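/- Assume setting (†). Let (T, M) be an uncountable local ring containing the rationals with |T| = |T/M|. Let Q₁, Q₂ ∈ Spec(T) with Q₁ ⊄ Q₂ and Q₂ ⊄ Q₁ such that the localizations T_{Q₁} and T_{Q₂} are catenary. Let T̄ = T/(Q₁ ∩ Q₂), Q̄ᵢ = Qᵢ/(Q₁ ∩ Q₂), Q̄ᵢᵉ = Q̄ᵢ·T̄[[y₁, …, yₙ]], and assume there is a ring isomorphism φ : T → T̄[[y₁, …, yₙ]]/I·T̄[[y₁, …, yₙ]] satisfying φ(Q₁) = (Q̄₁ᵉ, y₁, …, yₙ)/I·T̄[[y₁, …, yₙ]] and φ(Q₂) = (Q̄₂ᵉ, y₁, …, yₙ)/I·T̄[[y₁, …, yₙ]]. Then there exists an uncountable local subring (B, B ∩ M) of T containing the rationals such that: (1) the completion of B is isomorphic to the completion of T; (2) |B| = |B/(B ∩ M)|; (3) B ∩ Q₁ = B ∩ Q₂; (4) the localization B_{B ∩ Q₁} is catenary; (5) B ≅ R[[y₁, …, yₙ]]/I·R[[y₁, …, yₙ]] for some integral domain R containing the rationals; (6) the map f : Spec(T/(Q₁ ∩ Q₂)) → Spec(B/(B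 ∩ Q₁)) given by f(P/(Q₁ ∩ Q₂)) = (B ∩ P)/(B ∩ Q₁) is a bijection when restricted to prime ideals of positive height; (7) for each i ∈ {1, 2} there is a coheight-preserving bijection between the minimal prime ideals of T_{Qᵢ} and the minimal prime ideals of B_{B ∩ Q₁}; (8) if T is quasi-excellent, then B is quasi-excellent. -/

import Mathlib

/-!
The main theorem (Theorem 3.3 of the paper): gluing two incomparable primes `Q₁`, `Q₂`
of a local ring `T` in a precompletion `B` of `T`, preserving the completion, the prime
spectrum above the glued prime, coheights of minimal primes below `Q₁` and `Q₂`, and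
quasi-excellence.

Conventions: a "local ring" is a commutative Noetherian ring with exactly one maximal
ideal; completions are maximal-ideal-adic completions; `A[[y₁, …, yₙ]]` is modeled as
`MvPowerSeries (Fin n) A`.  The height of a prime is the height of the corresponding
point of the prime spectrum; the coheight of a prime `P` of `A` is `ringKrullDim (A ⧸ P)`.
Catenary rings and quasi-excellent rings are defined below.
-/

universe u

open IsLocalRing

/-- The extension of an ideal `J` of `ℚ[[y₁, …, yₙ]]` to `A[[y₁, …, yₙ]]`, for a
`ℚ`-algebra `A`. -/
noncomputable def Ideal.psExt (n : ℕ) (A : Type u) [CommRing A] [Algebra ℚ A]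
    (J : Ideal (MvPowerSeries (Fin n) ℚ)) : Ideal (MvPowerSeries (Fin n) A) :=
  J.map (MvPowerSeries.map (σ := Fin n) (algebraMap ℚ A))

/-- The extension of an ideal `a` of `A` to the power series ring `A[[y₁, …, yₙ]]`. -/
noncomputable def Ideal.constExt (n : ℕ) {A : Type u} [CommRing A] (a : Ideal A) :
    Ideal (MvPowerSeries (Fin n) A) :=
  a.map (MvPowerSeries.C (σ := Fin n) (R := A))

/-- A commutative ring is *catenary* if any two saturated chains of prime ideals with
the same (finite) endpoints have the same length.  Saturated chains of primes are
formalized as `RelSeries` for the covering relation `⋖` on the prime spectrum. -/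
def IsCatenaryRing (A : Type u) [CommRing A] : Prop :=
  ∀ c₁ c₂ : RelSeries {(P, Q) : PrimeSpectrum A × PrimeSpectrum A | P ⋖ Q},
    c₁.head = c₂.head → c₁.last = c₂.last → c₁.length = c₂.length

/-- A commutative ring is a *regular local ring* if it is Noetherian, local, and its
maximal ideal can be generated by `d` elements, where `d` is its Krull dimension. -/
def IsRegularLocalRing' (A : Type u) [CommRing A] : Prop :=
  ∃ h : IsLocalRing A,
    letI := h
    IsNoetherianRing A ∧
      ∃ s : Finset A, Ideal.span (s : Set A) = IsLocalRing.maximalIdeal A ∧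
        (s.card : WithBot (WithTop ℕ)) = ringKrullDim A

/-- A commutative ring is *regular* if it is Noetherian and all of its localizations at
primes are regular local rings. -/
def IsRegularRing' (A : Type u) [CommRing A] : Prop :=
  IsNoetherianRing A ∧
    ∀ (p : Ideal A) (hp : p.IsPrime),
      letI := hp
      IsRegularLocalRing' (Localization.AtPrime p)

/-- An algebra `A` over a field `k` is *geometrically regular* if `L ⊗[k] A` is a
regular ring for every finite field extension `L` of `k`. -/
def Algebra.IsGeometricallyRegular (k : Type u) (A : Type u) [Field k] [CommRing A]
    [Algebra k A] : Prop :=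
  ∀ (L : Type u) [Field L] [Algebra k L] [Module.Finite k L],
    IsRegularRing' (TensorProduct k L A)

/-- An algebra `S` over `R` has *geometrically regular fibers* if for every prime `p`
of `R` the fiber ring `κ(p) ⊗[R] S` is geometrically regular over the residue field
`κ(p)`. -/
def Algebra.HasGeometricallyRegularFibers (R S : Type u) [CommRing R] [CommRing S]
    [Algebra R S] : Prop :=
  ∀ (p : Ideal R) (hp : p.IsPrime),
    letI := hp
    Algebra.IsGeometricallyRegular (IsLocalRing.ResidueField (Localization.AtPrime p))
      (TensorProduct R (IsLocalRing.ResidueField (Localization.AtPrime p)) S)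

/-- A (Noetherian) commutative ring is a *G-ring* if, for every prime `q`, the formal
fibers of the local ring `A_q` (i.e. the fibers of the map from `A_q` to its
maximal-ideal-adic completion) are geometrically regular. -/
def IsGRing (A : Type u) [CommRing A] : Prop :=
  ∀ (q : Ideal A) (hq : q.IsPrime),
    letI := hq
    Algebra.HasGeometricallyRegularFibers (Localization.AtPrime q)
      (AdicCompletion (IsLocalRing.maximalIdeal (Localization.AtPrime q))
        (Localization.AtPrime q))

/-- A commutative ring `A` is *J-2* if the regular locus of every finitely generated
`A`-algebra is open in its prime spectrum. -/
def IsJ2Ring (A : Type u) [CommRing A] : Prop :=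
  ∀ (C : Type u) [CommRing C] [Algebra A C], Algebra.FiniteType A C →
    IsOpen {p : PrimeSpectrum C | IsRegularLocalRing' (Localization.AtPrime p.asIdeal)}

/-- A commutative ring is *quasi-excellent* if it is Noetherian, a G-ring, and J-2. -/
def IsQuasiExcellentRing (A : Type u) [CommRing A] : Prop :=
  IsNoetherianRing A ∧ IsGRing A ∧ IsJ2Ring A

section

open CategoryTheory TensorProduct

/-- Projective dimension at most `k`, for unbundled modules. -/
def PDLE (A : Type u) [CommRing A] (k : ℕ) (M : Type u) [AddCommGroup M] [Module A M] : Prop :=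
  HasProjectiveDimensionLE (ModuleCat.of A M) k

section PDLE

variable {A : Type u} [CommRing A] {M N F : Type u} [AddCommGroup M] [Module A M]
  [AddCommGroup N] [Module A N] [AddCommGroup F] [Module A F]

lemma pdle_zero_iff : PDLE A 0 M ↔ Module.Projective A M := by
  rw [PDLE, ← projective_iff_hasProjectiveDimensionLE_zero, ← IsProjective.iff_projective]

lemma PDLE.mono {k l : ℕ} (h : PDLE A k M) (hkl : k ≤ l) : PDLE A l M := by
  unfold PDLE at *
  exact hasProjectiveDimensionLT_of_ge _ (k + 1) (l + 1) (by omega)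

lemma PDLE.of_linearEquiv {k : ℕ} (e : M ≃ₗ[A] N) (h : PDLE A k M) : PDLE A k N := by
  unfold PDLE at *
  exact hasProjectiveDimensionLT_of_iso e.toModuleIso _

lemma PDLE.of_retract {k : ℕ} (i : M →ₗ[A] N) (r : N →ₗ[A] M) (hri : r ∘ₗ i = LinearMap.id)
    (h : PDLE A k N) : PDLE A k M := by
  unfold PDLE at *
  have : Retract (ModuleCat.of A M) (ModuleCat.of A N) :=
    ⟨ModuleCat.ofHom i, ModuleCat.ofHom r, by rw [← ModuleCat.ofHom_comp, hri]; rfl⟩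
  exact this.hasProjectiveDimensionLT _

lemma pdle_succ_iff_of_exact {k : ℕ} [Module.Projective A F] (i : N →ₗ[A] F) (f : F →ₗ[A] M)
    (hi : Function.Injective i) (hf : Function.Surjective f) (hif : Function.Exact i f) :
    PDLE A (k + 1) M ↔ PDLE A k N := by
  let S : ShortComplex (ModuleCat.{u} A) :=
    ShortComplex.mk (ModuleCat.ofHom i) (ModuleCat.ofHom f) (by
      rw [← ModuleCat.ofHom_comp, hif.linearMap_comp_eq_zero]; rfl)
  have hS : S.ShortExact := 
    { exact := by
        rw [ShortComplex.ShortExact.moduleCat_exact_iff_function_exact]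
        exact hif
      mono_f := (ModuleCat.mono_iff_injective _).mpr hi
      epi_g := (ModuleCat.epi_iff_surjective _).mpr hf }
  have : Projective S.X₂ := (IsProjective.iff_projective (R := A) F).mp inferInstance
  exact hS.hasProjectiveDimensionLT_X₃_iff k this

lemma pdle_succ_iff {k : ℕ} [Module.Projective A F] (f : F →ₗ[A] M)
    (hf : Function.Surjective f) : PDLE A (k + 1) M ↔ PDLE A k (LinearMap.ker f) :=
  pdle_succ_iff_of_exact (LinearMap.ker f).subtype f (Submodule.subtype_injective _) hf
    (LinearMap.exact_subtype_ker_map f)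

end PDLE

section PDLE
open TensorProduct
variable {A : Type u} [CommRing A]

lemma PDLE.baseChange {A' : Type u} [CommRing A'] [Algebra A A'] [Module.Flat A A']
    [IsNoetherianRing A] {k : ℕ} {M : Type u} [AddCommGroup M] [Module A M] [Module.Finite A M]
    (h : PDLE A k M) : PDLE A' k (A' ⊗[A] M) := by
  induction k generalizing M with
  | zero =>
    rw [pdle_zero_iff] at h ⊢
    infer_instance
  | succ k ih =>
    obtain ⟨n, f, hf⟩ := Module.Finite.exists_fin' A M
    rw [pdle_succ_iff f hf] at h
    have h' := ih h
    refine (pdle_succ_iff_of_exact ((LinearMap.ker f).subtype.baseChange A') (f.baseChange A')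
      ?_ ?_ ?_).mpr h'
    · exact Module.Flat.lTensor_preserves_injective_linearMap _ (Submodule.subtype_injective _)
    · exact LinearMap.lTensor_surjective A' hf
    · exact lTensor_exact A' (LinearMap.exact_subtype_ker_map f) hf

lemma PDLE.of_baseChange {A' : Type u} [CommRing A'] [Algebra A A'] [Module.FaithfullyFlat A A']
    [IsNoetherianRing A] {k : ℕ} {M : Type u} [AddCommGroup M] [Module A M] [Module.Finite A M]
    (h : PDLE A' k (A' ⊗[A] M)) : PDLE A k M := by
  induction k generalizing M with
  | zero =>
    rw [pdle_zero_iff] at h ⊢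
    have : Module.Flat A M := by
      exact (Module.Flat.iff_flat_tensorProduct A M A').mp inferInstance
    have : Module.FinitePresentation A M := Module.finitePresentation_of_finite A M
    exact Module.Flat.projective_of_finitePresentation
  | succ k ih =>
    obtain ⟨n, f, hf⟩ := Module.Finite.exists_fin' A M
    rw [pdle_succ_iff f hf]
    apply ih
    refine (pdle_succ_iff_of_exact ((LinearMap.ker f).subtype.baseChange A') (f.baseChange A')
      ?_ ?_ ?_).mp h
    · exact Module.Flat.lTensor_preserves_injective_linearMap _ (Submodule.subtype_injective _)
    · exact LinearMap.lTensor_surjective A' hf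
    · exact lTensor_exact A' (LinearMap.exact_subtype_ker_map f) hf

open Pointwise in
/-- Passing to the quotient by an element regular on the quotient module. -/
lemma pdle_quotSMulTop_succ_iff {x : A} {k : ℕ} {M N F : Type u} [AddCommGroup M] [Module A M]
    [AddCommGroup N] [Module A N] [AddCommGroup F] [Module A F] [Module.Free A F]
    (hx : IsSMulRegular M x) (i : N →ₗ[A] F) (f : F →ₗ[A] M)
    (hi : Function.Injective i) (hf : Function.Surjective f) (hif : Function.Exact i f) :
    PDLE (A ⧸ Ideal.span {x}) (k + 1) (QuotSMulTop x M) ↔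
      PDLE (A ⧸ Ideal.span {x}) k (QuotSMulTop x N) := by
  have hs : Function.Surjective (algebraMap A (A ⧸ Ideal.span {x})) := Ideal.Quotient.mk_surjective
  refine pdle_succ_iff_of_exact
    ((QuotSMulTop.map x i).extendScalarsOfSurjective hs)
    ((QuotSMulTop.map x f).extendScalarsOfSurjective hs) ?_ ?_ ?_
  · change Function.Injective (QuotSMulTop.map x i)
    rw [injective_iff_map_eq_zero]
    intro z hz
    obtain ⟨z, rfl⟩ := Submodule.mkQ_surjective _ z
    simp only [Submodule.mkQ_apply, QuotSMulTop.map_apply_mk] at hz ⊢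
    rw [Submodule.Quotient.mk_eq_zero] at hz ⊢
    obtain ⟨w, -, hw⟩ := (Submodule.mem_smul_pointwise_iff_exists _ _ _).mp hz
    have h0 : f w = 0 := by
      apply hx
      simp only [smul_zero]
      rw [← map_smul, hw]
      exact hif.apply_apply_eq_zero z
    obtain ⟨v, rfl⟩ := (hif w).mp h0
    refine (Submodule.mem_smul_pointwise_iff_exists _ _ _).mpr ⟨v, trivial, hi ?_⟩
    rw [map_smul, hw]
  · exact QuotSMulTop.map_surjective x hf
  · exact QuotSMulTop.map_exact x hif hf

lemma isSMulRegular_fin {x : A} (hx : IsSMulRegular A x) (n : ℕ) : IsSMulRegular (Fin n → A) x :=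
  fun _ _ h => funext fun j => hx (congrFun h j)

variable [IsLocalRing A] [IsNoetherianRing A]

lemma pdle_quotSMulTop_iff {x : A} (hxA : IsSMulRegular A x) (hxm : x ∈ maximalIdeal A) {k : ℕ}
    {M : Type u} [AddCommGroup M] [Module A M] [Module.Finite A M] (hx : IsSMulRegular M x) :
    PDLE (A ⧸ Ideal.span {x}) k (QuotSMulTop x M) ↔ PDLE A k M := by
  have : IsLocalRing (A ⧸ Ideal.span {x}) := by
    have : Nontrivial (A ⧸ Ideal.span {x}) := Ideal.Quotient.nontrivial_iff.mpr
      (ne_top_of_le_ne_top (maximalIdeal.isMaximal A).ne_top (by simpa))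
    exact IsLocalRing.of_surjective' (Ideal.Quotient.mk _) Ideal.Quotient.mk_surjective
  induction k generalizing M with
  | zero =>
    rw [pdle_zero_iff, pdle_zero_iff]
    have hfp : Module.FinitePresentation A M := Module.finitePresentation_of_finite A M
    have key := Module.free_quotSMulTop_iff_free A M (x := x)
      (by rw [IsLocalRing.jacobson_eq_maximalIdeal _ bot_ne_top]; exact hxm) hx
    have : Module.Finite (A ⧸ Ideal.span {x}) (QuotSMulTop x M) :=
      Module.Finite.of_restrictScalars_finite A _ _
    constructor
    · intro h
      have : Module.Free (A ⧸ Ideal.span {x}) (QuotSMulTop x M) :=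
        Module.free_of_flat_of_isLocalRing
      have := key.mp this
      infer_instance
    · intro h
      have : Module.Free A M := Module.free_of_flat_of_isLocalRing
      have := key.mpr this
      infer_instance
  | succ k ih =>
    obtain ⟨n, f, hf⟩ := Module.Finite.exists_fin' A M
    rw [pdle_succ_iff f hf, pdle_quotSMulTop_succ_iff hx (LinearMap.ker f).subtype f
      (Submodule.subtype_injective _) hf (LinearMap.exact_subtype_ker_map f)]
    exact ih ((isSMulRegular_fin hxA n).of_injective _
      (Submodule.subtype_injective (LinearMap.ker f)))
end PDLE

section RegularLocal

lemma IsRegularLocalRing.of_span {A : Type*} [CommRing A] [IsLocalRing A] [IsNoetherianRing A]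
    (s : Set A) (hs : s.Finite) (h : Ideal.span s = maximalIdeal A) (d : ℕ) (hd : s.ncard ≤ d)
    (hdim : (d : WithBot ℕ∞) ≤ ringKrullDim A) : IsRegularLocalRing A := by
  apply IsRegularLocalRing.of_spanFinrank_maximalIdeal_le
  refine le_trans ?_ hdim
  rw [← h]
  exact_mod_cast (Submodule.spanFinrank_span_le_ncard_of_finite hs).trans hd

lemma isRegularLocalRing'_iff {A : Type u} [CommRing A] :
    IsRegularLocalRing' A ↔ IsRegularLocalRing A := by
  constructor
  · rintro ⟨h, hN, s, hs, hc⟩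
    refine IsRegularLocalRing.of_span (s : Set A) s.finite_toSet hs s.card (by simp) ?_
    exact hc.le
  · intro h
    refine ⟨h.toIsLocalRing, inferInstance, ?_⟩
    have hfg : Submodule.FG (maximalIdeal A) := IsNoetherian.noetherian _
    refine ⟨hfg.finite_generators.toFinset, ?_, ?_⟩
    · rw [Set.Finite.coe_toFinset]; exact (maximalIdeal A).span_generators
    · rw [← Set.ncard_eq_toFinset_card _ hfg.finite_generators, hfg.generators_ncard]
      exact h.spanFinrank_maximalIdeal

lemma IsRegularLocalRing.exists_natCast_eq (A : Type*) [CommRing A] [IsRegularLocalRing A] :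
    ∃ d : ℕ, ringKrullDim A = d := ⟨_, (IsRegularLocalRing.spanFinrank_maximalIdeal (R := A)).symm⟩

/-- Elements of the maximal ideal that are independent modulo its square can be completed to a
generating set of the expected size. -/
lemma IsLocalRing.exists_complement_generators {A : Type*} [CommRing A] [IsLocalRing A]
    [IsNoetherianRing A] {r : ℕ} (f : Fin r → A) (hf : ∀ i, f i ∈ maximalIdeal A)
    (hind : ∀ c : Fin r → A, ∑ i, c i * f i ∈ maximalIdeal A ^ 2 → ∀ i, c i ∈ maximalIdeal A) :
    ∃ g : Fin ((maximalIdeal A).spanFinrank - r) → A, r ≤ (maximalIdeal A).spanFinrank ∧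
      Ideal.span (Set.range f ∪ Set.range g) = maximalIdeal A := by
  let v : Fin r → CotangentSpace A := fun i => (maximalIdeal A).toCotangent ⟨f i, hf i⟩
  have hv : LinearIndependent (ResidueField A) v := by
    rw [Fintype.linearIndependent_iff]
    intro c hc i
    choose c' hc' using fun i => residue_surjective (R := A) (c i)
    rw [← hc', residue_eq_zero_iff]
    refine hind c' ?_ i
    have h0 : (maximalIdeal A).toCotangent (∑ i, c' i • ⟨f i, hf i⟩) = 0 := by
      rw [map_sum, ← hc]
      refine Finset.sum_congr rfl fun i _ => ?_
      rw [map_smul, ← hc']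
      rfl
    rw [Ideal.toCotangent_eq_zero] at h0
    simpa using h0
  set W := Submodule.span (ResidueField A) (Set.range v) with hW
  have hWr : Module.finrank (ResidueField A) W = r := by
    rw [finrank_span_eq_card hv, Fintype.card_fin]
  have hq := Submodule.finrank_quotient_add_finrank W
  rw [hWr, ← IsLocalRing.spanFinrank_maximalIdeal_eq_finrank_cotangentSpace] at hq
  have hq' : Module.finrank (ResidueField A) (CotangentSpace A ⧸ W) =
    (maximalIdeal A).spanFinrank - r := by omega
  let b := Module.finBasisOfFinrankEq (ResidueField A) (CotangentSpace A ⧸ W) hq'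
  choose w hw using fun j => Submodule.mkQ_surjective W (b j)
  choose g hg using fun j => (maximalIdeal A).toCotangent_surjective (w j)
  refine ⟨fun j => g j, by omega, ?_⟩
  have hspan : Submodule.span (ResidueField A) (Set.range v ∪ Set.range w) = ⊤ := by
    rw [Submodule.span_union, ← hW]
    have h1 : (Submodule.span (ResidueField A) (Set.range w)).map W.mkQ = ⊤ := by
      rw [Submodule.map_span, ← Set.range_comp]
      have : (W.mkQ ∘ w) = b := funext hw
      rw [this, b.span_eq]
    rw [← Submodule.map_mkQ_eq_top, h1]
  have h2 : Submodule.span A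
      (Set.range (fun i => (⟨f i, hf i⟩ : maximalIdeal A)) ∪ Set.range g) = ⊤ := by
    rw [← CotangentSpace.span_image_eq_top_iff, Set.image_union, ← Set.range_comp, ← Set.range_comp]
    convert! hspan using 3
    congr 1
    exact funext hg
  have h3 := congrArg (Submodule.map (maximalIdeal A).subtype) h2
  rw [Submodule.map_span, Set.image_union, ← Set.range_comp, ← Set.range_comp, Submodule.map_top,
    Submodule.range_subtype] at h3
  exact h3

lemma IsLocalRing.quotient_of_le {A : Type*} [CommRing A] [IsLocalRing A] {J : Ideal A}
    (h : J ≤ maximalIdeal A) : IsLocalRing (A ⧸ J) := by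
  have : Nontrivial (A ⧸ J) := Ideal.Quotient.nontrivial_iff.mpr
      (ne_top_of_le_ne_top (maximalIdeal.isMaximal A).ne_top h)
  exact IsLocalRing.of_surjective' (Ideal.Quotient.mk _) Ideal.Quotient.mk_surjective

lemma IsLocalRing.map_maximalIdeal_of_surjective' {A B : Type*} [CommRing A] [IsLocalRing A]
    [CommRing B]
    [IsLocalRing B] (f : A →+* B) (hf : Function.Surjective f) :
    (maximalIdeal A).map f = maximalIdeal B := by
  have hloc : IsLocalHom f := hf.isLocalHom
  rw [← IsLocalRing.maximalIdeal_comap f] 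
  exact Ideal.map_comap_of_surjective f hf _

lemma IsRegularLocalRing.quotient_span {A : Type*} [CommRing A] [IsRegularLocalRing A] {r : ℕ}
    (f : Fin r → A) (hf : ∀ i, f i ∈ maximalIdeal A)
    (hind : ∀ c : Fin r → A, ∑ i, c i * f i ∈ maximalIdeal A ^ 2 → ∀ i, c i ∈ maximalIdeal A) :
    IsRegularLocalRing (A ⧸ Ideal.span (Set.range f)) ∧
      ringKrullDim A = ringKrullDim (A ⧸ Ideal.span (Set.range f)) + r := by
  obtain ⟨g, hr, hg⟩ := IsLocalRing.exists_complement_generators f hf hind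
  have hle : Ideal.span (Set.range f) ≤ maximalIdeal A :=
    Ideal.span_le.mpr (by rintro _ ⟨i, rfl⟩; exact hf i)
  have := IsLocalRing.quotient_of_le hle
  have hmap : (maximalIdeal A).map (Ideal.Quotient.mk (Ideal.span (Set.range f))) =
      (Ideal.span (Set.range f ∪ Set.range g)).map (Ideal.Quotient.mk (Ideal.span (Set.range f))) :=
    congrArg _ hg.symm
  have hspan : Ideal.span
      (Set.range (fun j => Ideal.Quotient.mk (Ideal.span (Set.range f)) (g j))) =
      maximalIdeal (A ⧸ Ideal.span (Set.range f)) := by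
    rw [← IsLocalRing.map_maximalIdeal_of_surjective' (Ideal.Quotient.mk (Ideal.span (Set.range f)))
      Ideal.Quotient.mk_surjective, hmap, Ideal.span_union, Ideal.map_sup, Ideal.map_quotient_self,
      bot_sup_eq, Ideal.map_span, ← Set.range_comp]
    rfl
  have hcard : (Set.range (fun j => Ideal.Quotient.mk (Ideal.span (Set.range f)) (g j))).ncard ≤
      (maximalIdeal A).spanFinrank - r := by
    have := Finite.card_range_le (fun j => Ideal.Quotient.mk (Ideal.span (Set.range f)) (g j))
    simpa using this
  have hdim : ((maximalIdeal A).spanFinrank : WithBot ℕ∞) ≤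
      ringKrullDim (A ⧸ Ideal.span (Set.range f)) + r := by
    rw [IsRegularLocalRing.spanFinrank_maximalIdeal]
    refine (ringKrullDim_le_ringKrullDim_quotient_add_spanFinrank (Ideal.span (Set.range f))
      ?_).trans ?_
    · rw [IsLocalRing.ringJacobson_eq_maximalIdeal]; exact hle
    · gcongr
      have := Submodule.spanFinrank_span_le_ncard_of_finite (R := A) (Set.finite_range f)
      have h2 : (Set.range f).ncard ≤ r := by
        rw [← Set.image_univ]
        refine (Set.ncard_image_le Set.finite_univ).trans ?_
        simp [Set.ncard_univ]
      exact_mod_cast this.trans h2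
  have hdim' : (((maximalIdeal A).spanFinrank - r : ℕ) : WithBot ℕ∞) ≤
      ringKrullDim (A ⧸ Ideal.span (Set.range f)) := by
    have e : ((maximalIdeal A).spanFinrank : WithBot ℕ∞) =
      ((((maximalIdeal A).spanFinrank - r : ℕ) : WithBot ℕ∞)) + r := by
      exact_mod_cast (Nat.sub_add_cancel hr).symm
    rw [e] at hdim
    exact (ENat.WithBot.add_le_add_natCast_right_iff).mp hdim
  have hreg := IsRegularLocalRing.of_span _ (Set.finite_range _) hspan _ hcard hdim'
  refine ⟨hreg, le_antisymm ?_ ?_⟩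
  · rw [← IsRegularLocalRing.spanFinrank_maximalIdeal]; exact hdim
  · rw [← IsRegularLocalRing.spanFinrank_maximalIdeal,
      ← IsRegularLocalRing.spanFinrank_maximalIdeal]
    have h := Submodule.spanFinrank_span_le_ncard_of_finite (R := (A ⧸ Ideal.span (Set.range f)))
      (Set.finite_range (fun j => Ideal.Quotient.mk (Ideal.span (Set.range f)) (g j)))
    rw [← Ideal.span, hspan] at h
    have := h.trans hcard
    norm_cast
    omega
end RegularLocal

section RegularLocal

lemma IsLocalRing.exists_mem_maximalIdeal_notMem_sq {A : Type*} [CommRing A] [IsLocalRing A]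
    [IsNoetherianRing A] (hm : maximalIdeal A ≠ ⊥) (s : Set (Ideal A)) (hsf : s.Finite)
    (hs : ∀ p ∈ s, p.IsPrime ∧ ¬ maximalIdeal A ≤ p) :
    ∃ x ∈ maximalIdeal A, x ∉ maximalIdeal A ^ 2 ∧ ∀ p ∈ s, x ∉ p := by
  classical
  by_contra! hcon
  have hsub : ((maximalIdeal A : Ideal A) : Set A) ⊆
      ⋃ p ∈ ((insert (maximalIdeal A ^ 2) hsf.toFinset : Finset (Ideal A)) : Set (Ideal A)),
        ((p : Ideal A) : Set A) := by
    intro x hx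
    by_cases h2 : x ∈ maximalIdeal A ^ 2
    · exact Set.mem_biUnion (by simp) h2
    · obtain ⟨p, hp, hxp⟩ := hcon x hx h2
      exact Set.mem_biUnion (by simp [hp]) hxp
  have := (Ideal.subset_union_prime (f := fun p : Ideal A => p) (maximalIdeal A ^ 2)
    (maximalIdeal A ^ 2) (fun p hp h1 _ => by
      rcases Finset.mem_insert.mp hp with h | h
      · exact absurd h h1
      · exact (hs p (by simpa using h)).1)).mp hsub
  obtain ⟨p, hp, hle⟩ := this
  rcases Finset.mem_insert.mp hp with rfl | h
  · refine hm (Submodule.eq_bot_of_le_smul_of_le_jacobson_bot (maximalIdeal A) _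
      (IsNoetherian.noetherian _) ?_ (IsLocalRing.maximalIdeal_le_jacobson _))
    rw [smul_eq_mul, ← pow_two]; exact hle
  · exact (hs p (by simpa using h)).2 hle

lemma IsRegularLocalRing.quotient_span_singleton {A : Type*} [CommRing A] [IsRegularLocalRing A]
    {x : A} (hx : x ∈ maximalIdeal A) (hx2 : x ∉ maximalIdeal A ^ 2) :
    IsRegularLocalRing (A ⧸ Ideal.span {x}) ∧
      ringKrullDim A = ringKrullDim (A ⧸ Ideal.span {x}) + 1 := by
  have := IsRegularLocalRing.quotient_span (fun _ : Fin 1 => x) (fun _ => hx) (fun c hc i => by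
    by_contra hi
    obtain ⟨u, hu⟩ := not_not.mp ((mem_maximalIdeal _).not.mp hi)
    obtain rfl : i = 0 := Subsingleton.elim _ _
    simp only [Fin.sum_univ_one] at hc
    rw [← hu] at hc
    exact hx2 ((Ideal.unit_mul_mem_iff_mem _ u.isUnit).mp hc))
  rwa [Set.range_const, Nat.cast_one] at this

lemma IsLocalRing.maximalIdeal_eq_bot_of_ringKrullDim_eq_zero {A : Type*} [CommRing A]
    [IsRegularLocalRing A] (h : ringKrullDim A = 0) : maximalIdeal A = ⊥ := by
  have h1 := IsRegularLocalRing.spanFinrank_maximalIdeal (R := A)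
  rw [h] at h1
  exact (Submodule.spanFinrank_eq_zero_iff_eq_bot (IsNoetherian.noetherian _)).mp
    (by exact_mod_cast h1)

lemma IsLocalRing.maximalIdeal_ne_bot_of_ringKrullDim_ne_zero {A : Type*} [CommRing A]
    [IsLocalRing A] (h : ringKrullDim A ≠ 0) : maximalIdeal A ≠ ⊥ := fun h0 =>
  h (ringKrullDim_eq_zero_of_isField (IsLocalRing.isField_iff_maximalIdeal_eq.mpr h0))

lemma IsRegularLocalRing.isDomain (A : Type*) [CommRing A] [IsRegularLocalRing A] : IsDomain A := by
  obtain ⟨d, hd⟩ := IsRegularLocalRing.exists_natCast_eq A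
  induction d generalizing A with
  | zero =>
    exact (IsLocalRing.isField_iff_maximalIdeal_eq.mpr
      (IsLocalRing.maximalIdeal_eq_bot_of_ringKrullDim_eq_zero hd)).isDomain
  | succ d ih =>
    have hm := IsLocalRing.maximalIdeal_ne_bot_of_ringKrullDim_ne_zero (A := A) (by
      rw [hd]; exact_mod_cast Nat.succ_ne_zero d)
    obtain ⟨x, hx, hx2, hxp⟩ := IsLocalRing.exists_mem_maximalIdeal_notMem_sq hm (minimalPrimes A)
      (minimalPrimes.finite_of_isNoetherianRing A) (fun p hp => ⟨hp.1.1, fun hle => by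
        have : maximalIdeal A ∈ minimalPrimes A := by
          have hp' := hp.1.1
          rwa [le_antisymm hle (le_maximalIdeal hp'.ne_top)]
        have h0 := Ideal.height_eq_zero_iff.mpr this 
        have h1 := IsLocalRing.maximalIdeal_height_eq_ringKrullDim (R := A)
        rw [h0, hd] at h1
        norm_cast at h1⟩)
    obtain ⟨hreg, hdim⟩ := IsRegularLocalRing.quotient_span_singleton hx hx2
    have hd' : ringKrullDim (A ⧸ Ideal.span {x}) = d := by
      rw [hd] at hdim
      push_cast at hdim
      apply le_antisymm
      · exact (ENat.WithBot.add_le_add_natCast_right_iff (c := 1)).mp (by simpa using hdim.ge)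
      · exact (ENat.WithBot.add_le_add_natCast_right_iff (c := 1)).mp (by simpa using hdim.le)
    have hdom := ih _ hd'
    have hprime : (Ideal.span {x}).IsPrime := (Ideal.Quotient.isDomain_iff_prime _).mp hdom
    obtain ⟨p, hp, hpx⟩ :=
      Ideal.exists_minimalPrimes_le (I := (⊥ : Ideal A)) (J := Ideal.span {x}) bot_le
    have hpp : p.IsPrime := hp.1.1
    have hpbot : p = ⊥ := by
      refine Submodule.eq_bot_of_le_smul_of_le_jacobson_bot (maximalIdeal A) _
        (IsNoetherian.noetherian _) ?_ (IsLocalRing.maximalIdeal_le_jacobson _)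
      intro y hy
      obtain ⟨z, rfl⟩ := Ideal.mem_span_singleton'.mp (hpx hy)
      have hz := (hpp.mem_or_mem hy).resolve_right (hxp p hp)
      rw [mul_comm]
      exact Submodule.smul_mem_smul hx hz
    rw [hpbot] at hpp
    exact IsDomain.of_bot_isPrime A

lemma IsRegularLocalRing.pdle {A : Type u} [CommRing A] [IsRegularLocalRing A] {d : ℕ}
    (hd : ringKrullDim A = d) (M : Type u) [AddCommGroup M] [Module A M] [Module.Finite A M] :
    PDLE A d M := by
  induction d generalizing A M with
  | zero =>
    have hf := IsLocalRing.isField_iff_maximalIdeal_eq.mpr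
      (IsLocalRing.maximalIdeal_eq_bot_of_ringKrullDim_eq_zero hd)
    let := hf.toField
    rw [pdle_zero_iff]
    exact Module.Projective.of_free
  | succ d ih =>
    have hm := IsLocalRing.maximalIdeal_ne_bot_of_ringKrullDim_ne_zero (A := A) (by
      rw [hd]; exact_mod_cast Nat.succ_ne_zero d)
    obtain ⟨x, hx, hx2, -⟩ := IsLocalRing.exists_mem_maximalIdeal_notMem_sq hm ∅ Set.finite_empty
      (by simp)
    obtain ⟨hreg, hdim⟩ := IsRegularLocalRing.quotient_span_singleton hx hx2
    have hd' : ringKrullDim (A ⧸ Ideal.span {x}) = d := by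
      rw [hd] at hdim
      push_cast at hdim
      apply le_antisymm
      · exact (ENat.WithBot.add_le_add_natCast_right_iff (c := 1)).mp (by simpa using hdim.ge)
      · exact (ENat.WithBot.add_le_add_natCast_right_iff (c := 1)).mp (by simpa using hdim.le)
    have := IsRegularLocalRing.isDomain A
    have hx0 : x ≠ 0 := fun h => hx2 (h ▸ zero_mem _)
    have hxA : IsSMulRegular A x := fun a b h => mul_left_cancel₀ hx0 h
    obtain ⟨n, f, hf⟩ := Module.Finite.exists_fin' A M
    rw [pdle_succ_iff f hf]
    have hreg' := (isSMulRegular_fin hxA n).of_injective _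
      (Submodule.subtype_injective (LinearMap.ker f))
    rw [← pdle_quotSMulTop_iff hxA hx hreg']
    have := Module.Finite.of_restrictScalars_finite A (A ⧸ Ideal.span {x})
      (QuotSMulTop x (LinearMap.ker f))
    exact ih hd' _
end RegularLocal

section RegularLocal

lemma IsLocalRing.exists_surjective_ker_le {A : Type u} [CommRing A] [IsLocalRing A]
    (M : Type u) [AddCommGroup M] [Module A M] [Module.Finite A M] :
    ∃ (n : ℕ) (f : (Fin n → A) →ₗ[A] M), Function.Surjective f ∧
      ∀ v ∈ LinearMap.ker f, ∀ i, v i ∈ maximalIdeal A := by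
  let b := Module.finBasis (ResidueField A) (ResidueField A ⊗[A] M)
  choose w hw using fun i => TensorProduct.mk_surjective A M (ResidueField A)
    residue_surjective (b i)
  refine ⟨_, Fintype.linearCombination A w, ?_, ?_⟩
  · rw [← LinearMap.range_eq_top, Fintype.range_linearCombination]
    exact IsLocalRing.span_eq_top_of_tmul_eq_basis w b hw
  · intro v hv i
    have h0 : ∑ i, residue A (v i) • b i = 0 := by
      have := congrArg (TensorProduct.mk A (ResidueField A) M 1) (LinearMap.mem_ker.mp hv)
      rw [Fintype.linearCombination_apply, map_sum, map_zero] at this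
      rw [← this]
      refine Finset.sum_congr rfl fun i _ => ?_
      rw [← hw i, map_smul]
      rfl
    have := Fintype.linearIndependent_iff.mp b.linearIndependent _ h0 i
    rwa [residue_eq_zero_iff] at this

lemma Module.Free.subsingleton_of_smul_eq_zero {A : Type*} [CommRing A] {N : Type*} [AddCommGroup N]
    [Module A N] [Module.Free A N] {s : A} (hs : s ≠ 0) (h : ∀ v : N, s • v = 0) :
    Subsingleton N := by
  let b := Module.Free.chooseBasis A N
  have : IsEmpty (Module.Free.ChooseBasisIndex A N) := ⟨fun i => hs (by
    have := congrArg (fun z => b.repr z i) (h (b i))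
    simpa using this)⟩
  exact b.repr.toEquiv.subsingleton

lemma PDLE.free_of_socle {A : Type u} [CommRing A] [IsLocalRing A] [IsNoetherianRing A] {s : A}
    (hs0 : s ≠ 0) (hs : ∀ a ∈ maximalIdeal A, s * a = 0) {k : ℕ} {M : Type u} [AddCommGroup M]
    [Module A M] [Module.Finite A M] (h : PDLE A k M) : Module.Free A M := by
  induction k generalizing M with
  | zero =>
    rw [pdle_zero_iff] at h
    exact Module.free_of_flat_of_isLocalRing
  | succ k ih =>
    obtain ⟨n, f, hf, hker⟩ := IsLocalRing.exists_surjective_ker_le (A := A) M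
    rw [pdle_succ_iff f hf] at h
    have hfree := ih h
    have hsub : Subsingleton (LinearMap.ker f) :=
      Module.Free.subsingleton_of_smul_eq_zero hs0 (fun v => Subtype.ext (funext fun i =>
        hs _ (hker v v.2 i)))
    have hinj : Function.Injective f := by
      rw [← LinearMap.ker_eq_bot, ← Submodule.subsingleton_iff_eq_bot]
      exact hsub
    exact Module.Free.of_equiv (LinearEquiv.ofBijective f ⟨hinj, hf⟩)

open Pointwise in
/-- The residue field is a retract of `𝔪 / x𝔪` when `x ∈ 𝔪 \ 𝔪²`. -/
lemma IsLocalRing.exists_retract_residueField {A : Type u} [CommRing A] [IsLocalRing A]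
    {x : A} (hx : x ∈ maximalIdeal A) (hx2 : x ∉ maximalIdeal A ^ 2)
    [IsLocalRing (A ⧸ Ideal.span {x})] :
    ∃ (i : ResidueField (A ⧸ Ideal.span {x}) →ₗ[A ⧸ Ideal.span {x}] QuotSMulTop x (maximalIdeal A))
      (r : QuotSMulTop x (maximalIdeal A) →ₗ[A ⧸ Ideal.span {x}]
        ResidueField (A ⧸ Ideal.span {x})), r ∘ₗ i = LinearMap.id := by
  have hs : Function.Surjective (algebraMap A (A ⧸ Ideal.span {x})) := Ideal.Quotient.mk_surjective
  have hmap := IsLocalRing.map_maximalIdeal_of_surjective' (algebraMap A (A ⧸ Ideal.span {x})) hs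
  let ξ : QuotSMulTop x (maximalIdeal A) := Submodule.Quotient.mk ⟨x, hx⟩
  let i₀ : (A ⧸ Ideal.span {x}) →ₗ[A ⧸ Ideal.span {x}] QuotSMulTop x (maximalIdeal A) :=
    LinearMap.toSpanSingleton _ _ ξ
  have hi₀ : (maximalIdeal (A ⧸ Ideal.span {x}) : Submodule _ _) ≤ LinearMap.ker i₀ := by
    rw [← hmap]
    refine Ideal.map_le_iff_le_comap.mpr fun a ha => ?_
    rw [Ideal.mem_comap]
    change i₀ (algebraMap A _ a) = 0
    rw [LinearMap.toSpanSingleton_apply, algebraMap_smul]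
    change Submodule.Quotient.mk (a • (⟨x, hx⟩ : maximalIdeal A)) = 0
    rw [Submodule.Quotient.mk_eq_zero]
    exact (Submodule.mem_smul_pointwise_iff_exists _ _ _).mpr
      ⟨⟨a, ha⟩, trivial, Subtype.ext (mul_comm x a)⟩
  let i : ResidueField (A ⧸ Ideal.span {x}) →ₗ[A ⧸ Ideal.span {x}]
      QuotSMulTop x (maximalIdeal A) := Submodule.liftQ _ i₀ hi₀
  have hv : (maximalIdeal A).toCotangent ⟨x, hx⟩ ≠ 0 := fun h =>
    hx2 ((Ideal.toCotangent_eq_zero _ _).mp h)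
  obtain ⟨l, hl⟩ :=
    Module.Projective.exists_dual_ne_zero (ResidueField A) (V := CotangentSpace A) hv
  let l' : CotangentSpace A →ₗ[A] ResidueField A :=
    ((l ((maximalIdeal A).toCotangent ⟨x, hx⟩))⁻¹ • l).restrictScalars A
  let g : ResidueField A →ₗ[A] ResidueField (A ⧸ Ideal.span {x}) :=
    Submodule.liftQ (maximalIdeal A) (Algebra.linearMap A (ResidueField (A ⧸ Ideal.span {x}))) (by
      intro a ha
      rw [LinearMap.mem_ker, Algebra.linearMap_apply,
        IsScalarTower.algebraMap_apply A (A ⧸ Ideal.span {x})]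
      refine (residue_eq_zero_iff _).mpr ?_
      rw [← hmap]
      exact Ideal.mem_map_of_mem _ ha)
  let r₀ : maximalIdeal A →ₗ[A] ResidueField (A ⧸ Ideal.span {x}) :=
    g ∘ₗ l' ∘ₗ (maximalIdeal A).toCotangent
  have hr₀ : x • (⊤ : Submodule A (maximalIdeal A)) ≤ LinearMap.ker r₀ := by
    intro z hz
    obtain ⟨w, -, rfl⟩ := (Submodule.mem_smul_pointwise_iff_exists _ _ _).mp hz
    rw [LinearMap.mem_ker, map_smul, algebra_compatible_smul (A ⧸ Ideal.span {x}) x]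
    have : algebraMap A (A ⧸ Ideal.span {x}) x = 0 :=
      Ideal.Quotient.eq_zero_iff_mem.mpr (Ideal.mem_span_singleton_self x)
    rw [this, zero_smul]
  let r := (Submodule.liftQ _ r₀ hr₀).extendScalarsOfSurjective hs
  refine ⟨i, r, ?_⟩
  have h1 : r (i 1) = 1 := by
    have : i 1 = ξ := by
      change i₀ 1 = ξ
      rw [LinearMap.toSpanSingleton_apply, one_smul]
    rw [this]
    change g ((l ((maximalIdeal A).toCotangent ⟨x, hx⟩))⁻¹ •
      l ((maximalIdeal A).toCotangent ⟨x, hx⟩)) = 1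
    rw [smul_eq_mul, inv_mul_cancel₀ hl]
    change algebraMap A _ 1 = 1
    exact map_one _
  ext z
  obtain ⟨a, rfl⟩ := residue_surjective z
  have hz : residue (A ⧸ Ideal.span {x}) a = a • (1 : ResidueField (A ⧸ Ideal.span {x})) := by
    rw [Algebra.smul_def, mul_one]
    rfl
  rw [hz, map_smul, LinearMap.comp_apply, h1, map_smul]
  rfl

end RegularLocal

section RegularLocal

lemma IsRegularLocalRing.of_maximalIdeal_eq_bot {A : Type*} [CommRing A] [IsLocalRing A]
    [IsNoetherianRing A] (h : maximalIdeal A = ⊥) : IsRegularLocalRing A :=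
  IsRegularLocalRing.of_span ∅ Set.finite_empty (by simp [h]) 0 (by simp)
    (by simpa using ringKrullDim_nonneg_of_nontrivial)

lemma IsRegularLocalRing.of_quotient_span_singleton {A : Type u} [CommRing A] [IsLocalRing A]
    [IsNoetherianRing A] {x : A} (hx : x ∈ maximalIdeal A) (hreg : IsSMulRegular A x)
    (h : IsRegularLocalRing (A ⧸ Ideal.span {x})) : IsRegularLocalRing A := by
  classical
  obtain ⟨hl, -, s, hs, hc⟩ := isRegularLocalRing'_iff.mpr h
  have hsurj : Function.Surjective (Ideal.Quotient.mk (Ideal.span {x})) :=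
    Ideal.Quotient.mk_surjective
  let g := Function.surjInv hsurj
  have hg : ∀ z, Ideal.Quotient.mk (Ideal.span {x}) (g z) = z := Function.surjInv_eq hsurj
  refine IsRegularLocalRing.of_span ((insert x (s.image g) : Finset A) : Set A)
    (Finset.finite_toSet _) ?_ (s.card + 1) ?_ ?_
  · refine le_antisymm (Ideal.span_le.mpr ?_) fun a ha => ?_
    · intro a ha
      rw [Finset.mem_coe, Finset.mem_insert, Finset.mem_image] at ha
      rcases ha with rfl | ⟨z, hz, rfl⟩
      · exact hx
      · have : z ∈ maximalIdeal _ := hs ▸ Ideal.subset_span hz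
        rw [← hg z, ← IsLocalRing.map_maximalIdeal_of_surjective' _ hsurj] at this
        exact (Ideal.mem_quotient_iff_mem
          (by simpa [Ideal.span_singleton_le_iff_mem] using hx)).mp this
    · have h1 : Ideal.Quotient.mk (Ideal.span {x}) a ∈ Ideal.span (s : Set _) := by
        rw [hs, ← IsLocalRing.map_maximalIdeal_of_surjective' _ hsurj]
        exact Ideal.mem_map_of_mem _ ha
      have h2 : (s : Set (A ⧸ Ideal.span {x})) =
          Ideal.Quotient.mk (Ideal.span {x}) '' ((s.image g : Finset A) : Set A) := by
        rw [Finset.coe_image, Set.image_image]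
        simp [hg]
      rw [h2, ← Ideal.map_span] at h1
      obtain ⟨b, hb, hab⟩ := (Ideal.mem_map_iff_of_surjective _ hsurj).mp h1
      have h3 := Ideal.Quotient.eq.mp hab.symm
      rw [← sub_add_cancel a b]
      refine add_mem (Ideal.span_mono ?_ h3) (Ideal.span_mono ?_ hb) <;> simp
  · rw [Set.ncard_coe_finset]
    exact (Finset.card_insert_le _ _).trans (Nat.add_le_add_right Finset.card_image_le 1)
  · rw [← ringKrullDim_quotient_span_singleton_succ_eq_ringKrullDim hreg hx, ← hc]
    push_cast
    exact le_rfl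

lemma IsLocalRing.exists_ringKrullDim_eq_natCast (A : Type*) [CommRing A] [IsLocalRing A]
    [IsNoetherianRing A] : ∃ d : ℕ, ringKrullDim A = d := by
  obtain ⟨d, hd⟩ := WithBot.ne_bot_iff_exists.mp (ringKrullDim_ne_bot (R := A))
  have : d ≠ ⊤ := by
    rintro rfl
    exact (ringKrullDim_lt_top (R := A)).ne hd.symm
  lift d to ℕ using this
  exact ⟨d, hd.symm⟩

/-- A Noetherian local ring whose residue field has finite projective dimension is regular. -/
theorem IsRegularLocalRing.of_pdle_residueField {A : Type u} [CommRing A] [IsLocalRing A]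
    [IsNoetherianRing A] {k : ℕ} (h : PDLE A k (ResidueField A)) : IsRegularLocalRing A := by
  obtain ⟨d, hd⟩ : ∃ d : ℕ, ringKrullDim A < d := by
    obtain ⟨d, hd⟩ := IsLocalRing.exists_ringKrullDim_eq_natCast A
    exact ⟨d + 1, by rw [hd]; exact_mod_cast d.lt_succ_self⟩
  induction d generalizing A with
  | zero => exact absurd hd (not_lt.mpr (by simpa using ringKrullDim_nonneg_of_nontrivial))
  | succ d ih =>
    by_cases hm : maximalIdeal A = ⊥
    · exact IsRegularLocalRing.of_maximalIdeal_eq_bot hm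
    by_cases hass : maximalIdeal A ∈ associatedPrimes A A
    · exfalso
      obtain ⟨-, s, hs⟩ := isAssociatedPrime_iff.mp hass
      have hmem : ∀ a, a ∈ maximalIdeal A ↔ a * s = 0 := fun a => by
        rw [hs, Submodule.mem_colon_singleton, Submodule.mem_bot, smul_eq_mul]
      have hs0 : s ≠ 0 := by
        rintro rfl
        exact (Ideal.ne_top_iff_one _).mp (maximalIdeal.isMaximal A).ne_top
          ((hmem 1).mpr (mul_zero 1))
      have hnt : Nontrivial (ResidueField A) :=
        Ideal.Quotient.nontrivial_iff.mpr (maximalIdeal.isMaximal A).ne_top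
      have : Module.Free A (ResidueField A) :=
        PDLE.free_of_socle hs0 (fun a ha => (mul_comm s a).trans ((hmem a).mp ha)) h
      obtain ⟨a, ha, ha0⟩ := Submodule.exists_mem_ne_zero_of_ne_bot hm
      have := Module.Free.subsingleton_of_smul_eq_zero (A := A) (N := ResidueField A) ha0
        fun v => by
          rw [Algebra.smul_def]
          exact mul_eq_zero_of_left ((residue_eq_zero_iff a).mpr ha) v
      exact false_of_nontrivial_of_subsingleton (ResidueField A)
    · obtain ⟨x, hx, hx2, hxp⟩ := IsLocalRing.exists_mem_maximalIdeal_notMem_sq hm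
        (associatedPrimes A A) (associatedPrimes.finite A A) fun p hp => ⟨hp.1, fun hle =>
          hass ((maximalIdeal.isMaximal A).eq_of_le hp.1.ne_top hle ▸ hp)⟩
      have hreg : IsSMulRegular A x := by
        by_contra hcon
        have : x ∈ {r : A | IsSMulRegular A r}ᶜ := hcon
        rw [← biUnion_associatedPrimes_eq_compl_regular A A] at this
        simp only [Set.mem_iUnion] at this
        obtain ⟨p, hp, hxp'⟩ := this
        exact hxp p hp hxp'
      have : IsLocalRing (A ⧸ Ideal.span {x}) :=
        IsLocalRing.quotient_of_le (by simpa [Ideal.span_singleton_le_iff_mem] using hx)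
      refine IsRegularLocalRing.of_quotient_span_singleton hx hreg (ih ?_ ?_)
      · obtain ⟨i, r, hri⟩ := IsLocalRing.exists_retract_residueField hx hx2
        refine PDLE.of_retract i r hri ?_
        rw [pdle_quotSMulTop_iff hreg hx
          (hreg.of_injective (Submodule.subtype _) (Submodule.subtype_injective _))]
        refine (pdle_succ_iff_of_exact (Submodule.subtype (maximalIdeal A))
          (Submodule.mkQ (maximalIdeal A)) (Submodule.subtype_injective _)
          (Submodule.mkQ_surjective _) ?_).mp (h.mono k.le_succ)
        exact LinearMap.exact_subtype_mkQ _
      · obtain ⟨e, he⟩ := IsLocalRing.exists_ringKrullDim_eq_natCast (A ⧸ Ideal.span {x})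
        rw [← ringKrullDim_quotient_span_singleton_succ_eq_ringKrullDim hreg hx, he] at hd
        rw [he]
        norm_cast at hd ⊢
        exact Nat.lt_of_succ_lt_succ hd
end RegularLocal

section RegularLocal

/-- **Serre's theorem**: a localization of a regular local ring at a prime is regular. -/
theorem IsRegularLocalRing.of_isLocalization_atPrime {A : Type u} [CommRing A]
    [IsRegularLocalRing A] (p : Ideal A) [p.IsPrime] (A' : Type u) [CommRing A'] [Algebra A A']
    [IsLocalization.AtPrime A' p] : IsRegularLocalRing A' := by
  obtain ⟨d, hd⟩ := IsRegularLocalRing.exists_natCast_eq A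
  have : IsLocalRing A' := IsLocalization.AtPrime.isLocalRing A' p
  have : IsNoetherianRing A' := IsLocalization.isNoetherianRing p.primeCompl A' inferInstance
  have : Module.Flat A A' := IsLocalization.flat A' p.primeCompl
  have h := (IsRegularLocalRing.pdle hd (A ⧸ p)).baseChange (A' := A')
  refine IsRegularLocalRing.of_pdle_residueField (k := d) (h.of_linearEquiv ?_)
  exact (Algebra.TensorProduct.quotIdealMapEquivTensorQuot A' p).symm.toLinearEquiv ≪≫ₗ
    Submodule.quotEquivOfEq _ _ (IsLocalization.AtPrime.map_eq_maximalIdeal p A')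

instance IsRegularLocalRing.isRegularRing {A : Type u} [CommRing A] [IsRegularLocalRing A] :
    IsRegularRing A :=
  isRegularRing_iff.mpr fun p _ => IsRegularLocalRing.of_isLocalization_atPrime p _

/-- Regularity descends along flat local homomorphisms. -/
theorem IsRegularLocalRing.of_flat {A A' : Type u} [CommRing A] [CommRing A'] [IsLocalRing A]
    [IsNoetherianRing A] [IsRegularLocalRing A'] (f : A →+* A') (hf : f.Flat) [IsLocalHom f] :
    IsRegularLocalRing A := by
  algebraize [f]
  have : IsLocalHom (algebraMap A A') := ‹IsLocalHom f›
  have : Module.FaithfullyFlat A A' := Module.FaithfullyFlat.of_flat_of_isLocalHom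
  obtain ⟨d, hd⟩ := IsRegularLocalRing.exists_natCast_eq A'
  exact IsRegularLocalRing.of_pdle_residueField (k := d)
    (PDLE.of_baseChange (A' := A') (IsRegularLocalRing.pdle hd _))

/-- A flat local homomorphism with regular source and regular closed fibre has regular target. -/
theorem IsRegularLocalRing.of_flat_of_quotient {A A' : Type u} [CommRing A] [CommRing A']
    [IsRegularLocalRing A] [IsLocalRing A'] [IsNoetherianRing A'] (f : A →+* A') (hf : f.Flat)
    [IsLocalHom f] (h : IsRegularLocalRing (A' ⧸ (maximalIdeal A).map f)) :
    IsRegularLocalRing A' := by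
  classical
  obtain ⟨hlA, -, s, hs, hsc⟩ := isRegularLocalRing'_iff.mpr ‹IsRegularLocalRing A›
  obtain ⟨hl, -, t, ht, htc⟩ := isRegularLocalRing'_iff.mpr h
  have hsurj : Function.Surjective (Ideal.Quotient.mk ((maximalIdeal A).map f)) :=
    Ideal.Quotient.mk_surjective
  have hle : (maximalIdeal A).map f ≤ maximalIdeal A' :=
    Ideal.map_le_iff_le_comap.mpr (IsLocalRing.maximalIdeal_comap f).ge
  let g := Function.surjInv hsurj
  have hg : ∀ z, Ideal.Quotient.mk ((maximalIdeal A).map f) (g z) = z :=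
    Function.surjInv_eq hsurj
  refine IsRegularLocalRing.of_span ((s.image f ∪ t.image g : Finset A') : Set A')
    (Finset.finite_toSet _) ?_ (s.card + t.card) ?_ ?_
  · refine le_antisymm (Ideal.span_le.mpr ?_) fun a ha => ?_
    · intro a ha
      rw [Finset.mem_coe, Finset.mem_union, Finset.mem_image, Finset.mem_image] at ha
      rcases ha with ⟨z, hz, rfl⟩ | ⟨z, hz, rfl⟩
      · exact hle (Ideal.mem_map_of_mem _ (hs ▸ Ideal.subset_span hz))
      · have : z ∈ maximalIdeal _ := ht ▸ Ideal.subset_span hz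
        rw [← hg z, ← IsLocalRing.map_maximalIdeal_of_surjective' _ hsurj] at this
        exact (Ideal.mem_quotient_iff_mem hle).mp this
    · have h1 : Ideal.Quotient.mk ((maximalIdeal A).map f) a ∈ Ideal.span (t : Set _) := by
        rw [ht, ← IsLocalRing.map_maximalIdeal_of_surjective' _ hsurj]
        exact Ideal.mem_map_of_mem _ ha
      have h2 : (t : Set (A' ⧸ (maximalIdeal A).map f)) =
          Ideal.Quotient.mk ((maximalIdeal A).map f) '' ((t.image g : Finset A') : Set A') := by
        rw [Finset.coe_image, Set.image_image]
        simp [hg]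
      rw [h2, ← Ideal.map_span] at h1
      obtain ⟨b, hb, hab⟩ := (Ideal.mem_map_iff_of_surjective _ hsurj).mp h1
      have h3 := Ideal.Quotient.eq.mp hab.symm
      rw [← hs, Ideal.map_span] at h3
      rw [← sub_add_cancel a b]
      refine add_mem (Ideal.span_mono ?_ h3) (Ideal.span_mono ?_ hb) <;> simp
  · rw [Set.ncard_coe_finset]
    exact (Finset.card_union_le _ _).trans
      (Nat.add_le_add Finset.card_image_le Finset.card_image_le)
  · algebraize [f]
    have : IsLocalHom (algebraMap A A') := ‹IsLocalHom f›
    have : Algebra.HasGoingDown A A' := inferInstance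
    have hlies : (maximalIdeal A').LiesOver (maximalIdeal A) :=
      ⟨(IsLocalRing.maximalIdeal_comap f).symm⟩
    have := Ideal.height_eq_height_add_of_liesOver_of_hasGoingDown (maximalIdeal A)
      (maximalIdeal A')
    rw [IsLocalRing.map_maximalIdeal_of_surjective' _ Ideal.Quotient.mk_surjective] at this
    rw [← IsLocalRing.maximalIdeal_height_eq_ringKrullDim, this]
    push_cast
    rw [IsLocalRing.maximalIdeal_height_eq_ringKrullDim,
      IsLocalRing.maximalIdeal_height_eq_ringKrullDim]
    exact (congrArg₂ (· + ·) hsc htc).le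
end RegularLocal

section RegAt

/-- A flat ring homomorphism stays flat after passing to the quotients by an ideal and its
extension. -/
theorem RingHom.Flat.quotientMap {A A' : Type u} [CommRing A] [CommRing A'] {f : A →+* A'}
    (hf : f.Flat) (J : Ideal A) :
    (Ideal.quotientMap (J.map f) f Ideal.le_comap_map).Flat := by
  algebraize [f]
  have h1 : Module.Flat (A ⧸ J) ((A ⧸ J) ⊗[A] A') := inferInstance
  let e := (Algebra.TensorProduct.quotIdealMapEquivTensorQuot A' J)
  let g : (A ⧸ J) ⊗[A] A' ≃ₐ[A] (A' ⧸ J.map (algebraMap A A')) :=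
    (Algebra.TensorProduct.comm _ _ _).trans (e.symm.restrictScalars A)
  have h2 : (algebraMap (A ⧸ J) ((A ⧸ J) ⊗[A] A')).Flat := RingHom.flat_algebraMap_iff.mpr h1
  have h3 := h2.comp (RingHom.Flat.of_bijective (f := g.toRingEquiv.toRingHom) g.bijective)
  refine (congrArg RingHom.Flat ?_).mpr h3
  refine Ideal.Quotient.ringHom_ext (RingHom.ext fun x => ?_)
  have : (algebraMap (A ⧸ J) ((A ⧸ J) ⊗[A] A')) (Ideal.Quotient.mk J x) =
    algebraMap A _ x := rfl
  simp only [RingHom.comp_apply, Ideal.quotientMap_mk, this]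
  exact (g.commutes x).symm

theorem isLocalHom_quotientMap {A A' : Type u} [CommRing A] [CommRing A'] [IsLocalRing A]
    [IsLocalRing A'] (f : A →+* A') [IsLocalHom f] (J : Ideal A) (J' : Ideal A')
    (hJ' : J' ≠ ⊤) (h : J ≤ J'.comap f) :
    IsLocalHom (Ideal.quotientMap J' f h) := by
  constructor
  intro a ha
  obtain ⟨a, rfl⟩ := Ideal.Quotient.mk_surjective a
  rw [Ideal.quotientMap_mk] at ha
  have : Nontrivial (A' ⧸ J') := Ideal.Quotient.nontrivial_iff.mpr hJ'
  have h1 : IsLocalHom (Ideal.Quotient.mk J') :=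
    IsLocalHom.of_surjective _ Ideal.Quotient.mk_surjective
  exact (isUnit_of_map_unit f _ (isUnit_of_map_unit (Ideal.Quotient.mk J') _ ha)).map _

theorem IsRegularLocalRing.quotient_ne_top {A : Type u} [CommRing A] (J : Ideal A)
    [h : IsRegularLocalRing (A ⧸ J)] : J ≠ ⊤ :=
  Ideal.Quotient.nontrivial_iff.mp inferInstance

theorem Ideal.map_ne_top_of_isLocalHom {A A' : Type u} [CommRing A] [CommRing A'] [IsLocalRing A]
    [IsLocalRing A'] (f : A →+* A') [IsLocalHom f] {J : Ideal A} (hJ : J ≠ ⊤) :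
    J.map f ≠ ⊤ := by
  refine ne_top_of_le_ne_top (maximalIdeal.isMaximal A').ne_top
    ((Ideal.map_mono (IsLocalRing.le_maximalIdeal hJ)).trans (Ideal.map_le_iff_le_comap.mpr ?_))
  exact (IsLocalRing.maximalIdeal_comap f).ge

theorem IsRegularLocalRing.quotient_of_flat {A A' : Type u} [CommRing A] [CommRing A']
    [IsLocalRing A] [IsNoetherianRing A] [IsLocalRing A'] [IsNoetherianRing A'] (f : A →+* A')
    (hf : f.Flat) [IsLocalHom f] (J : Ideal A) (hJ : J ≠ ⊤)
    (h : IsRegularLocalRing (A' ⧸ J.map f)) : IsRegularLocalRing (A ⧸ J) := by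
  have hJ' := Ideal.map_ne_top_of_isLocalHom f hJ
  have : Nontrivial (A ⧸ J) := Ideal.Quotient.nontrivial_iff.mpr hJ
  have : IsLocalRing (A ⧸ J) := .of_surjective' _ Ideal.Quotient.mk_surjective
  have := isLocalHom_quotientMap f J (J.map f) hJ' Ideal.le_comap_map
  exact IsRegularLocalRing.of_flat _ (hf.quotientMap J)

theorem IsRegularLocalRing.quotient_map_of_flat {A A' : Type u} [CommRing A] [CommRing A']
    [IsLocalRing A] [IsNoetherianRing A] [IsLocalRing A'] [IsNoetherianRing A'] (f : A →+* A')
    (hf : f.Flat) [IsLocalHom f] (J : Ideal A)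
    (hJ : IsRegularLocalRing (A ⧸ J)) (h : IsRegularLocalRing (A' ⧸ (maximalIdeal A).map f)) :
    IsRegularLocalRing (A' ⧸ J.map f) := by
  have hJ1 := IsRegularLocalRing.quotient_ne_top J
  have hJ' := Ideal.map_ne_top_of_isLocalHom f hJ1
  have : Nontrivial (A' ⧸ J.map f) := Ideal.Quotient.nontrivial_iff.mpr hJ'
  have : IsLocalRing (A' ⧸ J.map f) := .of_surjective' _ Ideal.Quotient.mk_surjective
  have := isLocalHom_quotientMap f J (J.map f) hJ' Ideal.le_comap_map
  refine IsRegularLocalRing.of_flat_of_quotient _ (hf.quotientMap J) ?_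
  have h1 : (maximalIdeal (A ⧸ J)).map (Ideal.quotientMap (J.map f) f Ideal.le_comap_map) =
      ((maximalIdeal A).map f).map (Ideal.Quotient.mk (J.map f)) := by
    rw [← IsLocalRing.map_maximalIdeal_of_surjective' (Ideal.Quotient.mk J)
      Ideal.Quotient.mk_surjective, Ideal.map_map, Ideal.map_map, Ideal.quotientMap_comp_mk]
  rw [h1]
  exact IsRegularLocalRing.of_ringEquiv (DoubleQuot.quotQuotEquivQuotOfLE
    (Ideal.map_mono (IsLocalRing.le_maximalIdeal hJ1))).symm

/-- The quotient by (the extension of) `J` of the localization at `N` is a regular local ring. -/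
def Ideal.RegAt {Z : Type u} [CommRing Z] (J N : Ideal Z) [N.IsPrime] : Prop :=
  IsRegularLocalRing (Localization.AtPrime N ⧸ J.map (algebraMap Z (Localization.AtPrime N)))

theorem Ideal.RegAt.le {Z : Type u} [CommRing Z] {J N : Ideal Z} [N.IsPrime] (h : J.RegAt N) :
    J ≤ N := by
  have h : IsRegularLocalRing
    (Localization.AtPrime N ⧸ J.map (algebraMap Z (Localization.AtPrime N))) := h
  have := IsLocalRing.le_maximalIdeal
    (IsRegularLocalRing.quotient_ne_top (J.map (algebraMap Z (Localization.AtPrime N))))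
  rw [Ideal.map_le_iff_le_comap] at this
  exact this.trans (IsLocalization.AtPrime.under_maximalIdeal (Localization.AtPrime N) N).le

theorem Ideal.RegAt.congr {Z : Type u} [CommRing Z] {J N J' N' : Ideal Z} [N.IsPrime] [N'.IsPrime]
    (h : J.RegAt N) (hJ : J = J') (hN : N = N') : J'.RegAt N' := by
  subst hJ hN
  exact h

theorem Ideal.map_localRingHom {Z W : Type u} [CommRing Z] [CommRing W] (g : Z →+* W)
    (J M : Ideal Z) (N : Ideal W) [M.IsPrime] [N.IsPrime] (hM : M = N.comap g) :
    (J.map (algebraMap Z (Localization.AtPrime M))).map (Localization.localRingHom M N g hM) =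
      (J.map g).map (algebraMap W (Localization.AtPrime N)) := by
  rw [Ideal.map_map, Ideal.map_map]
  congr 1
  ext x
  simp [Localization.localRingHom_to_map]

/-- Flat descent of regularity. -/
theorem Ideal.RegAt.of_map {Z W : Type u} [CommRing Z] [CommRing W] [IsNoetherianRing Z]
    [IsNoetherianRing W] {g : Z →+* W} (hg : g.Flat) {J M : Ideal Z} {N : Ideal W} [M.IsPrime]
    [N.IsPrime] (hM : M = N.comap g) (h : (J.map g).RegAt N) : J.RegAt M := by
  unfold Ideal.RegAt
  have hle : J ≤ M := hM ▸ Ideal.map_le_iff_le_comap.mp h.le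
  refine IsRegularLocalRing.quotient_of_flat _ (hg.localRingHom N M hM) _ ?_ ?_
  · intro h1
    exact (IsLocalization.map_algebraMap_ne_top_iff_disjoint M.primeCompl
      (Localization.AtPrime M) J).mpr (Set.disjoint_left.mpr fun x hx hx' => hx (hle hx')) h1
  · rw [Ideal.map_localRingHom]
    exact h

/-- Ascent of regularity along a flat map with regular fibre. -/
theorem Ideal.RegAt.map {Z W : Type u} [CommRing Z] [CommRing W] [IsNoetherianRing Z]
    [IsNoetherianRing W] {g : Z →+* W} (hg : g.Flat) {J M : Ideal Z} {N : Ideal W} [M.IsPrime]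
    [N.IsPrime] (hM : M = N.comap g) (h : J.RegAt M) (h' : (M.map g).RegAt N) :
    (J.map g).RegAt N := by
  unfold Ideal.RegAt at *
  rw [← Ideal.map_localRingHom g J M N hM]
  refine IsRegularLocalRing.quotient_map_of_flat _ (hg.localRingHom N M hM) _ h ?_
  rw [← Localization.AtPrime.map_eq_maximalIdeal, Ideal.map_localRingHom]
  exact h'

theorem Ideal.regAt_iff_of_isLocalization {Z : Type u} [CommRing Z] {J N : Ideal Z} [N.IsPrime]
    (W W' : Type u) [CommRing W] [CommRing W'] [Algebra W W'] (f : Z →+* W)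
    (hf : Function.Surjective f) (hJ : RingHom.ker f = J) (N' : Ideal W) [N'.IsPrime]
    (hN : N'.comap f = N) [IsLocalization.AtPrime W' N'] :
    J.RegAt N ↔ IsRegularLocalRing W' := by
  subst hJ hN
  let Zn := Localization.AtPrime (N'.comap f)
  let g : Zn →+* W' := IsLocalization.map (M := (N'.comap f).primeCompl) (T := N'.primeCompl)
    W' f (fun x hx => hx)
  have hmap : (N'.comap f).primeCompl.map f = N'.primeCompl := by
    ext x
    constructor
    · rintro ⟨y, hy, rfl⟩
      exact hy
    · intro hx
      obtain ⟨y, rfl⟩ := hf x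
      exact ⟨y, hx, rfl⟩
  have hgs : Function.Surjective g := by
    have : IsLocalization ((N'.comap f).primeCompl.map f) W' := by rw [hmap]; assumption
    exact IsLocalization.map_surjective_of_surjective _ Zn W' hf
  have hker : RingHom.ker g = (RingHom.ker f).map (algebraMap Z Zn) := by
    refine IsLocalization.ker_map (S := Zn) (Q := W') (g := f) hmap
  have e := (Ideal.quotEquivOfEq hker.symm).trans (RingHom.quotientKerEquivOfSurjective hgs)
  exact ⟨fun h => by
    have : IsRegularLocalRing (Zn ⧸ (RingHom.ker f).map (algebraMap Z Zn)) := h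
    exact IsRegularLocalRing.of_ringEquiv e, fun h => IsRegularLocalRing.of_ringEquiv e.symm⟩

/-- Regularity at a prime does not change when passing to a quotient ring. -/
theorem Ideal.regAt_map_iff {Z W : Type u} [CommRing Z] [CommRing W] (f : Z →+* W)
    (hf : Function.Surjective f) {J : Ideal Z} (hJ : RingHom.ker f ≤ J) (N : Ideal W) [N.IsPrime] :
    (J.map f).RegAt N ↔ J.RegAt (N.comap f) := by
  by_cases hle : J ≤ N.comap f
  swap
  · exact ⟨fun h => absurd (Ideal.map_le_iff_le_comap.mp h.le) hle, fun h => absurd h.le hle⟩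
  have hle' := Ideal.map_le_iff_le_comap.mpr hle
  let W1 := W ⧸ J.map f
  have hker : RingHom.ker (Ideal.Quotient.mk (J.map f)) ≤ N := by rwa [Ideal.mk_ker]
  have : (N.map (Ideal.Quotient.mk (J.map f))).IsPrime :=
    Ideal.map_isPrime_of_surjective Ideal.Quotient.mk_surjective hker
  have hN : (N.map (Ideal.Quotient.mk (J.map f))).comap (Ideal.Quotient.mk (J.map f)) = N := by
    rw [Ideal.comap_map_of_surjective' _ Ideal.Quotient.mk_surjective, sup_eq_left.mpr hker]
  rw [Ideal.regAt_iff_of_isLocalization W1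
      (Localization.AtPrime (N.map (Ideal.Quotient.mk (J.map f))))
      (Ideal.Quotient.mk (J.map f)) Ideal.Quotient.mk_surjective Ideal.mk_ker
      (N.map (Ideal.Quotient.mk (J.map f))) hN,
    Ideal.regAt_iff_of_isLocalization W1
      (Localization.AtPrime (N.map (Ideal.Quotient.mk (J.map f))))
      ((Ideal.Quotient.mk (J.map f)).comp f) (Ideal.Quotient.mk_surjective.comp hf) _
      (N.map (Ideal.Quotient.mk (J.map f)))]
  · rw [← Ideal.comap_comap, hN]
  · rw [← RingHom.comap_ker, Ideal.mk_ker, Ideal.comap_map_of_surjective' _ hf,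
      sup_eq_left.mpr hJ]

theorem Ideal.regAt_bot_iff {Z : Type u} [CommRing Z] (N : Ideal Z) [N.IsPrime] :
    (⊥ : Ideal Z).RegAt N ↔ IsRegularLocalRing (Localization.AtPrime N) :=
  Ideal.regAt_iff_of_isLocalization Z (Localization.AtPrime N) (RingHom.id Z)
    Function.surjective_id (by ext; simp) N (Ideal.comap_id N)
end RegAt

section Fibers

theorem Ideal.regAt_comap_includeRight_iff {R S : Type u} [CommRing R] [CommRing S] [Algebra R S]
    (p : Ideal R) [p.IsPrime] (q : Ideal (p.Fiber S)) [q.IsPrime] :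
    (p.map (algebraMap R S)).RegAt
      (q.comap (Algebra.TensorProduct.includeRight : S →ₐ[R] p.Fiber S)) ↔
      IsRegularLocalRing (Localization.AtPrime q) := by
  let e := Ideal.Fiber.algEquivAux₂ p q
  unfold Ideal.RegAt
  exact ⟨fun h => IsRegularLocalRing.of_ringEquiv e.symm.toRingEquiv,
    fun h => IsRegularLocalRing.of_ringEquiv (R := Localization.AtPrime q) e.toRingEquiv⟩

theorem Ideal.exists_comap_includeRight {R S : Type u} [CommRing R] [CommRing S] [Algebra R S]
    (N : Ideal S) [N.IsPrime] : ∃ q : Ideal ((N.comap (algebraMap R S)).Fiber S), q.IsPrime ∧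
      q.comap (Algebra.TensorProduct.includeRight : S →ₐ[R] _) = N := by
  let p : PrimeSpectrum R := ⟨N.comap (algebraMap R S), inferInstance⟩
  let x : PrimeSpectrum.comap (algebraMap R S) ⁻¹' {p} := ⟨⟨N, inferInstance⟩, rfl⟩
  refine ⟨(PrimeSpectrum.preimageEquivFiber R S p x).asIdeal,
    (PrimeSpectrum.preimageEquivFiber R S p x).isPrime, ?_⟩
  exact congrArg (fun y => (Subtype.val y).asIdeal)
    ((PrimeSpectrum.preimageEquivFiber R S p).symm_apply_apply x)

/-- A reduced finite algebra over a field is regular. -/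
theorem isRegularLocalRing_localization_of_isReduced {A : Type u} [CommRing A] [IsArtinianRing A]
    [IsReduced A] (q : Ideal A) [q.IsPrime] : IsRegularLocalRing (Localization.AtPrime q) := by
  have : IsArtinianRing (Localization.AtPrime q) := inferInstance
  exact IsRegularLocalRing.of_maximalIdeal_eq_bot (IsLocalRing.isField_iff_maximalIdeal_eq.mp
    (IsArtinianRing.isField_of_isReduced_of_isLocalRing _))

theorem Ideal.regAt_of_formallyUnramified {R S : Type u} [CommRing R] [CommRing S] [Algebra R S]
    [Algebra.FormallyUnramified R S] [Algebra.EssFiniteType R S] (N : Ideal S) [N.IsPrime] :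
    ((N.comap (algebraMap R S)).map (algebraMap R S)).RegAt N := by
  obtain ⟨q, hq, hqN⟩ := Ideal.exists_comap_includeRight (R := R) N
  let p := N.comap (algebraMap R S)
  have h1 : IsReduced (p.Fiber S) := Algebra.FormallyUnramified.isReduced_of_field p.ResidueField _
  have h2 : Module.Finite p.ResidueField (p.Fiber S) :=
    Algebra.FormallyUnramified.finite_of_free _ _
  have h3 : IsArtinianRing (p.Fiber S) := IsArtinianRing.of_finite p.ResidueField _
  have h4 := (Ideal.regAt_comap_includeRight_iff p q).mpr
    (isRegularLocalRing_localization_of_isReduced q)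
  exact h4.congr rfl hqN

theorem IsRegularRing.of_formallyUnramified {R S : Type u} [CommRing R] [CommRing S] [Algebra R S]
    [Algebra.FormallyUnramified R S] [Algebra.EssFiniteType R S] [Module.Flat R S]
    [IsNoetherianRing S] [IsRegularRing R] : IsRegularRing S := by
  rw [isRegularRing_iff]
  intro N hN
  rw [← Ideal.regAt_bot_iff, ← Ideal.map_bot (f := algebraMap R S)]
  refine Ideal.RegAt.map (RingHom.flat_algebraMap_iff.mpr inferInstance) rfl ?_
    (Ideal.regAt_of_formallyUnramified N)
  rw [Ideal.regAt_bot_iff]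
  exact inferInstance

theorem exists_mvPolynomial_formallyUnramified (k L : Type u) [Field k] [Field L] [Algebra k L]
    [CharZero k] [Algebra.EssFiniteType k L] :
    ∃ (ι : Type u) (_ : Finite ι) (_ : Algebra (MvPolynomial ι k) L),
      IsScalarTower k (MvPolynomial ι k) L ∧ Algebra.FormallyUnramified (MvPolynomial ι k) L ∧
      Module.Flat (MvPolynomial ι k) L := by
  obtain ⟨s, hs, H⟩ := exists_isTranscendenceBasis_and_isSeparable_of_perfectField k L
  let P := MvPolynomial s k
  let f : P →ₐ[k] L := MvPolynomial.aeval ((↑) : s → L)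
  have hf : Function.Injective f := hs.1
  let : Algebra P L := f.toRingHom.toAlgebra
  have : IsScalarTower k P L := .of_algebraMap_eq fun x => (f.commutes x).symm
  have : FaithfulSMul P L := (faithfulSMul_iff_algebraMap_injective P L).mpr hf
  have halg : Algebra.IsAlgebraic P L := by
    have := hs.isAlgebraic
    refine Algebra.IsAlgebraic.of_ringHom_of_comp_eq
      (S := Algebra.adjoin k (Set.range ((↑) : s → L))) (B := L)
      hs.1.aevalEquiv.toRingEquiv.toRingHom
      (RingHom.id L) hs.1.aevalEquiv.surjective Function.injective_id ?_
    refine RingHom.ext fun x => ?_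
    exact hs.1.algebraMap_aevalEquiv x
  let : Algebra (FractionRing P) L := FractionRing.liftAlgebra P L
  have : Algebra.IsAlgebraic (FractionRing P) L :=
    IsFractionRing.comap_isAlgebraic_iff (A := P).mp halg
  have : CharZero P := inferInstance
  have : CharZero (FractionRing P) := inferInstance
  have : Algebra.FormallyUnramified P (FractionRing P) := .of_isLocalization (nonZeroDivisors P)
  have : Algebra.FormallyUnramified (FractionRing P) L := .of_isSeparable _ _
  exact ⟨s, inferInstance, inferInstance, inferInstance, .comp P (FractionRing P) L,
    .trans P (FractionRing P) L⟩

theorem IsRegularRing.tensorProduct (k L F : Type u) [Field k] [Field L] [Algebra k L]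
    [CharZero k] [Algebra.EssFiniteType k L] [CommRing F] [Algebra k F] [IsRegularRing F] :
    IsRegularRing (L ⊗[k] F) := by
  obtain ⟨ι, hι, hP, h1, h2, h3⟩ := exists_mvPolynomial_formallyUnramified k L
  let P := MvPolynomial ι k
  have h4 : IsRegularRing (P ⊗[k] F) :=
    IsRegularRing.of_ringEquiv ((Algebra.TensorProduct.comm k P F).trans
      ((MvPolynomial.algebraTensorAlgEquiv k F).restrictScalars k)).symm.toRingEquiv
  have : Algebra.EssFiniteType P L := .of_comp k P L
  have : IsNoetherianRing ((P ⊗[k] F) ⊗[P] L) := 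
    Algebra.EssFiniteType.isNoetherianRing (P ⊗[k] F) ((P ⊗[k] F) ⊗[P] L)
  have h5 : IsRegularRing ((P ⊗[k] F) ⊗[P] L) := .of_formallyUnramified (R := P ⊗[k] F)
  exact IsRegularRing.of_ringEquiv (R := (P ⊗[k] F) ⊗[P] L)
    ((Algebra.TensorProduct.comm P (P ⊗[k] F) L).toRingEquiv.trans
    (Algebra.TensorProduct.cancelBaseChange k P P L F).toRingEquiv)

theorem isRegularRing'_iff {A : Type u} [CommRing A] : IsRegularRing' A ↔ IsRegularRing A := by
  constructor
  · rintro ⟨h1, h2⟩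
    exact isRegularRing_iff.mpr fun p hp => isRegularLocalRing'_iff.mp (h2 p hp)
  · intro h
    exact ⟨inferInstance, fun p hp => isRegularLocalRing'_iff.mpr inferInstance⟩

instance isNoetherianRing_fiber {R S : Type u} [CommRing R] [CommRing S] [Algebra R S]
    [IsNoetherianRing S] (p : Ideal R) [p.IsPrime] : IsNoetherianRing (p.Fiber S) := by
  have h1 : Algebra.EssFiniteType R p.ResidueField := inferInstance
  have : IsNoetherianRing (S ⊗[R] p.ResidueField) :=
    Algebra.EssFiniteType.isNoetherianRing S (S ⊗[R] p.ResidueField)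
  exact isNoetherianRing_of_ringEquiv (S ⊗[R] p.ResidueField)
    (Algebra.TensorProduct.comm R S p.ResidueField).toRingEquiv

/-- All the local rings of the fibres of `R → S` are regular. -/
def HasRegularFibers {R S : Type u} [CommRing R] [CommRing S] (f : R →+* S) : Prop :=
  ∀ (N : Ideal S) [N.IsPrime], ((N.comap f).map f).RegAt N

theorem HasRegularFibers.isRegularRing_fiber {R S : Type u} [CommRing R] [CommRing S] [Algebra R S]
    [IsNoetherianRing S] (h : HasRegularFibers (algebraMap R S)) (p : Ideal R) [p.IsPrime] :
    IsRegularRing (p.Fiber S) := by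
  refine isRegularRing_iff.mpr fun q hq => (Ideal.regAt_comap_includeRight_iff p q).mp ?_
  refine (h (q.comap (Algebra.TensorProduct.includeRight : S →ₐ[R] p.Fiber S))).congr ?_ rfl
  congr 1
  have : q.LiesOver p := inferInstance
  refine Eq.trans ?_ (Ideal.over_def q p).symm
  ext x
  exact iff_of_eq (congrArg (· ∈ q) (AlgHom.commutes
    (Algebra.TensorProduct.includeRight : S →ₐ[R] p.Fiber S) x))

theorem hasGeometricallyRegularFibers_iff {R S : Type u} [CommRing R] [CommRing S] [Algebra R S]
    [Algebra ℚ R] [IsNoetherianRing S] : Algebra.HasGeometricallyRegularFibers R S ↔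
      HasRegularFibers (algebraMap R S) := by
  constructor
  · intro h N hN
    obtain ⟨q, hq, hqN⟩ := Ideal.exists_comap_includeRight (R := R) N
    let p := N.comap (algebraMap R S)
    have h1 : IsRegularRing' (p.ResidueField ⊗[p.ResidueField] (p.Fiber S)) :=
      h p inferInstance p.ResidueField
    rw [isRegularRing'_iff] at h1
    have h2 : IsRegularRing (p.Fiber S) := IsRegularRing.of_ringEquiv
      (R := p.ResidueField ⊗[p.ResidueField] (p.Fiber S))
      (Algebra.TensorProduct.lid p.ResidueField (p.Fiber S)).toRingEquiv
    exact ((Ideal.regAt_comap_includeRight_iff p q).mpr inferInstance).congr rfl hqN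
  · intro h p hp L _ _ _
    have h1 := h.isRegularRing_fiber p
    rw [isRegularRing'_iff]
    have : CharZero p.ResidueField := algebraRat.charZero _
    have : Algebra.EssFiniteType p.ResidueField L := inferInstance
    exact IsRegularRing.tensorProduct p.ResidueField L (p.Fiber S)

theorem HasRegularFibers.baseChange {R S : Type u} [CommRing R] [CommRing S] [Algebra R S]
    [Algebra ℚ R] [IsNoetherianRing S] (h : HasRegularFibers (algebraMap R S)) (C : Type u)
    [CommRing C] [Algebra R C] [Algebra.EssFiniteType R C] :
    HasRegularFibers (algebraMap C (C ⊗[R] S)) := by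
  intro N hN
  obtain ⟨q, hq, hqN⟩ := Ideal.exists_comap_includeRight (R := C) N
  let c := N.comap (algebraMap C (C ⊗[R] S))
  let p := c.comap (algebraMap R C)
  let m : p.ResidueField →ₐ[R] c.ResidueField :=
    Ideal.ResidueField.mapₐ p c (Algebra.ofId R C) rfl
  let : Algebra p.ResidueField c.ResidueField := m.toRingHom.toAlgebra
  have : IsScalarTower R p.ResidueField c.ResidueField :=
    .of_algebraMap_eq fun x => (m.commutes x).symm
  have h1 := h.isRegularRing_fiber p
  have : CharZero p.ResidueField := algebraRat.charZero _
  have : Algebra.EssFiniteType R c.ResidueField := .comp R C _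
  have : Algebra.EssFiniteType p.ResidueField c.ResidueField := .of_comp R _ _
  have h2 := IsRegularRing.tensorProduct p.ResidueField c.ResidueField (p.Fiber S)
  have h3 : IsRegularRing (c.Fiber (C ⊗[R] S)) := IsRegularRing.of_ringEquiv
    (R := c.ResidueField ⊗[p.ResidueField] (p.Fiber S))
    ((Algebra.TensorProduct.cancelBaseChange R p.ResidueField p.ResidueField c.ResidueField
      S).toRingEquiv.trans
      (Algebra.TensorProduct.cancelBaseChange R C C c.ResidueField S).symm.toRingEquiv)
  exact ((Ideal.regAt_comap_includeRight_iff c q).mpr inferInstance).congr rfl hqN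
end Fibers

section Reduced

theorem IsRegularRing.isReduced (A : Type u) [CommRing A] [IsRegularRing A] : IsReduced A := by
  refine isReduced_ofLocalizationMaximal A fun p hp => ?_
  have := IsRegularLocalRing.isDomain (Localization.AtPrime p)
  infer_instance

/-- Radical ideals extend to radical ideals along flat maps with regular fibres. -/
theorem HasRegularFibers.isRadical_map {A Z : Type u} [CommRing A] [CommRing Z]
    [IsNoetherianRing A] [IsNoetherianRing Z] {f : A →+* Z} (hf : f.Flat) (h : HasRegularFibers f)
    {E : Ideal A} (hE : E.IsRadical) : (E.map f).IsRadical := by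
  classical
  algebraize [f]
  intro z ⟨n, hz⟩
  have hfin : Finite E.minimalPrimes := E.finite_minimalPrimes_of_isNoetherianRing
  have : Fintype E.minimalPrimes := Fintype.ofFinite _
  have hpr (i : E.minimalPrimes) : i.1.IsPrime := i.2.1.1
  let κ (i : E.minimalPrimes) := i.1.ResidueField
  let j0 : A →ₗ[A] (∀ i, κ i) := LinearMap.pi fun i => Algebra.linearMap A (κ i)
  have hker : LinearMap.ker j0 = E := by
    ext x
    rw [LinearMap.mem_ker, funext_iff]
    have h1 : ∀ i, j0 x i = 0 ↔ x ∈ i.1 := fun i => Ideal.algebraMap_residueField_eq_zero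
    simp only [Pi.zero_apply, h1]
    rw [← hE.radical, ← Ideal.sInf_minimalPrimes, Ideal.mem_sInf]
    simp
  let j : (A ⧸ E) →ₗ[A] (∀ i, κ i) := Submodule.liftQ E j0 hker.ge
  have hj : Function.Injective j := by
    rw [← LinearMap.ker_eq_bot]
    exact Submodule.ker_liftQ_eq_bot _ _ _ hker.le
  have hinj := Module.Flat.lTensor_preserves_injective_linearMap (M := Z) j hj
  have h0 : z ⊗ₜ[A] (1 : A ⧸ E) = 0 := by
    apply hinj
    rw [map_zero, LinearMap.lTensor_tmul]
    apply (TensorProduct.piRight A A Z κ).injective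
    rw [map_zero]
    ext i
    rw [TensorProduct.piRight_apply, TensorProduct.piRightHom_tmul]
    have hj1 : j 1 i = 1 := (algebraMap A (κ i)).map_one
    beta_reduce
    rw [hj1, Pi.zero_apply]
    have h2 := HasRegularFibers.isRegularRing_fiber (R := A) (S := Z) h i.1
    have h3 := IsRegularRing.isReduced (i.1.Fiber Z)
    let g : Z →ₐ[A] i.1.Fiber Z := Algebra.TensorProduct.includeRight
    have h4 : g z = 0 := by
      refine IsReduced.eq_zero _ ⟨n, ?_⟩
      rw [← map_pow]
      have : E.map f ≤ RingHom.ker g := by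
        rw [Ideal.map_le_iff_le_comap]
        intro e he
        have h5 : g (algebraMap A Z e) = algebraMap A _ e := g.commutes e
        have h6 : algebraMap A (i.1.Fiber Z) e = algebraMap i.1.ResidueField _ (algebraMap A _ e) :=
          IsScalarTower.algebraMap_apply _ _ _ _
        rw [Ideal.mem_comap, RingHom.mem_ker]
        refine h5.trans (h6.trans ?_)
        rw [Ideal.algebraMap_residueField_eq_zero.mpr (i.2.1.2 he), map_zero]
      exact this hz
    have h7 := congrArg (TensorProduct.comm A (κ i) Z) h4
    simpa [g] using h7
  have h8 := congrArg (Algebra.TensorProduct.quotIdealMapEquivTensorQuot Z E).symm h0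
  rw [map_zero] at h8
  have h9 : (Algebra.TensorProduct.quotIdealMapEquivTensorQuot Z E).symm (z ⊗ₜ[A] (1 : A ⧸ E)) =
      Ideal.Quotient.mk _ z := by
    rw [AlgEquiv.symm_apply_eq]
    rfl
  rw [h9] at h8
  exact Ideal.Quotient.eq_zero_iff_mem.mp h8

end Reduced

/-- Tensoring with `W` preserves injections of modules over `C` when the base change of `W` to `C`
is flat. -/
theorem LinearMap.lTensor_injective_of_flat_baseChange {Z C : Type*} (W : Type*) [CommRing Z]
    [CommRing C] [Algebra Z C] [AddCommGroup W] [Module Z W] [Module.Flat C (C ⊗[Z] W)]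
    {L L' : Type*} [AddCommGroup L] [AddCommGroup L'] [Module Z L] [Module Z L'] [Module C L]
    [Module C L'] [IsScalarTower Z C L] [IsScalarTower Z C L'] (f : L →ₗ[C] L')
    (hf : Function.Injective f) :
    Function.Injective ((f.restrictScalars Z).lTensor W) := by
  rw [LinearMap.lTensor_inj_iff_rTensor_inj]
  have h := Module.Flat.rTensor_preserves_injective_linearMap (M := C ⊗[Z] W) f hf
  let e := TensorProduct.AlgebraTensorModule.cancelBaseChange Z C C L W
  let e' := TensorProduct.AlgebraTensorModule.cancelBaseChange Z C C L' W
  have key : ∀ x, (f.restrictScalars Z).rTensor W (e x) = e' (f.rTensor (C ⊗[Z] W) x) := by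
    intro x
    induction x with
    | zero => simp
    | add x y hx hy => simp only [map_add, hx, hy]
    | tmul l y =>
      induction y with
      | zero => simp
      | add x y hx hy => simp only [TensorProduct.tmul_add, map_add, hx, hy]
      | tmul c w => simp [e, e']
  intro x y hxy
  obtain ⟨x, rfl⟩ := e.surjective x
  obtain ⟨y, rfl⟩ := e.surjective y
  rw [key, key] at hxy
  rw [h (e'.injective hxy)]

/-- The local criterion of flatness. -/
theorem Module.Flat.of_adic {Z W : Type*} [CommRing Z] [CommRing W] [Algebra Z W]
    [IsNoetherianRing Z] [IsNoetherianRing W] (m : Ideal Z)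
    (hm : m.map (algebraMap Z W) ≤ Ideal.jacobson ⊥)
    (h : ∀ k, Module.Flat (Z ⧸ m ^ k) ((Z ⧸ m ^ k) ⊗[Z] W)) : Module.Flat Z W := by
  rw [Module.Flat.iff_lTensor_injective']
  intro a
  rw [injective_iff_map_eq_zero]
  intro z hz
  have hH : IsHausdorff (m.map (algebraMap Z W)) (W ⊗[Z] a) := IsHausdorff.of_le_jacobson _ _ hm
  refine hH.haus' z fun k => ?_
  rw [SModEq.zero]
  obtain ⟨j₀, hj₀⟩ := Ideal.exists_pow_inf_eq_pow_smul m a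
  have hAR := hj₀ (j₀ + k) (by omega)
  simp only [Nat.add_sub_cancel_left] at hAR
  set j := j₀ + k
  have := h j
  let b : Ideal (Z ⧸ m ^ j) := a.map (Ideal.Quotient.mk _)
  let π : a →ₗ[Z] b :=
    { toFun := fun x => ⟨Ideal.Quotient.mk _ x.1, Ideal.mem_map_of_mem _ x.2⟩
      map_add' := fun x y => rfl
      map_smul' := fun x y => rfl }
  have hπ : Function.Surjective π := by
    rintro ⟨x, hx⟩
    obtain ⟨y, hy, rfl⟩ := (Ideal.mem_map_iff_of_surjective _ Ideal.Quotient.mk_surjective).mp hx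
    exact ⟨⟨y, hy⟩, rfl⟩
  have hinj := LinearMap.lTensor_injective_of_flat_baseChange (Z := Z) W b.subtype
    b.injective_subtype
  have hcomm : (b.subtype.restrictScalars Z) ∘ₗ π =
      (Submodule.mkQ (m ^ j)) ∘ₗ a.subtype := rfl
  have h0 : π.lTensor W z = 0 := by
    apply hinj
    rw [map_zero, ← LinearMap.comp_apply, ← LinearMap.lTensor_comp, hcomm,
      LinearMap.lTensor_comp, LinearMap.comp_apply, hz, map_zero]
  have hex : Function.Exact (LinearMap.ker π).subtype π := LinearMap.exact_subtype_ker_map π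
  obtain ⟨t, rfl⟩ := (_root_.lTensor_exact W hex hπ z).mp h0
  have hker : ∀ x : a, π x = 0 → x ∈ (m ^ k • ⊤ : Submodule Z a) := by
    intro x hx
    have h1 : (x : Z) ∈ m ^ j := Ideal.Quotient.eq_zero_iff_mem.mp (congrArg Subtype.val hx)
    have h2 : (x : Z) ∈ m ^ j • (⊤ : Submodule Z Z) ⊓ a := ⟨by simpa using h1, x.2⟩
    rw [hAR] at h2
    have h3 : (x : Z) ∈ m ^ k • a := Submodule.smul_mono le_rfl inf_le_right h2
    have h4 : Submodule.map a.subtype (m ^ k • ⊤ : Submodule Z a) = m ^ k • a := by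
      rw [Submodule.map_smul'', Submodule.map_top, Submodule.range_subtype]
    rw [← h4] at h3
    obtain ⟨y, hy, hyx⟩ := h3
    rwa [← Subtype.ext hyx]
  have hsm : ∀ (w : W) (x : a), x ∈ (m ^ k • ⊤ : Submodule Z a) →
      w ⊗ₜ[Z] x ∈ ((m.map (algebraMap Z W)) ^ k • ⊤ : Submodule W (W ⊗[Z] a)) := by
    intro w x hx
    induction hx using Submodule.smul_induction_on' with
    | smul r hr y hy =>
      rw [TensorProduct.tmul_smul, ← algebraMap_smul W r]
      refine Submodule.smul_mem_smul ?_ trivial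
      rw [← Ideal.map_pow]
      exact Ideal.mem_map_of_mem _ hr
    | add x _ y _ hx hy =>
      rw [TensorProduct.tmul_add]; exact add_mem hx hy
  clear hz h0
  induction t with
  | zero => simp
  | add x y hx hy =>
    rw [map_add]
    exact add_mem hx hy
  | tmul w x => exact hsm w x.1 (hker _ x.2)

theorem RingHom.Flat.of_adic {Z W : Type u} [CommRing Z] [CommRing W] [IsNoetherianRing Z]
    [IsNoetherianRing W] (g : Z →+* W) (m : Ideal Z) (hm : m.map g ≤ Ideal.jacobson ⊥)
    (h : ∀ k, (Ideal.quotientMap ((m ^ k).map g) g Ideal.le_comap_map).Flat) : g.Flat := by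
  algebraize [g]
  refine Module.Flat.of_adic m hm fun k => ?_
  let e : (Z ⧸ m ^ k) ⊗[Z] W ≃ₐ[Z] (W ⧸ (m ^ k).map (algebraMap Z W)) :=
    (Algebra.TensorProduct.comm _ _ _).trans
      ((Algebra.TensorProduct.quotIdealMapEquivTensorQuot W (m ^ k)).symm.restrictScalars Z)
  rw [← RingHom.flat_algebraMap_iff]
  have h1 : algebraMap (Z ⧸ m ^ k) ((Z ⧸ m ^ k) ⊗[Z] W) = (e.symm : _ →+* _).comp
      (Ideal.quotientMap ((m ^ k).map g) g Ideal.le_comap_map) := by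
    apply Ideal.Quotient.ringHom_ext
    ext x
    exact (e.symm.commutes x).symm
  rw [h1]
  exact (h k).comp (RingHom.Flat.of_bijective e.symm.bijective)

theorem RingHom.Flat.of_comp_of_bijective {A Z W : Type*} [CommRing A] [CommRing Z] [CommRing W]
    {f : A →+* Z} {g : Z →+* W} (hf : Function.Bijective f) (h : (g.comp f).Flat) : g.Flat := by
  let e := RingEquiv.ofBijective f hf
  have h1 : g = (g.comp f).comp (e.symm : Z →+* A) := by
    ext x
    exact congrArg g (e.apply_symm_apply x).symm
  rw [h1]
  exact (RingHom.Flat.of_bijective e.symm.bijective).comp h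

/-- If `Z` is an adic completion of `A` then a `Z`-algebra which is flat over `A` is flat
over `Z`. -/
theorem RingHom.Flat.of_comp_adic {A Z W : Type u} [CommRing A] [CommRing Z] [CommRing W]
    [IsNoetherianRing Z] [IsNoetherianRing W] (f : A →+* Z) (g : Z →+* W) (m : Ideal A)
    (hf : ∀ k, Function.Bijective (Ideal.quotientMap ((m ^ k).map f) f Ideal.le_comap_map))
    (hm : m.map (g.comp f) ≤ Ideal.jacobson ⊥) (h : (g.comp f).Flat) : g.Flat := by
  refine RingHom.Flat.of_adic g (m.map f) (by rwa [Ideal.map_map]) fun k => ?_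
  have h1 := h.quotientMap (m ^ k)
  have h2 : ((m.map f) ^ k).map g = (m ^ k).map (g.comp f) := by
    rw [← Ideal.map_pow, Ideal.map_map]
  let e1 := Ideal.quotEquivOfEq (Ideal.map_pow f m k)
  let e2 := Ideal.quotEquivOfEq h2.symm
  refine RingHom.Flat.of_comp_of_bijective
    (f := (e1 : _ →+* _).comp (Ideal.quotientMap ((m ^ k).map f) f Ideal.le_comap_map))
    (e1.bijective.comp (hf k)) ?_
  have h3 := h1.comp (RingHom.Flat.of_bijective (f := e2.toRingHom) e2.bijective)
  convert h3 using 1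
  apply Ideal.Quotient.ringHom_ext
  ext x
  rfl

/-- `f : A →+* Z` exhibits `Z` as the `m`-adic completion of `A`. -/
structure RingHom.IsAdicCompletion {A Z : Type*} [CommRing A] [CommRing Z] (f : A →+* Z)
    (m : Ideal A) : Prop where
  complete : IsAdicComplete (m.map f) Z
  exists_sub_mem : ∀ k z, ∃ a, z - f a ∈ (m ^ k).map f
  mem_of_mem : ∀ k a, f a ∈ (m ^ k).map f → a ∈ m ^ k

namespace RingHom.IsAdicCompletion

variable {A Z W : Type*} [CommRing A] [CommRing Z] [CommRing W] {f : A →+* Z} {m : Ideal A}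

theorem bijective (hf : f.IsAdicCompletion m) (k : ℕ) :
    Function.Bijective (Ideal.quotientMap ((m ^ k).map f) f Ideal.le_comap_map) := by
  constructor
  · rw [injective_iff_map_eq_zero]
    intro x hx
    obtain ⟨x, rfl⟩ := Ideal.Quotient.mk_surjective x
    rw [Ideal.quotientMap_mk, Ideal.Quotient.eq_zero_iff_mem] at hx
    exact Ideal.Quotient.eq_zero_iff_mem.mpr (hf.mem_of_mem k x hx)
  · intro z
    obtain ⟨z, rfl⟩ := Ideal.Quotient.mk_surjective z
    obtain ⟨a, ha⟩ := hf.exists_sub_mem k z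
    refine ⟨Ideal.Quotient.mk _ a, ?_⟩
    rw [Ideal.quotientMap_mk]
    exact ((Ideal.Quotient.mk_eq_mk_iff_sub_mem _ _).mpr ha).symm

theorem le_jacobson (hf : f.IsAdicCompletion m) : m.map f ≤ Ideal.jacobson ⊥ :=
  have := hf.complete
  IsAdicComplete.le_jacobson_bot _

/-- The universal property of adic completions. -/
theorem exists_lift (hf : f.IsAdicCompletion m) (g : A →+* W) (n : Ideal W) [IsAdicComplete n W]
    (hmn : m.map g ≤ n) : ∃ h : Z →+* W, h.comp f = g := by
  have hle : ∀ k, m ^ k ≤ (n ^ k).comap g := fun k => by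
    rw [← Ideal.map_le_iff_le_comap, Ideal.map_pow]
    exact Ideal.pow_right_mono hmn k
  let e k := RingEquiv.ofBijective _ (hf.bijective k)
  let F : (k : ℕ) → Z →+* W ⧸ n ^ k := fun k =>
    ((Ideal.quotientMap (n ^ k) g (hle k)).comp (e k).symm.toRingHom).comp (Ideal.Quotient.mk _)
  have hF : ∀ k z a, z - f a ∈ (m ^ k).map f → F k z = Ideal.Quotient.mk _ (g a) := by
    intro k z a h
    have : Ideal.Quotient.mk _ z = e k (Ideal.Quotient.mk _ a) :=
      (Ideal.Quotient.mk_eq_mk_iff_sub_mem _ _).mpr h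
    simp only [F, RingHom.comp_apply, this]
    exact congrArg (Ideal.quotientMap (n ^ k) g (hle k)) ((e k).symm_apply_apply _)
  have hc : ∀ {i j : ℕ} (h : i ≤ j), (Ideal.Quotient.factorPow n h).comp (F j) = F i := by
    intro i j h
    ext z
    obtain ⟨a, ha⟩ := hf.exists_sub_mem j z
    rw [RingHom.comp_apply, hF j z a ha,
      hF i z a (Ideal.map_mono (Ideal.pow_le_pow_right h) ha)]
    rfl
  refine ⟨IsAdicComplete.liftRingHom n F hc, ?_⟩
  ext a
  rw [IsHausdorff.eq_iff_smodEq (I := n)]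
  intro k
  rw [SModEq.sub_mem]
  have h1 := IsAdicComplete.mk_liftRingHom n F hc k (f a)
  rw [hF k (f a) a (by simp), Ideal.Quotient.mk_eq_mk_iff_sub_mem] at h1
  simpa using h1

theorem hom_ext (hf : f.IsAdicCompletion m) {n : Ideal W} [IsHausdorff n W] {g h : Z →+* W}
    (hgh : g.comp f = h.comp f) (hg : m.map (g.comp f) ≤ n) : g = h := by
  ext z
  rw [IsHausdorff.eq_iff_smodEq (I := n)]
  intro k
  rw [SModEq.sub_mem]
  obtain ⟨a, ha⟩ := hf.exists_sub_mem k z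
  have h1 : ∀ g' : Z →+* W, m.map (g'.comp f) ≤ n → g' (z - f a) ∈ n ^ k := by
    intro g' hg'
    have h3 := Ideal.mem_map_of_mem g' ha
    rw [Ideal.map_map, Ideal.map_pow] at h3
    exact Ideal.pow_right_mono hg' k h3
  have h2 := sub_mem (h1 g hg) (h1 h (hgh ▸ hg))
  have h3 : g (f a) = h (f a) := RingHom.congr_fun hgh a
  simp only [map_sub, h3, sub_sub_sub_cancel_right] at h2
  simpa using h2

/-- Adic completions are unique. -/
theorem exists_ringEquiv (hf : f.IsAdicCompletion m) {g : A →+* W} (hg : g.IsAdicCompletion m) :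
    ∃ e : Z ≃+* W, e.toRingHom.comp f = g := by
  have := hf.complete
  have := hg.complete
  obtain ⟨h, hh⟩ := hf.exists_lift g (m.map g) le_rfl
  obtain ⟨h', hh'⟩ := hg.exists_lift f (m.map f) le_rfl
  have h1 : h'.comp h = RingHom.id Z :=
    hf.hom_ext (n := m.map f) (by rw [RingHom.comp_assoc, hh, hh', RingHom.id_comp])
      (by rw [RingHom.comp_assoc, hh, hh'])
  have h2 : h.comp h' = RingHom.id W :=
    hg.hom_ext (n := m.map g) (by rw [RingHom.comp_assoc, hh', hh, RingHom.id_comp])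
      (by rw [RingHom.comp_assoc, hh', hh])
  exact ⟨RingEquiv.ofRingHom h h' h2 h1, hh⟩

theorem comp_ringEquiv (hf : f.IsAdicCompletion m) (e : Z ≃+* W) :
    (e.toRingHom.comp f).IsAdicCompletion m := by
  have hm : ∀ I : Ideal A, I.map (e.toRingHom.comp f) = (I.map f).map e := fun I =>
    (Ideal.map_map f e.toRingHom).symm
  have hmem : ∀ (I : Ideal Z) z, e z ∈ I.map e ↔ z ∈ I := fun I z => by
    rw [Ideal.mem_map_of_equiv]
    exact ⟨fun ⟨x, hx, hxz⟩ => e.injective hxz ▸ hx, fun h => ⟨z, h, rfl⟩⟩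
  refine ⟨?_, fun k w => ?_, fun k a h => ?_⟩
  · rw [hm, IsAdicComplete.congr_ringEquiv]
    exact hf.complete
  · obtain ⟨z, rfl⟩ := e.surjective w
    obtain ⟨a, ha⟩ := hf.exists_sub_mem k z
    refine ⟨a, ?_⟩
    rw [hm]
    have := (hmem ((m ^ k).map f) (z - f a)).mpr ha
    rwa [map_sub] at this
  · rw [hm] at h
    exact hf.mem_of_mem k a ((hmem _ _).mp h)

/-- If `A / mᵏ → C / mᵏC` is bijective for all `k`, the completion of `C` is that of `A`. -/
theorem comp_of_quotient {C : Type*} [CommRing C] {f : C →+* Z} {g : A →+* C}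
    (hf : f.IsAdicCompletion (m.map g)) (h1 : ∀ k c, ∃ a, c - g a ∈ (m ^ k).map g)
    (h2 : ∀ k a, g a ∈ (m ^ k).map g → a ∈ m ^ k) : (f.comp g).IsAdicCompletion m := by
  have hm : ∀ k, (m ^ k).map (f.comp g) = ((m.map g) ^ k).map f := fun k => by
    rw [← Ideal.map_pow, Ideal.map_map]
  refine ⟨?_, fun k z => ?_, fun k a h => ?_⟩
  · rw [← Ideal.map_map]
    exact hf.complete
  · obtain ⟨c, hc⟩ := hf.exists_sub_mem k z
    obtain ⟨a, ha⟩ := h1 k c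
    refine ⟨a, ?_⟩
    rw [hm]
    have := add_mem hc (Ideal.mem_map_of_mem f (by rwa [Ideal.map_pow] at ha))
    simpa using this
  · rw [hm] at h
    apply h2
    rw [Ideal.map_pow]
    exact hf.mem_of_mem k _ h

end RingHom.IsAdicCompletion

theorem AdicCompletion.isAdicCompletion {A : Type*} [CommRing A] {m : Ideal A} (hm : m.FG) :
    (algebraMap A (AdicCompletion m A)).IsAdicCompletion m := by
  have hk : ∀ k z, z ∈ (m ^ k).map (algebraMap A (AdicCompletion m A)) ↔
      evalₐ m k z = 0 := by
    intro k z
    have := AdicCompletion.pow_smul_top_eq_ker_eval (M := A) hm (n := k)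
    rw [← Submodule.restrictScalars_mem A, ← Ideal.smul_top_eq_map, this, LinearMap.mem_ker,
      ← factor_eval_eq_evalₐ m z (le_of_eq (Ideal.mul_top _))]
    constructor
    · intro h; rw [h, _root_.map_zero]
    · intro h
      rw [← factor_evalₐ_eq_eval m z (le_of_eq (Ideal.mul_top _).symm),
        ← factor_eval_eq_evalₐ m z (le_of_eq (Ideal.mul_top _)), h, _root_.map_zero]
  refine ⟨isAdicComplete_self _ hm, fun k z => ?_, fun k a h => ?_⟩
  · obtain ⟨a, ha⟩ := Ideal.Quotient.mk_surjective (evalₐ m k z)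
    refine ⟨a, ?_⟩
    rw [hk, map_sub, AlgHom.commutes, sub_eq_zero]
    exact ha.symm
  · rw [hk, AlgHom.commutes] at h
    exact Ideal.Quotient.eq_zero_iff_mem.mp h

theorem MvPowerSeries.isAdicCompletion (σ R : Type*) [Finite σ] [CommRing R] :
    (MvPolynomial.coeToMvPowerSeries.ringHom (σ := σ) (R := R)).IsAdicCompletion
      (MvPolynomial.idealOfVars σ R) := by
  have h := (AdicCompletion.isAdicCompletion
    (MvPolynomial.idealOfVars_fg σ R)).comp_ringEquiv
      (toAdicCompletionAlgEquiv σ R).toRingEquiv.symm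
  convert h
  apply RingHom.ext
  intro p
  symm
  refine ((toAdicCompletionAlgEquiv σ R).symm_apply_eq).mpr ?_
  rw [toAdicCompletionAlgEquiv_apply]
  exact (toAdicCompletion_coe p).symm

theorem RingHom.IsAdicCompletion.isNoetherianRing {A Z : Type*} [CommRing A] [CommRing Z]
    {f : A →+* Z} {m : Ideal A} [IsNoetherianRing A] (hf : f.IsAdicCompletion m) :
    IsNoetherianRing Z := by
  have := hf.complete
  obtain ⟨r, a, ha⟩ := Submodule.fg_iff_exists_fin_generating_family.mp (IsNoetherian.noetherian m)
  let g : MvPolynomial (Fin r) A →+* Z := MvPolynomial.eval₂Hom f (f ∘ a)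
  have hg : (MvPolynomial.idealOfVars (Fin r) A).map g = m.map f := by
    rw [← ha, MvPolynomial.idealOfVars]
    change (Ideal.span _).map _ = (Ideal.span _).map _
    rw [Ideal.map_span, Ideal.map_span, ← Set.range_comp, ← Set.range_comp]
    congr 2
    ext i
    simp [g]
  have hP := MvPowerSeries.isAdicCompletion (Fin r) A
  have hPc := hP.complete
  obtain ⟨h, hh⟩ := hP.exists_lift g (m.map f) hg.le
  have hmap : (((MvPolynomial.idealOfVars (Fin r) A).map
      MvPolynomial.coeToMvPowerSeries.ringHom).map h) = m.map f := by
    rw [Ideal.map_map, hh, hg]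
  have hH : IsHausdorff (((MvPolynomial.idealOfVars (Fin r) A).map
      MvPolynomial.coeToMvPowerSeries.ringHom).map h) Z := by
    rw [hmap]; infer_instance
  have hs : Function.Surjective h := by
    apply surjective_of_mk_map_comp_surjective (I := (MvPolynomial.idealOfVars (Fin r) A).map
      MvPolynomial.coeToMvPowerSeries.ringHom)
    intro z
    obtain ⟨z, rfl⟩ := Ideal.Quotient.mk_surjective z
    obtain ⟨x, hx⟩ := hf.exists_sub_mem 1 z
    refine ⟨MvPolynomial.coeToMvPowerSeries.ringHom (MvPolynomial.C x), ?_⟩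
    rw [RingHom.comp_apply, ← RingHom.comp_apply h, hh, eq_comm,
      Ideal.Quotient.mk_eq_mk_iff_sub_mem, hmap]
    simpa [g] using hx
  exact isNoetherianRing_of_surjective _ _ h hs

instance AdicCompletion.isNoetherianRing {A : Type*} [CommRing A] [IsNoetherianRing A]
    (m : Ideal A) : IsNoetherianRing (AdicCompletion m A) :=
  (AdicCompletion.isAdicCompletion (IsNoetherian.noetherian m)).isNoetherianRing

/-- Adic completions of Noetherian rings are flat. -/
theorem RingHom.IsAdicCompletion.flat {A Z : Type u} [CommRing A] [CommRing Z]
    {f : A →+* Z} {m : Ideal A} [IsNoetherianRing A] (hf : f.IsAdicCompletion m) : f.Flat := by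
  obtain ⟨e, rfl⟩ := (AdicCompletion.isAdicCompletion
    (IsNoetherian.noetherian m)).exists_ringEquiv hf
  have h : (algebraMap A (AdicCompletion m A)).Flat :=
    RingHom.flat_algebraMap_iff.mpr inferInstance
  exact h.comp (RingHom.Flat.of_bijective e.bijective)

theorem HasRegularFibers.comp {A B C : Type u} [CommRing A] [CommRing B] [CommRing C]
    [IsNoetherianRing A] [IsNoetherianRing B]
    [IsNoetherianRing C] {f : A →+* B} {g : B →+* C} (hg : g.Flat)
    (h1 : HasRegularFibers f) (h2 : HasRegularFibers g) : HasRegularFibers (g.comp f) := by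
  intro N _
  have := Ideal.RegAt.map hg rfl (h1 (N.comap g)) (h2 N)
  rwa [Ideal.map_map, Ideal.comap_comap] at this

theorem HasRegularFibers.of_comp {A B C : Type u} [CommRing A] [CommRing B] [CommRing C]
    [IsNoetherianRing A] [IsNoetherianRing B]
    [IsNoetherianRing C] {f : A →+* B} {g : B →+* C} (hg : g.Flat)
    (hs : Function.Surjective (PrimeSpectrum.comap g))
    (h : HasRegularFibers (g.comp f)) : HasRegularFibers f := by
  intro N hN
  obtain ⟨M, hM⟩ := hs ⟨N, hN⟩
  have hM' : N = M.asIdeal.comap g := (congrArg PrimeSpectrum.asIdeal hM).symm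
  have h1 := h M.asIdeal
  rw [← Ideal.comap_comap, ← hM', ← Ideal.map_map] at h1
  exact Ideal.RegAt.of_map hg hM' h1

theorem Ideal.RegAt.self {Z : Type u} [CommRing Z] [IsNoetherianRing Z] (N : Ideal Z) [N.IsPrime] :
    N.RegAt N := by
  unfold Ideal.RegAt
  rw [Localization.AtPrime.map_eq_maximalIdeal]
  let _ : Field (Localization.AtPrime N ⧸ maximalIdeal (Localization.AtPrime N)) :=
    Ideal.Quotient.field _
  refine IsRegularLocalRing.of_maximalIdeal_eq_bot ?_
  exact (IsLocalRing.isField_iff_maximalIdeal_eq).mp (Field.toIsField _)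

theorem HasRegularFibers.of_map_comap {A B : Type u} [CommRing A] [CommRing B]
    [IsNoetherianRing B] {f : A →+* B}
    (hf : ∀ (N : Ideal B) [N.IsPrime], (N.comap f).map f = N) : HasRegularFibers f := by
  intro N _
  rw [hf N]
  exact Ideal.RegAt.self N

theorem HasRegularFibers.of_comp_of_map_comap {A B C : Type u} [CommRing A] [CommRing B]
    [CommRing C] {f : A →+* B} {g : B →+* C}
    (hf : ∀ (N : Ideal B) [N.IsPrime], (N.comap f).map f = N)
    (h : HasRegularFibers (g.comp f)) : HasRegularFibers g := by
  intro N _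
  have h1 := h N
  rwa [← Ideal.comap_comap, ← Ideal.map_map, hf] at h1

theorem HasRegularFibers.localRingHom {A B : Type u} [CommRing A] [CommRing B] [IsNoetherianRing A]
    [IsNoetherianRing B] {f : A →+* B} (h : HasRegularFibers f)
    (p : Ideal A) [p.IsPrime] (N : Ideal B) [N.IsPrime] (hp : p = N.comap f) :
    HasRegularFibers (Localization.localRingHom p N f hp) := by
  refine HasRegularFibers.of_comp_of_map_comap (f := algebraMap A (Localization.AtPrime p))
    (fun N' _ => IsLocalization.map_under p.primeCompl _ N') ?_
  have h1 : (Localization.localRingHom p N f hp).comp (algebraMap A (Localization.AtPrime p)) =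
      (algebraMap B (Localization.AtPrime N)).comp f := by
    ext x
    simp [Localization.localRingHom_to_map]
  rw [h1]
  exact h.comp (RingHom.flat_algebraMap_iff.mpr (IsLocalization.flat _ N.primeCompl))
    (HasRegularFibers.of_map_comap fun N' _ => IsLocalization.map_under N.primeCompl _ N')

theorem PrimeSpectrum.comap_surjective_of_flat_of_isLocalHom {A B : Type u} [CommRing A]
    [CommRing B] [IsLocalRing A] [IsLocalRing B] (f : A →+* B) [IsLocalHom f] (hf : f.Flat) :
    Function.Surjective (PrimeSpectrum.comap f) := by
  algebraize [f]
  have : IsLocalHom (algebraMap A B) := ‹IsLocalHom f›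
  have := Module.FaithfullyFlat.of_flat_of_isLocalHom (A := A) (B := B)
  exact PrimeSpectrum.comap_surjective_of_faithfullyFlat

/-- Regularity of formal fibres descends along flat local homomorphisms with regular fibres. -/
theorem HasRegularFibers.adicCompletion_of_flat {A B : Type u} [CommRing A] [CommRing B]
    [IsNoetherianRing A] [IsNoetherianRing B] [IsLocalRing A] [IsLocalRing B] {f : A →+* B}
    [IsLocalHom f] (hf : f.Flat) (h : HasRegularFibers f)
    (hB : HasRegularFibers (algebraMap B (AdicCompletion (maximalIdeal B) B))) :
    HasRegularFibers (algebraMap A (AdicCompletion (maximalIdeal A) A)) := by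
  have hA' := AdicCompletion.isAdicCompletion (IsNoetherian.noetherian (maximalIdeal A))
  have hB' := AdicCompletion.isAdicCompletion (IsNoetherian.noetherian (maximalIdeal B))
  have := hB'.complete
  have hle : (maximalIdeal A).map ((algebraMap B (AdicCompletion (maximalIdeal B) B)).comp f) ≤
      (maximalIdeal B).map (algebraMap B (AdicCompletion (maximalIdeal B) B)) := by
    rw [← Ideal.map_map]
    exact Ideal.map_mono (((local_hom_TFAE f).out 0 2).mp ‹_›)
  obtain ⟨g, hg⟩ := hA'.exists_lift _ _ hle
  have hgf : g.Flat := by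
    refine RingHom.Flat.of_comp_adic _ g (maximalIdeal A) hA'.bijective ?_ ?_
    · rw [hg]; exact hle.trans hB'.le_jacobson
    · rw [hg]; exact hf.comp hB'.flat
  have : IsLocalHom g := by
    refine ((local_hom_TFAE g).out 0 2).mpr ?_
    rw [AdicCompletion.maximalIdeal_eq_map, AdicCompletion.maximalIdeal_eq_map, Ideal.map_map, hg]
    exact hle
  refine HasRegularFibers.of_comp hgf
    (PrimeSpectrum.comap_surjective_of_flat_of_isLocalHom g hgf) ?_
  rw [hg]
  exact h.comp hB'.flat hB

theorem isGRing_iff {A : Type u} [CommRing A] [Algebra ℚ A] [IsNoetherianRing A] :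
    IsGRing A ↔ ∀ (p : Ideal A) [p.IsPrime],
      HasRegularFibers (algebraMap (Localization.AtPrime p)
        (AdicCompletion (maximalIdeal (Localization.AtPrime p)) (Localization.AtPrime p))) :=
  forall₂_congr fun _ _ => hasGeometricallyRegularFibers_iff

/-- The G-ring property descends along faithfully flat homomorphisms with regular fibres. -/
theorem IsGRing.of_flat {A B : Type u} [CommRing A] [CommRing B] [Algebra ℚ A] [Algebra ℚ B]
    [IsNoetherianRing A] [IsNoetherianRing B] {f : A →+* B} (hf : f.Flat)
    (hs : Function.Surjective (PrimeSpectrum.comap f)) (h : HasRegularFibers f) (hB : IsGRing B) :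
    IsGRing A := by
  rw [isGRing_iff] at hB ⊢
  intro p hp
  obtain ⟨⟨N, hN⟩, hNp⟩ := hs ⟨p, hp⟩
  have hpN : p = N.comap f := (congrArg PrimeSpectrum.asIdeal hNp).symm
  exact HasRegularFibers.adicCompletion_of_flat (hf.localRingHom N p hpN)
    (h.localRingHom p N hpN) (hB N)

/-- The J-2 property descends along faithfully flat homomorphisms with regular fibres. -/
theorem IsJ2Ring.of_flat {A B : Type u} [CommRing A] [CommRing B] [Algebra A B] [Algebra ℚ A]
    [IsNoetherianRing A] [IsNoetherianRing B] [Module.FaithfullyFlat A B]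
    (h : HasRegularFibers (algebraMap A B)) (hB : IsJ2Ring B) : IsJ2Ring A := by
  intro C _ _ hC
  let f : C →+* C ⊗[A] B := algebraMap C (C ⊗[A] B)
  have hf : f.Flat := RingHom.flat_algebraMap_iff.mpr inferInstance
  have hN : IsNoetherianRing C := Algebra.FiniteType.isNoetherianRing A C
  let e : B ⊗[A] C ≃ₐ[A] C ⊗[A] B := Algebra.TensorProduct.comm A B C
  have hN' : IsNoetherianRing (C ⊗[A] B) := by
    have : IsNoetherianRing (B ⊗[A] C) := Algebra.FiniteType.isNoetherianRing B _
    exact isNoetherianRing_of_ringEquiv _ e.toRingEquiv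
  have hs : Function.Surjective (PrimeSpectrum.comap f) :=
    PrimeSpectrum.comap_surjective_of_faithfullyFlat
  have hq : Topology.IsQuotientMap (PrimeSpectrum.comap f) :=
    PrimeSpectrum.isQuotientMap_of_generalizingMap hs
      hf.generalizingMap_comap
  let _ : Algebra B (C ⊗[A] B) := Algebra.TensorProduct.rightAlgebra
  have hft : Algebra.FiniteType B (C ⊗[A] B) := by
    have h0 : Algebra.FiniteType B (B ⊗[A] C) := inferInstance
    exact h0.equiv (AlgEquiv.ofRingEquiv (f := e.toRingEquiv)
      fun b => by simp [e, Algebra.TensorProduct.right_algebraMap_apply])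
  have ho := hB (C ⊗[A] B) hft
  rw [← hq.isOpen_preimage]
  convert ho using 1
  ext N
  have h1 := h.baseChange C N.asIdeal
  simp only [Set.mem_preimage, Set.mem_ofPred_eq, isRegularLocalRing'_iff, ← Ideal.regAt_bot_iff]
  constructor
  · intro h2
    have h3 := Ideal.RegAt.map hf rfl h2 h1
    rwa [Ideal.map_bot] at h3
  · intro h2
    exact Ideal.RegAt.of_map hf (N := N.asIdeal) rfl (by rwa [Ideal.map_bot])

theorem IsQuasiExcellentRing.of_flat {A B : Type u} [CommRing A] [CommRing B] [Algebra A B]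
    [Algebra ℚ A] [Algebra ℚ B] [IsNoetherianRing A] [Module.FaithfullyFlat A B]
    (h : HasRegularFibers (algebraMap A B)) (hB : IsQuasiExcellentRing B) :
    IsQuasiExcellentRing A := by
  obtain ⟨h1, h2, h3⟩ := hB
  exact ⟨‹_›, IsGRing.of_flat (RingHom.flat_algebraMap_iff.mpr inferInstance)
    PrimeSpectrum.comap_surjective_of_faithfullyFlat h h2, IsJ2Ring.of_flat h h3⟩

theorem MvPolynomial.flat_map {σ : Type*} {R X : Type*} [CommRing R] [CommRing X] {f : R →+* X}
    (hf : f.Flat) : (MvPolynomial.map (σ := σ) f).Flat := by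
  algebraize [f]
  let _ : Algebra (MvPolynomial σ R) (MvPolynomial σ X) := MvPolynomial.algebraMvPolynomial
  have h : Algebra.IsPushout R (MvPolynomial σ R) X (MvPolynomial σ X) := inferInstance
  have := Module.Flat.isBaseChange _ _ _ _ h.out
  exact this

namespace MvPowerSeries

variable {σ : Type*}

/-- The ideal generated by the variables. -/
noncomputable abbrev varIdeal (σ : Type*) (R : Type*) [CommRing R] : Ideal (MvPowerSeries σ R) :=
  Ideal.span (Set.range X)

theorem map_idealOfVars (R : Type*) [CommRing R] :
    (MvPolynomial.idealOfVars σ R).map MvPolynomial.coeToMvPowerSeries.ringHom =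
      varIdeal σ R := by
  rw [MvPolynomial.idealOfVars, Ideal.map_span, ← Set.range_comp]
  congr 2
  ext1 i
  simp

theorem map_varIdeal {R X : Type*} [CommRing R] [CommRing X] (f : R →+* X) :
    (varIdeal σ R).map (map f) = varIdeal σ X := by
  rw [varIdeal, Ideal.map_span, ← Set.range_comp]
  congr 2
  ext1 i
  simp

theorem varIdeal_le_jacobson [Finite σ] (R : Type*) [CommRing R] :
    varIdeal σ R ≤ Ideal.jacobson ⊥ :=
  IsAdicComplete.le_jacobson_bot _

theorem mem_varIdeal_pow_iff [Finite σ] {R : Type*} [CommRing R] (k : ℕ)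
    (f : MvPowerSeries σ R) :
    f ∈ varIdeal σ R ^ k ↔ ∀ d : σ →₀ ℕ, d.degree < k → coeff d f = 0 := by
  have key : ∀ (k : ℕ) (f : MvPowerSeries σ R), f ∈ varIdeal σ R ^ k →
      ∀ d : σ →₀ ℕ, d.degree < k → coeff d f = 0 := by
    intro k
    induction k with
    | zero => simp
    | succ k ih =>
      intro f hf
      rw [pow_succ] at hf
      induction hf using Submodule.mul_induction_on' with
      | mem_mul_mem a ha b hb =>
        have hb' : constantCoeff b = 0 := by
          have : varIdeal σ R ≤ RingHom.ker (constantCoeff (σ := σ) (R := R)) := by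
            rw [Ideal.span_le]
            rintro _ ⟨i, rfl⟩
            simp
          exact this hb
        intro d hd
        classical
        rw [coeff_mul]
        refine Finset.sum_eq_zero fun x hx => ?_
        rw [Finset.HasAntidiagonal.mem_antidiagonal] at hx
        by_cases h2 : x.2 = 0
        · rw [h2, coeff_zero_eq_constantCoeff_apply, hb', mul_zero]
        · rw [ih a ha x.1, zero_mul]
          have h3 : x.2.degree ≠ 0 := by rwa [Ne, Finsupp.degree_eq_zero_iff]
          have h4 : x.1.degree + x.2.degree = d.degree := by
            rw [← hx]; exact (map_add Finsupp.degree _ _).symm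
          omega
      | add a _ b _ ha hb =>
        intro d hd
        rw [map_add, ha d hd, hb d hd, add_zero]
  refine ⟨key k f, fun h => ?_⟩
  obtain ⟨q, hq⟩ := (isAdicCompletion σ R).exists_sub_mem k f
  rw [Ideal.map_pow, map_idealOfVars] at hq
  have h1 : q ∈ MvPolynomial.idealOfVars σ R ^ k := by
    rw [MvPolynomial.mem_pow_idealOfVars_iff']
    intro d hd
    have := key k _ hq d hd
    rw [map_sub, h d hd, zero_sub, neg_eq_zero] at this
    simpa using this
  have h2 := Ideal.mem_map_of_mem MvPolynomial.coeToMvPowerSeries.ringHom h1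
  rw [Ideal.map_pow, map_idealOfVars] at h2
  simpa using add_mem hq h2

theorem mem_varIdeal_iff [Finite σ] {R : Type*} [CommRing R] (f : MvPowerSeries σ R) :
    f ∈ varIdeal σ R ↔ constantCoeff f = 0 := by
  rw [← pow_one (varIdeal σ R), mem_varIdeal_pow_iff]
  constructor
  · intro h
    exact h 0 (by simp)
  · intro h d hd
    have : d = 0 := by rwa [Nat.lt_one_iff, Finsupp.degree_eq_zero_iff] at hd
    rw [this]
    exact h

theorem ker_constantCoeff [Finite σ] {R : Type*} [CommRing R] :
    RingHom.ker (constantCoeff (σ := σ) (R := R)) = varIdeal σ R := by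
  ext f
  rw [mem_varIdeal_iff, RingHom.mem_ker]

theorem flat_map {τ : Type} [Finite τ] {R X : Type u} [CommRing R] [CommRing X]
    [IsNoetherianRing R] [IsNoetherianRing X] {f : R →+* X} (hf : f.Flat) :
    (map (σ := τ) f).Flat := by
  have h1 : (MvPolynomial.coeToMvPowerSeries.ringHom (σ := τ) (R := X)).Flat :=
    (isAdicCompletion τ X).flat
  have h2 := (MvPolynomial.flat_map (σ := τ) hf).comp h1
  have h : (map (σ := τ) f).comp MvPolynomial.coeToMvPowerSeries.ringHom =
        MvPolynomial.coeToMvPowerSeries.ringHom.comp (MvPolynomial.map f) := by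
    apply RingHom.ext
    intro p
    ext d
    simp [MvPolynomial.coeff_map]
  rw [← h] at h2
  have h3 : (MvPolynomial.idealOfVars τ R).map ((map (σ := τ) f).comp
      MvPolynomial.coeToMvPowerSeries.ringHom) ≤ Ideal.jacobson ⊥ := by
    rw [← Ideal.map_map, map_idealOfVars, map_varIdeal]
    exact varIdeal_le_jacobson X
  have h4 := (isAdicCompletion τ R).bijective
  exact RingHom.Flat.of_comp_adic _ (map f) (MvPolynomial.idealOfVars τ R) h4 h3 h2

end MvPowerSeries

theorem WellFoundedLT.exists_forall_image_Iio {ι X : Type*} [LinearOrder ι] [WellFoundedLT ι]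
    [Nonempty X]     (C : ι → Set X → X → Prop) (h : ∀ i (f : ι → X), ∃ x, C i (f '' Set.Iio i) x) :
    ∃ f : ι → X, ∀ i, C i (f '' Set.Iio i) (f i) := by
  classical
  let x₀ : X := Classical.arbitrary X
  let F : (i : ι) → ((j : ι) → j < i → X) → X := fun i rec =>
    (h i (fun j => if hj : j < i then rec j hj else x₀)).choose
  let f : ι → X := WellFounded.fix (wellFounded_lt (α := ι)) F
  refine ⟨f, fun i => ?_⟩
  have h1 : f i = F i (fun j _ => f j) := WellFounded.fix_eq _ _ _
  have h2 := (h i (fun j => if hj : j < i then f j else x₀)).choose_spec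
  have h3 : (fun j => if hj : j < i then f j else x₀) '' Set.Iio i = f '' Set.Iio i := by
    refine Set.image_congr fun j hj => ?_
    exact dif_pos hj
  have h4 : f i = (h i (fun j => if hj : j < i then f j else x₀)).choose := h1
  rw [← h4, h3] at h2
  exact h2

theorem AlgebraicIndependent.of_transcendental_Iio {ι K A : Type*} [LinearOrder ι] [CommRing K]
    [CommRing A] [Algebra K A] (hinj : Function.Injective (algebraMap K A)) (x : ι → A)
    (h : ∀ i, Transcendental (Algebra.adjoin K (x '' Set.Iio i)) (x i)) :
    AlgebraicIndependent K x := by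
  classical
  refine algebraicIndependent_of_finite_type fun t ht => ?_
  obtain ⟨t, rfl⟩ := ht.exists_finset_coe
  change AlgebraicIndepOn K x t
  induction t using Finset.induction_on_max with
  | empty => simpa [AlgebraicIndepOn] using hinj
  | insert a s hs ih =>
    rw [Finset.coe_insert]
    refine (ih s.finite_toSet).insert ?_
    refine Transcendental.of_tower_top_of_subalgebra_le (Algebra.adjoin_mono ?_) (h a)
    exact Set.image_mono fun y hy => hs y hy

open Cardinal in
theorem IsLocalRing.mk_isAlgebraic_add_mul_lt {X : Type u} [CommRing X] [IsLocalRing X]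
    [Algebra ℚ X] (hu : ℵ₀ < #(ResidueField X)) (P : Ideal X) [P.IsPrime] (W : Set X)
    (hW : #W < #(ResidueField X)) (t a : X) (ha : a ∉ P) :
    #{c : ResidueField X | IsAlgebraic (Algebra.adjoin ℚ (Ideal.Quotient.mk P '' W))
      (Ideal.Quotient.mk P (t + a * Function.surjInv residue_surjective c))} <
        #(ResidueField X) := by
  let A := Algebra.adjoin ℚ (Ideal.Quotient.mk P '' W)
  let g : ResidueField X → X ⧸ P := fun c =>
    Ideal.Quotient.mk P (t + a * Function.surjInv residue_surjective c)
  have hg : Function.Injective g := by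
    intro c c' hcc
    have h1 := Ideal.Quotient.eq.mp hcc
    rw [add_sub_add_left_eq_sub, ← mul_sub] at h1
    have h2 := (Ideal.IsPrime.mem_or_mem ‹_› h1).resolve_left ha
    have h3 := le_maximalIdeal (Ideal.IsPrime.ne_top ‹P.IsPrime›) h2
    rw [← residue_eq_zero_iff, map_sub, sub_eq_zero] at h3
    rwa [Function.surjInv_eq residue_surjective, Function.surjInv_eq residue_surjective] at h3
  have h1 : #{c : ResidueField X | IsAlgebraic A (g c)} ≤ #{x : X ⧸ P // IsAlgebraic A x} := by
    refine Cardinal.mk_le_of_injective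
      (f := fun c : {c : ResidueField X | IsAlgebraic A (g c)} =>
        (⟨g c.1, c.2⟩ : {x : X ⧸ P // IsAlgebraic A x})) ?_
    intro c c' hcc
    exact Subtype.ext (hg (Subtype.ext_iff.mp hcc))
  have h2 := h1.trans (Algebraic.cardinalMk_le_max A (X ⧸ P))
  refine h2.trans_lt (max_lt ?_ hu)
  have h3 := Algebra.lift_cardinalMk_adjoin_le ℚ (Ideal.Quotient.mk P '' W)
  simp only [Cardinal.lift_uzero, Cardinal.mk_eq_aleph0, Cardinal.lift_aleph0] at h3
  refine h3.trans_lt (max_lt (max_lt hu ?_) hu)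
  exact Cardinal.mk_image_le.trans_lt hW

/-- A subring `R` of `X` that meets the primes `P₁` and `P₂` trivially, is large modulo every
element outside `P₁ ∪ P₂`, and is closed under division. -/
structure Subring.IsGluing {X : Type*} [CommRing X] (R : Subring X) (P₁ P₂ : Ideal X) : Prop where
  eq_zero_left : ∀ r ∈ R, r ∈ P₁ → r = 0
  eq_zero_right : ∀ r ∈ R, r ∈ P₂ → r = 0
  exists_eq_add : ∀ a ∉ P₁, a ∉ P₂ → ∀ t, ∃ r ∈ R, ∃ s, t = r + a * s
  mem_of_mul_mem : ∀ r ∈ R, r ≠ 0 → ∀ x, r * x ∈ R → x ∈ R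

open Cardinal in
theorem Subring.exists_isGluing {X : Type u} [CommRing X] [IsLocalRing X] [Algebra ℚ X]
    (hu : ℵ₀ < #X) (hX : #X = #(ResidueField X)) (P₁ P₂ : Ideal X) [P₁.IsPrime] [P₂.IsPrime]
    (h12 : P₁ ⊓ P₂ = ⊥) : ∃ R : Subring X, R.IsGluing P₁ P₂ ∧ ∀ c : ℚ, algebraMap ℚ X c ∈ R := by
  let κ := #X
  have hinf : Infinite X := Cardinal.infinite_iff.mpr hu.le
  have hcard : #(κ.ord.ToType) = #(X × X) := by
    rw [Cardinal.mk_ord_toType, Cardinal.mk_prod, Cardinal.lift_id, Cardinal.mul_eq_self hu.le]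
  obtain ⟨e⟩ := Cardinal.eq.mp hcard
  obtain ⟨w, hw⟩ := WellFoundedLT.exists_forall_image_Iio (ι := κ.ord.ToType) (X := X)
    (fun i W x => ((e i).2 ∉ P₁ → (e i).2 ∉ P₂ → ∃ s, x = (e i).1 + (e i).2 * s) ∧
      (Transcendental (Algebra.adjoin ℚ (Ideal.Quotient.mk P₁ '' W)) (Ideal.Quotient.mk P₁ x)) ∧
      (Transcendental (Algebra.adjoin ℚ (Ideal.Quotient.mk P₂ '' W)) (Ideal.Quotient.mk P₂ x)))
    (by
      intro i f
      have hW : #(f '' Set.Iio i) < #(ResidueField X) := by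
        rw [← hX]
        exact Cardinal.mk_image_le.trans_lt (by simpa using Cardinal.mk_Iio_lt i)
      have key : ∀ t a : X, a ∉ P₁ → a ∉ P₂ → ∃ s,
          Transcendental (Algebra.adjoin ℚ (Ideal.Quotient.mk P₁ '' (f '' Set.Iio i)))
            (Ideal.Quotient.mk P₁ (t + a * s)) ∧
          Transcendental (Algebra.adjoin ℚ (Ideal.Quotient.mk P₂ '' (f '' Set.Iio i)))
            (Ideal.Quotient.mk P₂ (t + a * s)) := by
        intro t a h1 h2
        by_contra! hcon
        have hu' := hu
        rw [hX] at hu'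
        have b1 := IsLocalRing.mk_isAlgebraic_add_mul_lt hu' P₁ _ hW t a h1
        have b2 := IsLocalRing.mk_isAlgebraic_add_mul_lt hu' P₂ _ hW t a h2
        have b3 := (Cardinal.mk_union_le _ _).trans_lt (Cardinal.add_lt_of_lt hu'.le b1 b2)
        refine b3.ne ((congrArg (fun s : Set (ResidueField X) => #s)
          (Set.eq_univ_of_forall fun c => ?_)).trans Cardinal.mk_univ)
        by_cases hc : IsAlgebraic (Algebra.adjoin ℚ (Ideal.Quotient.mk P₁ '' (f '' Set.Iio i)))
            (Ideal.Quotient.mk P₁ (t + a * Function.surjInv residue_surjective c))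
        · exact Or.inl hc
        · exact Or.inr (not_not.mp (hcon _ hc))
      by_cases ha : (e i).2 ∉ P₁ ∧ (e i).2 ∉ P₂
      · obtain ⟨s, hs⟩ := key (e i).1 (e i).2 ha.1 ha.2
        exact ⟨_, fun _ _ => ⟨s, rfl⟩, hs⟩
      · obtain ⟨s, hs⟩ := key 0 1 ((Ideal.ne_top_iff_one _).mp (Ideal.IsPrime.ne_top ‹_›))
          ((Ideal.ne_top_iff_one _).mp (Ideal.IsPrime.ne_top ‹_›))
        exact ⟨_, fun h1 h2 => (ha ⟨h1, h2⟩).elim, hs⟩)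
  have hP : ∀ P : Ideal X, P.IsPrime →
      (∀ i, Transcendental (Algebra.adjoin ℚ (Ideal.Quotient.mk P '' (w '' Set.Iio i)))
        (Ideal.Quotient.mk P (w i))) → ∀ x ∈ Algebra.adjoin ℚ (Set.range w), x ∈ P → x = 0 := by
    intro P hPp htr x hx hxP
    have hai : AlgebraicIndependent ℚ (fun i => Ideal.Quotient.mk P (w i)) := by
      refine AlgebraicIndependent.of_transcendental_Iio (algebraMap ℚ (X ⧸ P)).injective _ ?_
      intro i
      have := htr i
      rwa [Set.image_image] at this
    rw [Algebra.adjoin_range_eq_range_aeval] at hx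
    obtain ⟨p, rfl⟩ := hx
    have h0 : MvPolynomial.aeval (fun i => Ideal.Quotient.mk P (w i)) p = 0 := by
      rw [← Ideal.Quotient.eq_zero_iff_mem] at hxP
      rw [← hxP]
      exact (MvPolynomial.comp_aeval_apply w (Ideal.Quotient.mkₐ ℚ P) p).symm
    rw [hai.eq_zero_of_aeval_eq_zero p h0]
    simp
  have hP1 := hP P₁ inferInstance fun i => (hw i).2.1
  have hP2 := hP P₂ inferInstance fun i => (hw i).2.2
  let R₀ := Algebra.adjoin ℚ (Set.range w)
  have hmul : ∀ r ∈ R₀, r ≠ 0 → ∀ s ∈ R₀, s ≠ 0 → r * s ≠ 0 := by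
    intro r hr hr0 s hs hs0 h0
    have : r * s ∈ P₁ := h0 ▸ zero_mem _
    rcases Ideal.IsPrime.mem_or_mem ‹_› this with h | h
    · exact hr0 (hP1 r hr h)
    · exact hs0 (hP1 s hs h)
  have h10 : (1 : X) ≠ 0 := one_ne_zero
  let R : Subring X :=
    { carrier := {x | ∃ r ∈ R₀, r ≠ 0 ∧ r * x ∈ R₀}
      mul_mem' := by
        rintro x y ⟨r, hr, hr0, hx⟩ ⟨s, hs, hs0, hy⟩
        refine ⟨r * s, mul_mem hr hs, hmul r hr hr0 s hs hs0, ?_⟩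
        rw [mul_mul_mul_comm]
        exact mul_mem hx hy
      one_mem' := ⟨1, one_mem _, h10, by rw [mul_one]; exact one_mem _⟩
      add_mem' := by
        rintro x y ⟨r, hr, hr0, hx⟩ ⟨s, hs, hs0, hy⟩
        refine ⟨r * s, mul_mem hr hs, hmul r hr hr0 s hs hs0, ?_⟩
        rw [show r * s * (x + y) = s * (r * x) + r * (s * y) by ring]
        exact add_mem (mul_mem hs hx) (mul_mem hr hy)
      zero_mem' := ⟨1, one_mem _, h10, by rw [mul_zero]; exact zero_mem _⟩
      neg_mem' := by
        rintro x ⟨r, hr, hr0, hx⟩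
        exact ⟨r, hr, hr0, by rw [mul_neg]; exact neg_mem hx⟩ }
  have hle : ∀ x ∈ R₀, x ∈ R := fun x hx => ⟨1, one_mem _, h10, by rwa [one_mul]⟩
  have hR12 : ∀ x, x ∈ P₁ → x ∈ P₂ → x = 0 := fun x h1 h2 =>
    (Ideal.mem_bot).mp (h12 ▸ (⟨h1, h2⟩ : x ∈ P₁ ⊓ P₂))
  have hz1 : ∀ r ∈ R, r ∈ P₁ → r = 0 := by
    rintro x ⟨r, hr, hr0, hx⟩ hxP
    have h0 := hP1 _ hx (Ideal.mul_mem_left _ _ hxP)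
    refine hR12 x hxP ?_
    have : r * x ∈ P₂ := h0 ▸ zero_mem _
    exact (Ideal.IsPrime.mem_or_mem ‹_› this).resolve_left fun h => hr0 (hP2 r hr h)
  have hz2 : ∀ r ∈ R, r ∈ P₂ → r = 0 := by
    rintro x ⟨r, hr, hr0, hx⟩ hxP
    have h0 := hP2 _ hx (Ideal.mul_mem_left _ _ hxP)
    refine hR12 x ?_ hxP
    have : r * x ∈ P₁ := h0 ▸ zero_mem _
    exact (Ideal.IsPrime.mem_or_mem ‹_› this).resolve_left fun h => hr0 (hP1 r hr h)
  refine ⟨R, ⟨hz1, hz2, ?_, ?_⟩, fun c => hle _ (Subalgebra.algebraMap_mem _ c)⟩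
  · intro a h1 h2 t
    obtain ⟨s, hs⟩ := (hw (e.symm (t, a))).1 (by simpa using h1) (by simpa using h2)
    simp only [Equiv.apply_symm_apply] at hs
    refine ⟨_, hle _ (Algebra.subset_adjoin ⟨e.symm (t, a), rfl⟩), -s, ?_⟩
    rw [hs]; ring
  · rintro r ⟨s, hs, hs0, hr⟩ hr0 x ⟨s', hs', hs0', hx⟩
    refine ⟨s' * (s * r), mul_mem hs' hr, hmul _ hs' hs0' _ hr ?_, ?_⟩
    · intro h0
      have : s * r ∈ P₁ := h0 ▸ zero_mem _
      rcases Ideal.IsPrime.mem_or_mem ‹_› this with h | h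
      · exact hs0 (hP1 s hs h)
      · exact hr0 (hz1 r ⟨s, hs, hs0, hr⟩ h)
    · rw [show s' * (s * r) * x = s * (s' * (r * x)) by ring]
      exact mul_mem hs hx

/-- The ring homomorphism `f : A → X` is surjective modulo every element of `X` lying outside
`P₁ ∪ P₂`. -/
def RingHom.SurjectiveOff {A X : Type*} [CommRing A] [CommRing X] (f : A →+* X)
    (P₁ P₂ : Ideal X) : Prop :=
  ∀ a ∉ P₁, a ∉ P₂ → ∀ t, ∃ r s, t = f r + a * s

theorem Ideal.exists_mem_notMem_notMem {X : Type*} [CommRing X] {J P₁ P₂ : Ideal X} [P₁.IsPrime]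
    [P₂.IsPrime] (h1 : ¬ J ≤ P₁) (h2 : ¬ J ≤ P₂) : ∃ a ∈ J, a ∉ P₁ ∧ a ∉ P₂ := by
  by_contra! h
  obtain ⟨a, ha, ha1⟩ := SetLike.not_le_iff_exists.mp h1
  obtain ⟨b, hb, hb2⟩ := SetLike.not_le_iff_exists.mp h2
  have ha2 := h a ha ha1
  have hb1 : b ∈ P₁ := by
    by_contra hb1
    exact hb2 (h b hb hb1)
  have := h (a + b) (add_mem ha hb) fun h' => ha1 ((add_mem_cancel_right hb1).mp h')
  exact hb2 ((add_mem_cancel_left ha2).mp this)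

namespace RingHom.SurjectiveOff

variable {A X : Type*} [CommRing A] [CommRing X] {f : A →+* X} {P₁ P₂ : Ideal X}

theorem exists_eq_mul_unit [IsLocalRing X] (hf : f.SurjectiveOff P₁ P₂) {a : X} (h1 : a ∉ P₁)
    (h2 : a ∉ P₂) [P₁.IsPrime] [P₂.IsPrime] : ∃ r, ∃ u : X, IsUnit u ∧ f r = a * u := by
  by_cases ha : IsUnit a
  · obtain ⟨b, hb⟩ := ha.exists_right_inv
    exact ⟨1, b, IsUnit.of_mul_eq_one a (by rw [mul_comm, hb]), by rw [hb, map_one]⟩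
  · have hP : ∀ P : Ideal X, P.IsPrime → a ∉ P → a * a ∉ P := fun P hP h h' =>
      h ((hP.mem_or_mem h').elim (fun h => h) fun h => h)
    obtain ⟨r, s, hrs⟩ := hf (a * a) (hP _ inferInstance h1) (hP _ inferInstance h2) a
    refine ⟨r, 1 - a * s, ?_, ?_⟩
    · have : a * s ∈ maximalIdeal X :=
        Ideal.mul_mem_right _ _ ((mem_maximalIdeal _).mpr ha)
      exact (IsLocalRing.isUnit_or_isUnit_one_sub_self (a * s)).resolve_left
        ((mem_maximalIdeal _).mp this)
    · linear_combination (-1 : X) * hrs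

theorem exists_sub_mem [P₁.IsPrime] [P₂.IsPrime] (hf : f.SurjectiveOff P₁ P₂)
    {J : Ideal X} (h1 : ¬ J ≤ P₁) (h2 : ¬ J ≤ P₂) (t : X) : ∃ r, t - f r ∈ J := by
  obtain ⟨a, ha, ha1, ha2⟩ := Ideal.exists_mem_notMem_notMem h1 h2
  obtain ⟨r, s, hrs⟩ := hf a ha1 ha2 t
  exact ⟨r, by rw [hrs, add_sub_cancel_left]; exact Ideal.mul_mem_right _ _ ha⟩

theorem exists_mem_notMem [IsLocalRing X] [P₁.IsPrime] [P₂.IsPrime] (hf : f.SurjectiveOff P₁ P₂)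
    {J : Ideal X} (h1 : ¬ J ≤ P₁) (h2 : ¬ J ≤ P₂) : ∃ r, f r ∈ J ∧ f r ∉ P₁ ∧ f r ∉ P₂ := by
  obtain ⟨a, ha, ha1, ha2⟩ := Ideal.exists_mem_notMem_notMem h1 h2
  obtain ⟨r, u, hu, hr⟩ := hf.exists_eq_mul_unit ha1 ha2
  refine ⟨r, hr ▸ Ideal.mul_mem_right _ _ ha, ?_, ?_⟩
  · rw [hr, Ideal.mul_unit_mem_iff_mem _ hu]; exact ha1
  · rw [hr, Ideal.mul_unit_mem_iff_mem _ hu]; exact ha2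

theorem map_comap [IsLocalRing X] [P₁.IsPrime] [P₂.IsPrime] (hf : f.SurjectiveOff P₁ P₂)
    {J : Ideal X} (h1 : ¬ J ≤ P₁) (h2 : ¬ J ≤ P₂) : (J.comap f).map f = J := by
  refine le_antisymm Ideal.map_comap_le fun t ht => ?_
  obtain ⟨r, hrJ, hr1, hr2⟩ := hf.exists_mem_notMem h1 h2
  obtain ⟨b, s, hbs⟩ := hf (f r) hr1 hr2 t
  have hb : f b ∈ J := by
    have : f b = t - f r * s := by rw [hbs]; ring
    rw [this]
    exact sub_mem ht (Ideal.mul_mem_right _ _ hrJ)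
  rw [hbs]
  exact add_mem (Ideal.mem_map_of_mem f hb)
    (Ideal.mul_mem_right _ _ (Ideal.mem_map_of_mem f hrJ))

theorem of_surjective {B T : Type*} [CommRing B] [CommRing T] {Q₁ Q₂ : Ideal T}
    (hf : f.SurjectiveOff P₁ P₂) {g : B →+* T} (s : A →+* B) (p : X →+* T)
    (hp : Function.Surjective p) (hs : g.comp s = p.comp f) (h1 : P₁ ≤ Q₁.comap p)
    (h2 : P₂ ≤ Q₂.comap p) : g.SurjectiveOff Q₁ Q₂ := by
  intro a ha1 ha2 t
  obtain ⟨a, rfl⟩ := hp a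
  obtain ⟨t, rfl⟩ := hp t
  obtain ⟨r, y, hry⟩ := hf a (fun h => ha1 (h1 h)) (fun h => ha2 (h2 h)) t
  refine ⟨s r, p y, ?_⟩
  have := RingHom.congr_fun hs r
  rw [RingHom.comp_apply, RingHom.comp_apply] at this
  rw [hry, map_add, map_mul, this]

theorem mvPowerSeries {σ : Type*} [_root_.Finite σ] [IsNoetherianRing X] [IsLocalRing X]
    (hf : f.SurjectiveOff P₁ P₂) [P₁.IsPrime] [P₂.IsPrime] :
    (MvPowerSeries.map (σ := σ) f).SurjectiveOff (P₁.comap MvPowerSeries.constantCoeff)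
      (P₂.comap MvPowerSeries.constantCoeff) := by
  intro a h1 h2 t
  by_cases ha : IsUnit a
  · obtain ⟨b, hb⟩ := ha.exists_right_inv
    exact ⟨0, b * t, by rw [map_zero, zero_add, ← mul_assoc, hb, one_mul]⟩
  let J : Ideal (MvPowerSeries σ X) := Ideal.span {a}
  let g : MvPowerSeries σ A →+* MvPowerSeries σ X ⧸ J :=
    (Ideal.Quotient.mk J).comp (MvPowerSeries.map f)
  have hmap : (MvPowerSeries.varIdeal σ A).map g =
      (MvPowerSeries.varIdeal σ X).map (Ideal.Quotient.mk J) := by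
    rw [← Ideal.map_map, MvPowerSeries.map_varIdeal]
  have hJ : J ≠ ⊤ := by
    rwa [Ne, Ideal.span_singleton_eq_top]
  have : IsLocalRing (MvPowerSeries σ X ⧸ J) := IsLocalRing.quotient_of_le (le_maximalIdeal hJ)
  have hH : IsHausdorff ((MvPowerSeries.varIdeal σ A).map g) (MvPowerSeries σ X ⧸ J) := by
    rw [hmap]
    refine IsHausdorff.of_le_jacobson _ _ ?_
    rw [IsLocalRing.jacobson_eq_maximalIdeal ⊥ bot_ne_top,
      ← IsLocalRing.map_maximalIdeal_of_surjective' _ Ideal.Quotient.mk_surjective]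
    refine Ideal.map_mono ((MvPowerSeries.varIdeal_le_jacobson X).trans ?_)
    rw [IsLocalRing.jacobson_eq_maximalIdeal ⊥ bot_ne_top]
  have hsurj : Function.Surjective g := by
    refine surjective_of_mk_map_comp_surjective (I := MvPowerSeries.varIdeal σ A) g ?_
    intro z
    obtain ⟨z, rfl⟩ := Ideal.Quotient.mk_surjective z
    obtain ⟨z, rfl⟩ := Ideal.Quotient.mk_surjective z
    obtain ⟨r, s, hrs⟩ := hf _ h1 h2 (MvPowerSeries.constantCoeff z)
    refine ⟨MvPowerSeries.C r, ?_⟩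
    rw [RingHom.comp_apply, Ideal.Quotient.eq, hmap]
    have h3 : z - (MvPowerSeries.C (f r) + a * MvPowerSeries.C s) ∈
        MvPowerSeries.varIdeal σ X := by
      rw [MvPowerSeries.mem_varIdeal_iff]
      simp [hrs]
    have h4 := Ideal.mem_map_of_mem (Ideal.Quotient.mk J) h3
    have h5 : Ideal.Quotient.mk J a = 0 :=
      Ideal.Quotient.eq_zero_iff_mem.mpr (Ideal.mem_span_singleton_self a)
    rw [map_sub, map_add, map_mul, h5, zero_mul, add_zero] at h4
    rw [← neg_mem_iff, neg_sub]
    simpa [g] using h4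
  obtain ⟨r, hr⟩ := hsurj (Ideal.Quotient.mk J t)
  obtain ⟨s, hs⟩ := Ideal.mem_span_singleton'.mp (Ideal.Quotient.eq.mp hr.symm)
  refine ⟨r, s, ?_⟩
  rw [mul_comm, hs]
  ring

end RingHom.SurjectiveOff

namespace Subring.IsGluing

variable {X : Type u} [CommRing X] {R : Subring X} {P₁ P₂ : Ideal X}

theorem surjectiveOff (h : R.IsGluing P₁ P₂) : R.subtype.SurjectiveOff P₁ P₂ := by
  intro a h1 h2 t
  obtain ⟨r, hr, s, hs⟩ := h.exists_eq_add a h1 h2 t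
  exact ⟨⟨r, hr⟩, s, hs⟩

theorem comap_left (h : R.IsGluing P₁ P₂) : P₁.comap R.subtype = ⊥ := by
  ext r
  refine ⟨fun hr => ?_, fun hr => ?_⟩
  · exact Subtype.ext (h.eq_zero_left r.1 r.2 hr)
  · rw [Ideal.mem_bot.mp hr]; exact zero_mem _

theorem comap_right (h : R.IsGluing P₁ P₂) : P₂.comap R.subtype = ⊥ := by
  ext r
  refine ⟨fun hr => ?_, fun hr => ?_⟩
  · exact Subtype.ext (h.eq_zero_right r.1 r.2 hr)
  · rw [Ideal.mem_bot.mp hr]; exact zero_mem _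

theorem isDomain (h : R.IsGluing P₁ P₂) [P₁.IsPrime] : IsDomain R := by
  have : (P₁.comap R.subtype).IsPrime := inferInstance
  rw [h.comap_left] at this
  exact IsDomain.of_bot_isPrime R

theorem isLocalHom (h : R.IsGluing P₁ P₂) [Nontrivial X] : IsLocalHom R.subtype := by
  constructor
  intro r hr
  obtain ⟨s, hs⟩ := hr.exists_right_inv
  have hs' : s ∈ R := by
    refine h.mem_of_mul_mem r.1 r.2 ?_ s ?_
    · intro h0
      rw [Subring.coe_subtype, h0, zero_mul] at hs
      exact zero_ne_one hs
    · change R.subtype r * s ∈ R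
      rw [hs]
      exact one_mem _
  exact IsUnit.of_mul_eq_one ⟨s, hs'⟩ (Subtype.ext hs)

theorem isLocalRing (h : R.IsGluing P₁ P₂) [IsLocalRing X] : IsLocalRing R :=
  have := h.isLocalHom
  RingHom.domain_isLocalRing R.subtype

theorem bijective_quotientMap (h : R.IsGluing P₁ P₂) {r : R} (hr : r ≠ 0) :
    Function.Bijective (Ideal.quotientMap ((Ideal.span {r}).map R.subtype) R.subtype
      Ideal.le_comap_map) := by
  constructor
  · refine Ideal.quotientMap_injective' fun x hx => ?_
    rw [Ideal.mem_comap, Ideal.map_span, Set.image_singleton, Ideal.mem_span_singleton'] at hx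
    obtain ⟨y, hy⟩ := hx
    have hy' : y ∈ R := by
      refine h.mem_of_mul_mem r.1 r.2 (fun h0 => hr (Subtype.ext h0)) y ?_
      rw [mul_comm]
      change y * R.subtype r ∈ R
      rw [hy]
      exact x.2
    exact Ideal.mem_span_singleton'.mpr ⟨⟨y, hy'⟩, Subtype.ext hy⟩
  · intro z
    obtain ⟨z, rfl⟩ := Ideal.Quotient.mk_surjective z
    obtain ⟨b, s, hb⟩ := h.surjectiveOff r.1 (fun h' => hr (Subtype.ext (h.eq_zero_left _ r.2 h')))
      (fun h' => hr (Subtype.ext (h.eq_zero_right _ r.2 h'))) z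
    refine ⟨Ideal.Quotient.mk _ b, ?_⟩
    rw [Ideal.quotientMap_mk, Ideal.Quotient.eq, hb, sub_add_cancel_left, neg_mem_iff]
    exact Ideal.mul_mem_right _ _ (Ideal.mem_map_of_mem R.subtype (Ideal.mem_span_singleton_self r))

theorem isNoetherianRing (h : R.IsGluing P₁ P₂) [IsNoetherianRing X] : IsNoetherianRing R := by
  refine (isNoetherianRing_iff_ideal_fg R).mpr fun J => ?_
  by_cases hJ : J = ⊥
  · rw [hJ]; exact Submodule.fg_bot
  obtain ⟨r, hrJ, hr⟩ := Submodule.exists_mem_ne_zero_of_ne_bot hJ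
  have hN : IsNoetherianRing (R ⧸ Ideal.span {r}) :=
    isNoetherianRing_of_ringEquiv _ (RingEquiv.ofBijective _ (h.bijective_quotientMap hr)).symm
  have h1 : (J.map (Ideal.Quotient.mk (Ideal.span {r}))).FG := IsNoetherian.noetherian _
  refine Ideal.fg_of_fg_map_of_fg_inf_ker_of_surjective h1 ?_ Ideal.Quotient.mk_surjective
  rw [Ideal.mk_ker, inf_eq_right.mpr ((Ideal.span_singleton_le_iff_mem J).mpr hrJ)]
  exact ⟨{r}, by simp⟩

theorem flat (h : R.IsGluing P₁ P₂) [IsNoetherianRing X] [IsLocalRing X] [P₁.IsPrime] [P₂.IsPrime]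
    (h1 : ¬ maximalIdeal X ≤ P₁) (h2 : ¬ maximalIdeal X ≤ P₂) : R.subtype.Flat := by
  have := h.isNoetherianRing
  have := h.isDomain
  obtain ⟨r, hrm, hr1, hr2⟩ := h.surjectiveOff.exists_mem_notMem h1 h2
  have hr0 : r ≠ 0 := by
    rintro rfl
    exact hr1 (by rw [map_zero]; exact zero_mem _)
  refine RingHom.Flat.of_adic _ (Ideal.span {r}) ?_ fun k => ?_
  · rw [IsLocalRing.jacobson_eq_maximalIdeal ⊥ bot_ne_top, Ideal.map_span, Set.image_singleton,
      Ideal.span_singleton_le_iff_mem]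
    exact hrm
  · have h3 := h.bijective_quotientMap (pow_ne_zero k hr0)
    rw [Ideal.span_singleton_pow]
    exact RingHom.Flat.of_bijective h3

end Subring.IsGluing

namespace RingHom.SurjectiveOff

variable {A X : Type*} [CommRing A] [CommRing X] {f : A →+* X} {P₁ P₂ : Ideal X}

theorem map_isPrime [P₁.IsPrime] [P₂.IsPrime] (hf : f.SurjectiveOff P₁ P₂)
    {p : Ideal A} [p.IsPrime] (hc : (p.map f).comap f ≤ p) (h1 : ¬ p ≤ P₁.comap f)
    (h2 : ¬ p ≤ P₂.comap f) : (p.map f).IsPrime := by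
  rw [← Ideal.map_le_iff_le_comap] at h1 h2
  refine ⟨fun htop => ?_, fun {x y} hxy => ?_⟩
  · rw [htop, Ideal.comap_top] at hc
    exact Ideal.IsPrime.ne_top ‹_› (top_le_iff.mp hc)
  · obtain ⟨a, ha⟩ := hf.exists_sub_mem h1 h2 x
    obtain ⟨b, hb⟩ := hf.exists_sub_mem h1 h2 y
    have hab : a * b ∈ p := by
      refine hc ?_
      rw [Ideal.mem_comap, map_mul]
      have : f a * f b = x * y - (x - f a) * y - f a * (y - f b) := by ring
      rw [this]
      exact sub_mem (sub_mem hxy (Ideal.mul_mem_right _ _ ha)) (Ideal.mul_mem_left _ _ hb)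
    rcases Ideal.IsPrime.mem_or_mem ‹_› hab with h | h
    · exact Or.inl (by simpa using add_mem ha (Ideal.mem_map_of_mem f h))
    · exact Or.inr (by simpa using add_mem hb (Ideal.mem_map_of_mem f h))

end RingHom.SurjectiveOff

theorem PrimeSpectrum.height_pos_iff_of_inf_eq_bot {X : Type*} [CommRing X] {P₁ P₂ : Ideal X}
    [P₁.IsPrime] [P₂.IsPrime] (h0 : P₁ ⊓ P₂ = ⊥) (h12 : ¬ P₁ ≤ P₂) (h21 : ¬ P₂ ≤ P₁)
    (P : PrimeSpectrum X) :
    0 < Order.height P ↔ ¬ P.asIdeal ≤ P₁ ∧ ¬ P.asIdeal ≤ P₂ := by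
  have key : ∀ P : PrimeSpectrum X, P₁ ≤ P.asIdeal ∨ P₂ ≤ P.asIdeal := fun P =>
    (Ideal.IsPrime.inf_le P.2).mp (h0 ▸ bot_le)
  rw [Order.height_pos, ← not_or, not_iff_not]
  constructor
  · intro hmin
    rcases key P with h | h
    · exact Or.inl (hmin (b := ⟨P₁, inferInstance⟩) h)
    · exact Or.inr (hmin (b := ⟨P₂, inferInstance⟩) h)
  · rintro (h | h) Q hQ
    · rcases key Q with h' | h'
      · exact (h.trans h' : _)
      · exact (h21 (h'.trans (le_trans hQ h))).elim
    · rcases key Q with h' | h'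
      · exact (h12 (h'.trans (le_trans hQ h))).elim
      · exact (h.trans h' : _)

theorem RingHom.SurjectiveOff.bijOn_comap {A X : Type*} [CommRing A] [IsDomain A] [CommRing X]
    [IsLocalRing X] {f : A →+* X} {P₁ P₂ : Ideal X} [P₁.IsPrime] [P₂.IsPrime]
    (hf : f.SurjectiveOff P₁ P₂) (h0 : P₁ ⊓ P₂ = ⊥) (h12 : ¬ P₁ ≤ P₂) (h21 : ¬ P₂ ≤ P₁)
    (hP1 : P₁.comap f = ⊥) (hP2 : P₂.comap f = ⊥) (hc : ∀ p : Ideal A, (p.map f).comap f ≤ p) :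
    Set.BijOn (fun P : Ideal X => P.comap f)
      {P : Ideal X | ∃ hP : P.IsPrime, 0 < Order.height (⟨P, hP⟩ : PrimeSpectrum X)}
      {p : Ideal A | ∃ hp : p.IsPrime, 0 < Order.height (⟨p, hp⟩ : PrimeSpectrum A)} := by
  have hpos : ∀ p : PrimeSpectrum A, 0 < Order.height p ↔ p.asIdeal ≠ ⊥ := by
    intro p
    rw [Order.height_pos, not_iff_comm, not_not]
    constructor
    · intro h Q _
      change p.asIdeal ≤ _
      rw [h]
      exact bot_le
    · intro h
      exact le_bot_iff.mp (h (b := ⟨⊥, Ideal.isPrime_bot⟩) (bot_le (a := p.asIdeal)))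
  refine ⟨?_, ?_, ?_⟩
  · rintro P ⟨hP, hht⟩
    rw [PrimeSpectrum.height_pos_iff_of_inf_eq_bot h0 h12 h21] at hht
    refine ⟨inferInstanceAs (P.comap f).IsPrime, ?_⟩
    rw [hpos]
    obtain ⟨r, hrJ, hr1, -⟩ := hf.exists_mem_notMem hht.1 hht.2
    intro hbot
    have : r ∈ P.comap f := hrJ
    change P.comap f = ⊥ at hbot
    rw [hbot, Ideal.mem_bot] at this
    rw [this, map_zero] at hr1
    exact hr1 (zero_mem _)
  · rintro P ⟨hP, hht⟩ P' ⟨hP', hht'⟩ heq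
    rw [PrimeSpectrum.height_pos_iff_of_inf_eq_bot h0 h12 h21] at hht hht'
    rw [← hf.map_comap (J := P) hht.1 hht.2, ← hf.map_comap (J := P') hht'.1 hht'.2]
    exact congrArg (Ideal.map f) heq
  · rintro p ⟨hp, hht⟩
    rw [hpos] at hht
    have h1 : ¬ p ≤ P₁.comap f := by rw [hP1]; exact fun h => hht (le_bot_iff.mp h)
    have h2 : ¬ p ≤ P₂.comap f := by rw [hP2]; exact fun h => hht (le_bot_iff.mp h)
    refine ⟨p.map f, ⟨hf.map_isPrime (hc p) h1 h2, ?_⟩, le_antisymm (hc p) Ideal.le_comap_map⟩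
    rw [PrimeSpectrum.height_pos_iff_of_inf_eq_bot h0 h12 h21]
    rw [← Ideal.map_le_iff_le_comap] at h1 h2
    exact ⟨h1, h2⟩

theorem RingHom.SurjectiveOff.exists_adicCompletion_ringEquiv {B T : Type*} [CommRing B]
    [CommRing T] [IsNoetherianRing B] [IsNoetherianRing T] [IsLocalRing B] [IsLocalRing T]
    {g : B →+* T} [IsLocalHom g] {Q₁ Q₂ : Ideal T} [Q₁.IsPrime] [Q₂.IsPrime]
    (hg : g.SurjectiveOff Q₁ Q₂) (h1 : ¬ maximalIdeal T ≤ Q₁) (h2 : ¬ maximalIdeal T ≤ Q₂)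
    (hc : ∀ p : Ideal B, (p.map g).comap g ≤ p) :
    Nonempty (AdicCompletion (maximalIdeal B) B ≃+* AdicCompletion (maximalIdeal T) T) := by
  have hm : (maximalIdeal B).map g = maximalIdeal T := by
    rw [← IsLocalRing.maximalIdeal_comap g]
    exact hg.map_comap h1 h2
  have hT : (algebraMap T (AdicCompletion (maximalIdeal T) T)).IsAdicCompletion
      ((maximalIdeal B).map g) := by
    rw [hm]
    exact AdicCompletion.isAdicCompletion (IsNoetherian.noetherian _)
  have hpow : ∀ Q : Ideal T, Q.IsPrime → ¬ maximalIdeal T ≤ Q → ∀ k,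
      ¬ ((maximalIdeal B) ^ k).map g ≤ Q := by
    intro Q hQ hn k h
    rw [Ideal.map_pow, hm] at h
    exact hn (hQ.le_of_pow_le h)
  have hB := hT.comp_of_quotient
    (fun k c => hg.exists_sub_mem (hpow _ inferInstance h1 k) (hpow _ inferInstance h2 k) c)
    (fun k a ha => hc _ ha)
  obtain ⟨e, -⟩ := (AdicCompletion.isAdicCompletion (A := B)
    (IsNoetherian.noetherian (maximalIdeal B))).exists_ringEquiv hB
  exact ⟨e⟩

/-- Krull's principal ideal theorem relative to a prime `P'`. -/
theorem Ideal.not_lt_lt_of_mem_minimalPrimes_sup_span {A : Type*} [CommRing A]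
    [IsNoetherianRing A] {P' P W : Ideal A} [P'.IsPrime] [W.IsPrime] {x : A}
    (hP : P ∈ (P' ⊔ Ideal.span {x}).minimalPrimes) (h1 : P' < W) (h2 : W < P) : False := by
  have hPp : P.IsPrime := hP.1.1
  have hP'P : P' ≤ P := (h1.trans h2).le
  have hsurj := Ideal.Quotient.mk_surjective (I := P')
  have hprime : ∀ {V : Ideal A}, V.IsPrime → P' ≤ V →
      (V.map (Ideal.Quotient.mk P')).IsPrime := fun hV hle =>
    Ideal.map_isPrime_of_surjective hsurj (by rwa [Ideal.mk_ker])
  have hc : ∀ {V : Ideal A}, P' ≤ V →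
      (V.map (Ideal.Quotient.mk P')).comap (Ideal.Quotient.mk P') = V := fun hle => by
    rw [Ideal.comap_map_of_surjective _ hsurj, ← RingHom.ker_eq_comap_bot, Ideal.mk_ker,
      sup_of_le_left hle]
  have := hprime hPp hP'P
  have := hprime ‹W.IsPrime› h1.le
  have hmin : P.map (Ideal.Quotient.mk P') ∈
      (Ideal.span {Ideal.Quotient.mk P' x}).minimalPrimes := by
    refine ⟨⟨hprime hPp hP'P, ?_⟩, ?_⟩
    · rw [Ideal.span_singleton_le_iff_mem]
      exact Ideal.mem_map_of_mem _ (hP.1.2 (Ideal.mem_sup_right (Ideal.mem_span_singleton_self x)))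
    · rintro V ⟨hV, hxV⟩ hVP
      rw [Ideal.map_le_iff_le_comap]
      refine hP.2 ⟨hV.comap _, sup_le ?_ ?_⟩ ?_
      · intro z hz
        rw [Ideal.mem_comap, Ideal.Quotient.eq_zero_iff_mem.mpr hz]
        exact zero_mem _
      · rw [Ideal.span_singleton_le_iff_mem] at hxV ⊢
        exact hxV
      · rw [← hc hP'P]
        exact Ideal.comap_mono hVP
  have hone := Ideal.height_le_one_of_isPrincipal_of_mem_minimalPrimes _ _ hmin
  have hlt1 : W.map (Ideal.Quotient.mk P') < P.map (Ideal.Quotient.mk P') := by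
    refine lt_of_le_of_ne (Ideal.map_mono h2.le) fun h => h2.ne ?_
    rw [← hc h1.le, h, hc hP'P]
  have hlt0 : (⊥ : Ideal (A ⧸ P')) < W.map (Ideal.Quotient.mk P') := by
    refine bot_lt_iff_ne_bot.mpr fun h => h1.ne ?_
    rw [← hc h1.le, h, ← RingHom.ker_eq_comap_bot, Ideal.mk_ker]
  have h3 := Ideal.height_strict_mono_of_isPrime_of_isPrime hlt0
  have h4 := Ideal.height_strict_mono_of_isPrime_of_isPrime hlt1
  have h5 : (1 : ℕ∞) ≤ (W.map (Ideal.Quotient.mk P')).height :=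
    Order.one_le_iff_pos.mpr (lt_of_le_of_lt bot_le h3)
  exact absurd (h5.trans_lt h4) (not_lt.mpr hone)

theorem Ideal.comap_eq_of_mem_minimalPrimes_map {A A' : Type*} [CommRing A] [CommRing A']
    {f : A →+* A'} (hf : f.Flat) {p : Ideal A} [p.IsPrime] {P : Ideal A'}
    (hP : P ∈ (p.map f).minimalPrimes) : P.comap f = p := by
  algebraize [f]
  have hPp : P.IsPrime := hP.1.1
  have hle : p ≤ P.comap f := Ideal.map_le_iff_le_comap.mp hP.1.2
  have : P.LiesOver (P.comap f) := ⟨rfl⟩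
  obtain ⟨W, hWP, hW, hWp⟩ := Ideal.exists_ideal_le_liesOver_of_le P hle
  have hWpe : p = W.comap f := hWp.over
  have : P ≤ W := hP.2 ⟨hW, Ideal.map_le_iff_le_comap.mpr hWpe.le⟩ hWP
  rw [le_antisymm this hWP, ← hWpe]

/-- Covering relations of primes lift downwards along flat homomorphisms. -/
theorem PrimeSpectrum.exists_covBy_of_flat {A A' : Type*} [CommRing A] [CommRing A']
    [IsNoetherianRing A'] {f : A →+* A'} (hf : f.Flat) {p' p : PrimeSpectrum A} (h : p' ⋖ p)
    {P : PrimeSpectrum A'} (hP : P.asIdeal ∈ (p.asIdeal.map f).minimalPrimes) :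
    ∃ P' : PrimeSpectrum A', P'.asIdeal ∈ (p'.asIdeal.map f).minimalPrimes ∧ P' ⋖ P := by
  have hlt : p'.asIdeal < p.asIdeal := h.1
  obtain ⟨P', hP', hP'P⟩ := Ideal.exists_minimalPrimes_le
    ((Ideal.map_mono hlt.le).trans hP.1.2 : p'.asIdeal.map f ≤ P.asIdeal)
  have hP'p : P'.IsPrime := hP'.1.1
  have hc' := Ideal.comap_eq_of_mem_minimalPrimes_map hf hP'
  have hc := Ideal.comap_eq_of_mem_minimalPrimes_map hf hP
  refine ⟨⟨P', hP'p⟩, hP', ?_, ?_⟩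
  · refine lt_of_le_of_ne hP'P fun h => hlt.ne ?_
    rw [← hc, ← hc', ← h]
  · obtain ⟨x, hx, hx'⟩ := Set.exists_of_ssubset hlt
    have hmin : P.asIdeal ∈ (P' ⊔ Ideal.span {f x}).minimalPrimes := by
      refine ⟨⟨P.2, sup_le hP'P ?_⟩, ?_⟩
      · rw [Ideal.span_singleton_le_iff_mem]
        exact hP.1.2 (Ideal.mem_map_of_mem f hx)
      · rintro W ⟨hW, hxW⟩ hWP
        rw [sup_le_iff, Ideal.span_singleton_le_iff_mem] at hxW
        refine hP.2 ⟨hW, ?_⟩ hWP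
        rw [Ideal.map_le_iff_le_comap]
        have h1 : p'.asIdeal < W.comap f := by
          refine lt_of_le_of_ne (hc'.ge.trans (Ideal.comap_mono hxW.1)) fun h => hx' ?_
          change x ∈ p'.asIdeal
          rw [h]
          exact hxW.2
        have h2 : W.comap f ≤ p.asIdeal := (Ideal.comap_mono hWP).trans hc.le
        by_contra h3
        exact h.2 (c := ⟨W.comap f, hW.comap f⟩) h1 (lt_of_le_not_ge h2 h3)
    intro W h1 h2
    exact Ideal.not_lt_lt_of_mem_minimalPrimes_sup_span (W := W.asIdeal) hmin h1 h2

theorem PrimeSpectrum.exists_relSeries_of_flat {A A' : Type*} [CommRing A] [CommRing A']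
    [IsNoetherianRing A'] {f : A →+* A'} (hf : f.Flat)
    (c : RelSeries {(P, Q) : PrimeSpectrum A × PrimeSpectrum A | P ⋖ Q})
    (P : PrimeSpectrum A') (hP : P.asIdeal ∈ (c.last.asIdeal.map f).minimalPrimes) :
    ∃ C : RelSeries {(P, Q) : PrimeSpectrum A' × PrimeSpectrum A' | P ⋖ Q},
      C.length = c.length ∧ C.last = P ∧ C.head.asIdeal ∈ (c.head.asIdeal.map f).minimalPrimes := by
  induction c using RelSeries.inductionOn' generalizing P with
  | singleton x => exact ⟨RelSeries.singleton _ P, rfl, rfl, hP⟩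
  | snoc c x hx ih =>
    rw [RelSeries.last_snoc] at hP
    obtain ⟨P', hP', hcov⟩ := PrimeSpectrum.exists_covBy_of_flat hf hx hP
    obtain ⟨C, hl, hlast, hhead⟩ := ih P' hP'
    refine ⟨C.snoc P (by rw [hlast]; exact hcov), by simp [hl], by simp, by simpa using hhead⟩

theorem PrimeSpectrum.exists_relSeries_isMin {A : Type*} [CommRing A] [IsNoetherianRing A]
    (p : PrimeSpectrum A) :
    ∃ c : RelSeries {(P, Q) : PrimeSpectrum A × PrimeSpectrum A | P ⋖ Q},
      IsMin c.head ∧ c.last = p := by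
  have hwf : WellFounded fun a b : PrimeSpectrum A => a.asIdeal.height < b.asIdeal.height :=
    InvImage.wf (fun a : PrimeSpectrum A => a.asIdeal.height) wellFounded_lt
  induction p using hwf.induction with
  | _ p ih =>
    by_cases hp : IsMin p
    · exact ⟨RelSeries.singleton _ p, hp, rfl⟩
    · obtain ⟨q, hq⟩ := not_isMin_iff.mp hp
      obtain ⟨m, ⟨hm, hm2⟩, hmax⟩ := set_has_maximal_iff_noetherian.mpr
        (inferInstance : IsNoetherian A A)
        {J : Ideal A | J.IsPrime ∧ J < p.asIdeal} ⟨q.asIdeal, q.2, hq⟩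
      obtain ⟨c, hc1, hc2⟩ := ih ⟨m, hm⟩ (Ideal.height_strict_mono_of_isPrime_of_isPrime hm2)
      have hcov : c.last ⋖ p := by
        rw [hc2]
        exact ⟨hm2, fun W h1 h2 => hmax W.asIdeal ⟨W.2, h2⟩ h1⟩
      exact ⟨c.snoc p hcov, by simpa using hc1, by simp⟩

theorem PrimeSpectrum.isMin_iff_mem_minimalPrimes {A : Type*} [CommRing A] (p : PrimeSpectrum A) :
    IsMin p ↔ p.asIdeal ∈ minimalPrimes A :=
  ⟨fun h => ⟨⟨p.2, bot_le⟩, fun _ hq hle => h (b := ⟨_, hq.1⟩) hle⟩,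
    fun h q hle => h.2 ⟨q.2, bot_le⟩ hle⟩

theorem IsCatenaryRing.of_flat {A A' : Type u} [CommRing A] [CommRing A'] [IsNoetherianRing A]
    [IsNoetherianRing A'] [IsLocalRing A] [IsLocalRing A'] {f : A →+* A'} [IsLocalHom f]
    (hf : f.Flat) (hA' : IsCatenaryRing A')
    (hmin : ∀ p ∈ minimalPrimes A, (p.map f).IsPrime) : IsCatenaryRing A := by
  intro c₁ c₂ hhead hlast
  obtain ⟨c, hc, hcl⟩ := PrimeSpectrum.exists_relSeries_isMin c₁.head
  have hprime := hmin _ ((PrimeSpectrum.isMin_iff_mem_minimalPrimes _).mp hc)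
  have hne : c₁.last.asIdeal.map f ≠ ⊤ := Ideal.map_ne_top_of_isLocalHom f c₁.last.2.ne_top
  obtain ⟨P, hP⟩ := Ideal.nonempty_minimalPrimes hne
  let P' : PrimeSpectrum A' := ⟨P, hP.1.1⟩
  obtain ⟨C₁, hl₁, hlast₁, hhead₁⟩ := PrimeSpectrum.exists_relSeries_of_flat hf
    (c.smash c₁ hcl) P' (by simpa using hP)
  obtain ⟨C₂, hl₂, hlast₂, hhead₂⟩ := PrimeSpectrum.exists_relSeries_of_flat hf
    (c.smash c₂ (hcl.trans hhead)) P' (by rw [RelSeries.last_smash, ← hlast]; exact hP)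
  rw [RelSeries.head_smash, Ideal.minimalPrimes_eq_subsingleton_self, Set.mem_singleton_iff]
    at hhead₁ hhead₂
  have := hA' C₁ C₂ (PrimeSpectrum.ext (hhead₁.trans hhead₂.symm)) (hlast₁.trans hlast₂.symm)
  rw [hl₁, hl₂] at this
  simpa [RelSeries.smash] using this

theorem RingHom.Flat.ringKrullDim_quotient_map_eq {A A' : Type u} [CommRing A] [CommRing A']
    [IsNoetherianRing A] [IsNoetherianRing A'] [IsLocalRing A] [IsLocalRing A'] {f : A →+* A'}
    [IsLocalHom f]
    (hf : f.Flat) (hm : (maximalIdeal A).map f = maximalIdeal A') {p : Ideal A} [p.IsPrime] :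
    ringKrullDim (A' ⧸ p.map f) = ringKrullDim (A ⧸ p) := by
  have h1 : p ≤ maximalIdeal A := le_maximalIdeal ‹p.IsPrime›.ne_top
  have h2 : p.map f ≤ maximalIdeal A' := hm ▸ Ideal.map_mono h1
  have := IsLocalRing.quotient_of_le h1
  have := IsLocalRing.quotient_of_le h2
  let g : A ⧸ p →+* A' ⧸ p.map f := Ideal.quotientMap (p.map f) f Ideal.le_comap_map
  have hg : g.Flat := RingHom.Flat.quotientMap hf p
  have : IsLocalHom g := isLocalHom_quotientMap f p _
    (ne_top_of_le_ne_top (IsLocalRing.maximalIdeal.isMaximal A').ne_top h2) _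
  have hgm : (maximalIdeal (A ⧸ p)).map g = maximalIdeal (A' ⧸ p.map f) := by
    rw [← IsLocalRing.map_maximalIdeal_of_surjective' _ Ideal.Quotient.mk_surjective,
      ← IsLocalRing.map_maximalIdeal_of_surjective' _ Ideal.Quotient.mk_surjective,
      Ideal.map_map, Ideal.quotientMap_comp_mk, ← Ideal.map_map, hm]
  algebraize [g]
  have hlies : (maximalIdeal (A' ⧸ p.map f)).LiesOver (maximalIdeal (A ⧸ p)) :=
    ⟨(IsLocalRing.maximalIdeal_comap g).symm⟩
  have := Ideal.height_eq_height_add_of_liesOver_of_hasGoingDown (maximalIdeal (A ⧸ p))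
    (maximalIdeal (A' ⧸ p.map f))
  have hz : ((maximalIdeal (A' ⧸ p.map f)).map
      (Ideal.Quotient.mk
        ((maximalIdeal (A ⧸ p)).map (algebraMap _ (A' ⧸ p.map f))))).height = 0 := by
    rw [show algebraMap _ (A' ⧸ p.map f) = g from rfl, hgm, Ideal.map_quotient_self]
    have : Nontrivial ((A' ⧸ p.map f) ⧸ maximalIdeal (A' ⧸ p.map f)) :=
      Ideal.Quotient.nontrivial_iff.mpr (IsLocalRing.maximalIdeal.isMaximal _).ne_top
    exact Ideal.height_bot
  rw [hz, add_zero] at this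
  rw [← IsLocalRing.maximalIdeal_height_eq_ringKrullDim, this,
    IsLocalRing.maximalIdeal_height_eq_ringKrullDim]

theorem exists_minimalPrimes_equiv_of_flat {A A' : Type u} [CommRing A] [CommRing A']
    [IsNoetherianRing A] [IsNoetherianRing A'] [IsLocalRing A] [IsLocalRing A'] {f : A →+* A'}
    [IsLocalHom f]
    (hf : f.Flat) (hm : (maximalIdeal A).map f = maximalIdeal A')
    (hmin : ∀ p ∈ minimalPrimes A, (p.map f).IsPrime) :
    ∃ e : {P : Ideal A' // P ∈ minimalPrimes A'} ≃ {p : Ideal A // p ∈ minimalPrimes A},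
      ∀ P, ringKrullDim (A' ⧸ P.val) = ringKrullDim (A ⧸ (e P).val) := by
  have hc : ∀ p ∈ minimalPrimes A, (p.map f).comap f = p := fun p hp => by
    have := hp.1.1
    have := hmin p hp
    exact Ideal.comap_eq_of_mem_minimalPrimes_map hf
      (by rw [Ideal.minimalPrimes_eq_subsingleton_self]; rfl)
  have hcomap : ∀ P ∈ minimalPrimes A', P.comap f ∈ minimalPrimes A := fun P hP => by
    algebraize [f]
    have := hP.1.1
    obtain ⟨p, hp, hpP⟩ := Ideal.exists_minimalPrimes_le (bot_le (a := P.comap f))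
    have := hp.1.1
    have : P.LiesOver (P.comap f) := ⟨rfl⟩
    obtain ⟨W, hWP, hW, hWp⟩ := Ideal.exists_ideal_le_liesOver_of_le P hpP
    have hWpe : p = W.comap f := hWp.over
    rw [le_antisymm (hP.2 ⟨hW, bot_le⟩ hWP) hWP, ← hWpe]
    exact hp
  have hmap : ∀ p ∈ minimalPrimes A, p.map f ∈ minimalPrimes A' := fun p hp => by
    have := hmin p hp
    refine ⟨⟨hmin p hp, bot_le⟩, fun W hW hle => ?_⟩
    rw [Ideal.map_le_iff_le_comap]
    have := hW.1
    exact hp.2 ⟨inferInstance, bot_le⟩ ((Ideal.comap_mono hle).trans (hc p hp).le)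
  have hmc : ∀ P ∈ minimalPrimes A', (P.comap f).map f = P := fun P hP =>
    le_antisymm Ideal.map_comap_le
      (hP.2 ⟨hmin _ (hcomap P hP), bot_le⟩ Ideal.map_comap_le)
  refine ⟨⟨fun P => ⟨P.1.comap f, hcomap _ P.2⟩, fun p => ⟨p.1.map f, hmap _ p.2⟩,
    fun P => Subtype.ext (hmc _ P.2), fun p => Subtype.ext (hc _ p.2)⟩, fun P => ?_⟩
  have := (hcomap _ P.2).1.1
  change _ = ringKrullDim (A ⧸ P.1.comap f)
  rw [← hf.ringKrullDim_quotient_map_eq hm, hmc _ P.2]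

theorem Ideal.isPrime_map_of_surjective_of_isLocalization {S T : Type*} [CommRing S] [CommRing T]
    {p : S →+* T} (hp : Function.Surjective p) {E : Ideal S} [E.IsPrime] (hE : RingHom.ker p ≤ E)
    {Q : Ideal T} [Q.IsPrime] (hEQ : E ≤ Q.comap p) :
    (E.map ((algebraMap T (Localization.AtPrime Q)).comp p)).IsPrime := by
  have := Ideal.map_isPrime_of_surjective hp hE
  rw [← Ideal.map_map]
  refine IsLocalization.isPrime_of_isPrime_disjoint Q.primeCompl _ _ this ?_
  exact Set.disjoint_left.mpr fun x hx hx' => hx (Ideal.map_le_iff_le_comap.mpr hEQ hx')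

theorem Ideal.map_le_map_of_mul_mem {S A : Type*} [CommRing S] [CommRing A] (h : S →+* A)
    {E E' : Ideal S} (c : S) (hc : IsUnit (h c)) (hE : ∀ x ∈ E', c * x ∈ E) :
    E'.map h ≤ E.map h := by
  rw [Ideal.map_le_iff_le_comap]
  intro x hx
  have := Ideal.mem_map_of_mem h (hE x hx)
  rw [_root_.map_mul] at this
  exact (Ideal.unit_mul_mem_iff_mem _ hc).mp this

theorem Ideal.exists_map_eq_of_mem_minimalPrimes {W A : Type*} [CommRing W] [CommRing A]
    (u : W →+* A) {I : Ideal W} (hI : I.map u = ⊥)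
    (hprime : ∀ 𝔮 ∈ I.minimalPrimes, (𝔮.map u).IsPrime) {p : Ideal A} (hp : p ∈ minimalPrimes A) :
    ∃ 𝔮 ∈ I.minimalPrimes, 𝔮.map u = p := by
  have := hp.1.1
  have hIp : I ≤ p.comap u := by rw [← Ideal.map_le_iff_le_comap, hI]; exact bot_le
  obtain ⟨𝔮, h𝔮, hle⟩ := Ideal.exists_minimalPrimes_le hIp
  rw [← Ideal.map_le_iff_le_comap] at hle
  exact ⟨𝔮, h𝔮, le_antisymm hle (hp.2 ⟨hprime 𝔮 h𝔮, bot_le⟩ hle)⟩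

namespace MvPowerSeries
variable {n : ℕ}

theorem map_comp_map_algebraMap {R X : Type u} [CommRing R] [CommRing X] [Algebra ℚ R]
    [Algebra ℚ X] (f : R →+* X) : (map (σ := Fin n) f).comp (map (algebraMap ℚ R)) =
      map (algebraMap ℚ X) := by
  rw [← RingHom.ext_rat (f.comp (algebraMap ℚ R)) (algebraMap ℚ X)]
  rfl

theorem map_psExt {R X : Type u} [CommRing R] [CommRing X] [Algebra ℚ R]
    [Algebra ℚ X] (f : R →+* X) (J : Ideal (MvPowerSeries (Fin n) ℚ)) :
    (J.psExt n R).map (map (σ := Fin n) f) = J.psExt n X := by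
  rw [Ideal.psExt, Ideal.map_map, map_comp_map_algebraMap, Ideal.psExt]

theorem psExt_le_varIdeal {J : Ideal (MvPowerSeries (Fin n) ℚ)} (hJ : J ≠ ⊤) (X : Type u)
    [CommRing X] [Algebra ℚ X] : J.psExt n X ≤ varIdeal (Fin n) X := by
  rw [Ideal.psExt, ← map_varIdeal (algebraMap ℚ X)]
  refine Ideal.map_mono fun f hf => ?_
  rw [mem_varIdeal_iff]
  by_contra h
  exact hJ (Ideal.eq_top_of_isUnit_mem _ hf
    (isUnit_iff_constantCoeff.mpr (isUnit_iff_ne_zero.mpr h)))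

theorem varIdeal_le_comap_constantCoeff {X : Type*} [CommRing X] (P : Ideal X) :
    varIdeal (Fin n) X ≤ P.comap constantCoeff := by
  rw [← ker_constantCoeff]
  exact Ideal.ker_le_comap _

theorem surjective_map {σ R X : Type*} [CommRing R] [CommRing X] (f : R →+* X)
    (hf : Function.Surjective f) : Function.Surjective (map (σ := σ) f) := fun z =>
  ⟨fun d => (hf (coeff d z)).choose, by
    ext d
    exact (hf (coeff d z)).choose_spec⟩

theorem isPrime_map_localRingHom_of_mem_minimalPrimes {I : Ideal (MvPowerSeries (Fin n) ℚ)}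
    (hprime : ∀ 𝔮 ∈ I.minimalPrimes, ∀ (D : Type u) [CommRing D] [IsDomain D] [Algebra ℚ D],
      (𝔮.psExt n D).IsPrime) {R X B T : Type u} [CommRing R] [CommRing X] [CommRing B] [CommRing T]
    [Algebra ℚ R] [Algebra ℚ X] [IsDomain R] {f : R →+* X} {P P' : Ideal X} [P.IsPrime]
    (hPP' : P ⊓ P' = ⊥) (h : ¬ P' ≤ P) {s : MvPowerSeries (Fin n) R →+* B}
    (hs : Function.Surjective s) (hsk : RingHom.ker s = I.psExt n R)
    {p : MvPowerSeries (Fin n) X →+* T} (hp : Function.Surjective p)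
    (hpk : RingHom.ker p = I.psExt n X) {g : B →+* T} (hg : g.comp s = p.comp (map f))
    {Q : Ideal T} [Q.IsPrime] (hQ : Q.comap p = P.comap constantCoeff)
    {q : Ideal B} [q.IsPrime] (hq : q = Q.comap g) (p₀ : Ideal (Localization.AtPrime q))
    (hp₀ : p₀ ∈ minimalPrimes (Localization.AtPrime q)) :
    (p₀.map (Localization.localRingHom q Q g hq)).IsPrime := by
  have hqs : q.comap s = (P.comap f).comap constantCoeff := by
    rw [hq, Ideal.comap_comap, hg, ← Ideal.comap_comap, hQ, Ideal.comap_comap, Ideal.comap_comap]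
    congr 1
  have hle : ∀ 𝔮 ∈ I.minimalPrimes, ∀ (X : Type u) [CommRing X] [Algebra ℚ X] (P : Ideal X),
      𝔮.psExt n X ≤ P.comap constantCoeff := fun 𝔮 h𝔮 X _ _ P =>
    (psExt_le_varIdeal h𝔮.1.1.ne_top X).trans (varIdeal_le_comap_constantCoeff P)
  let u : MvPowerSeries (Fin n) ℚ →+* Localization.AtPrime q :=
    ((algebraMap B (Localization.AtPrime q)).comp s).comp (map (algebraMap ℚ R))
  have hu : ∀ J : Ideal (MvPowerSeries (Fin n) ℚ), J.map u =
      (J.psExt n R).map ((algebraMap B (Localization.AtPrime q)).comp s) := fun J => by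
    rw [Ideal.psExt, Ideal.map_map]
  have huI : I.map u = ⊥ := by
    rw [hu, ← hsk, ← Ideal.map_map, (Ideal.map_eq_bot_iff_le_ker s).mpr le_rfl, Ideal.map_bot]
  obtain ⟨𝔮, h𝔮, rfl⟩ := Ideal.exists_map_eq_of_mem_minimalPrimes u huI (fun 𝔮 h𝔮 => by
    have := hprime 𝔮 h𝔮 R
    rw [hu]
    refine Ideal.isPrime_map_of_surjective_of_isLocalization hs ?_ ?_
    · rw [hsk]
      exact Ideal.map_mono h𝔮.1.2
    · rw [hqs]
      exact hle 𝔮 h𝔮 R _) hp₀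
  let E : Ideal (MvPowerSeries (Fin n) X) := (𝔮.psExt n (X ⧸ P)).comap (map (Ideal.Quotient.mk P))
  have := hprime 𝔮 h𝔮 (X ⧸ P)
  have hE : E.IsPrime := Ideal.comap_isPrime _ _
  have hE1 : 𝔮.psExt n X ≤ E := by
    rw [← Ideal.map_le_iff_le_comap, map_psExt]
  have hE2 : (E.map ((algebraMap T (Localization.AtPrime Q)).comp p)).IsPrime := by
    refine Ideal.isPrime_map_of_surjective_of_isLocalization hp ?_ ?_
    · rw [hpk]
      exact (Ideal.map_mono h𝔮.1.2).trans hE1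
    · rw [hQ]
      intro x hx
      have := hle 𝔮 h𝔮 (X ⧸ P) ⊥ hx
      simpa [Ideal.Quotient.eq_zero_iff_mem] using this
  obtain ⟨c, hcP', hcP⟩ := Set.not_subset.mp h
  have hcE : ∀ x ∈ E, C c * x ∈ 𝔮.psExt n X := by
    intro x hx
    have hx' : map (Ideal.Quotient.mk P) x ∈
        (𝔮.psExt n X).map (map (σ := Fin n) (Ideal.Quotient.mk P)) := by
      rw [map_psExt]
      exact hx
    have hsurj : Function.Surjective (map (σ := Fin n) (Ideal.Quotient.mk P)) :=
      MvPowerSeries.surjective_map _ Ideal.Quotient.mk_surjective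
    obtain ⟨z, hz, hzx⟩ := (Ideal.mem_map_iff_of_surjective _ hsurj).mp hx'
    have : C c * x = C c * z := by
      ext d
      rw [coeff_C_mul, coeff_C_mul, ← sub_eq_zero, ← mul_sub]
      have h1 : coeff d x - coeff d z ∈ P := by
        have := congrArg (coeff d) hzx
        rw [coeff_map, coeff_map, eq_comm, ← sub_eq_zero, ← map_sub] at this
        exact Ideal.Quotient.eq_zero_iff_mem.mp this
      have h2 : c * (coeff d x - coeff d z) ∈ P ⊓ P' :=
        ⟨Ideal.mul_mem_left _ _ h1, Ideal.mul_mem_right _ _ hcP'⟩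
      rw [hPP'] at h2
      exact h2
    rw [this]
    exact Ideal.mul_mem_left _ _ hz
  have hunit : IsUnit (((algebraMap T (Localization.AtPrime Q)).comp p) (C c)) := by
    refine IsLocalization.map_units (Localization.AtPrime Q) (⟨p (C c), fun hmem => hcP ?_⟩ :
      Q.primeCompl)
    have : C c ∈ Q.comap p := hmem
    rw [hQ] at this
    simpa using this
  have heq : (𝔮.map u).map (Localization.localRingHom q Q g hq) =
      (𝔮.psExt n X).map ((algebraMap T (Localization.AtPrime Q)).comp p) := by
    rw [hu, Ideal.map_map, ← RingHom.comp_assoc]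
    have h1 : (Localization.localRingHom q Q g hq).comp (algebraMap B (Localization.AtPrime q)) =
        (algebraMap T (Localization.AtPrime Q)).comp g := by
      ext x
      exact Localization.localRingHom_to_map q Q g hq x
    rw [h1, RingHom.comp_assoc, hg, ← RingHom.comp_assoc, ← Ideal.map_map, map_psExt]
  rw [heq, le_antisymm (Ideal.map_mono hE1) (Ideal.map_le_map_of_mul_mem _ (C c) hunit hcE)]
  exact hE2
end MvPowerSeries

theorem Derivation.eq_zero_of_isIntegral {Λ C : Type*} [CommRing Λ] [CommRing C] [IsDomain C]
    [CharZero C] [Algebra Λ C] [Algebra.IsIntegral Λ C] (δ : Derivation Λ C C) : δ = 0 := by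
  ext c
  by_contra hc
  change δ c ≠ 0 at hc
  suffices H : ∀ (N : ℕ) (p : Polynomial Λ), p.natDegree ≤ N → Polynomial.aeval c p = 0 →
      p.map (algebraMap Λ C) = 0 by
    obtain ⟨p, hp, hpc⟩ := Algebra.IsIntegral.isIntegral (R := Λ) c
    exact (hp.map (algebraMap Λ C)).ne_zero (H _ p le_rfl hpc)
  intro N
  induction N with
  | zero =>
    intro p hp h
    obtain ⟨a, rfl⟩ := Polynomial.natDegree_eq_zero.mp (Nat.le_zero.mp hp)
    rw [Polynomial.aeval_C] at h
    rw [Polynomial.map_C, h, Polynomial.C_0]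
  | succ N ih =>
    intro p hp h
    have h1 : Polynomial.aeval c p.derivative • δ c = 0 := by
      rw [← Derivation.map_aeval, h, _root_.map_zero]
    have h2 := ih p.derivative ((Polynomial.natDegree_derivative_le p).trans (by lia))
      ((smul_eq_zero.mp h1).resolve_right hc)
    rw [← Polynomial.derivative_map] at h2
    have h3 := Polynomial.derivative_eq_zero.mp h2
    obtain ⟨a, ha⟩ := Polynomial.natDegree_eq_zero.mp h3
    rw [Polynomial.aeval_def, Polynomial.eval₂_eq_eval_map, ← ha, Polynomial.eval_C] at h
    rw [← ha, h, Polynomial.C_0]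

theorem IsPrecomplete.pi {A ι M : Type*} [CommRing A] [AddCommGroup M] [Module A M] [Finite ι]
    {J : Ideal A} [IsPrecomplete J M] : IsPrecomplete J (ι → M) := by
  classical
  have := Fintype.ofFinite ι
  have key : ∀ (k : ℕ) (x : ι → M), x ∈ (J ^ k • ⊤ : Submodule A (ι → M)) ↔
      ∀ i, x i ∈ (J ^ k • ⊤ : Submodule A M) := by
    intro k x
    constructor
    · intro hx i
      have := Submodule.mem_map_of_mem (f := LinearMap.proj i) hx
      rw [Submodule.map_smul''] at this
      exact Submodule.smul_mono le_rfl le_top this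
    · intro hx
      have hx' : x = ∑ i, LinearMap.single A (fun _ => M) i (x i) := by
        simp [LinearMap.single_apply, Finset.univ_sum_single]
      rw [hx']
      refine sum_mem fun i _ => ?_
      have := Submodule.mem_map_of_mem (f := LinearMap.single A (fun _ => M) i) (hx i)
      rw [Submodule.map_smul''] at this
      exact Submodule.smul_mono le_rfl le_top this
  refine ⟨fun f hf => ?_⟩
  have h : ∀ i, ∃ L : M, ∀ k, f k i ≡ L [SMOD (J ^ k • ⊤ : Submodule A M)] := fun i => by
    refine IsPrecomplete.prec ‹_› fun {a b} hab => ?_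
    have := hf hab
    rw [SModEq.sub_mem] at this ⊢
    exact (key _ _).mp this i
  choose L hL using h
  refine ⟨L, fun k => ?_⟩
  rw [SModEq.sub_mem, key]
  intro i
  have := hL i k
  rw [SModEq.sub_mem] at this
  exact this

/-- A complete version of Nakayama's lemma. -/
theorem Module.Finite.of_isPrecomplete {A M : Type*} [CommRing A] [AddCommGroup M] [Module A M]
    {J : Ideal A} [IsPrecomplete J A] [IsHausdorff J M] (s : Finset M)
    (hs : Submodule.span A (s : Set M) ⊔ J • ⊤ = ⊤) : Module.Finite A M := by
  have := IsPrecomplete.pi (A := A) (ι := s) (M := A) (J := J)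
  let F : (s → A) →ₗ[A] M := Fintype.linearCombination A (fun i : s => (i : M))
  have hF : LinearMap.range F = Submodule.span A (s : Set M) := by
    rw [Fintype.range_linearCombination]
    simp
  refine Module.Finite.of_surjective F (surjective_of_mkQ_comp_surjective (I := J) ?_)
  rw [← LinearMap.range_eq_top, LinearMap.range_comp, hF, eq_top_iff, ← Submodule.range_mkQ,
    ← Submodule.map_top, ← hs, Submodule.map_sup]
  refine sup_le le_rfl ?_
  rw [hs, Submodule.mkQ_map_self]
  exact bot_le

theorem IsLocalRing.exists_finset_span_sup_pow_eq_top {K C : Type*} [Field K] [CommRing C]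
    [IsNoetherianRing C] [IsLocalRing C] [Algebra K C]
    (hres : ∀ c : C, ∃ k : K, c - algebraMap K C k ∈ maximalIdeal C) (k : ℕ) :
    ∃ s : Finset C, ∀ c : C, ∃ x ∈ Submodule.span K (s : Set C), c - x ∈ maximalIdeal C ^ k := by
  classical
  induction k with
  | zero => exact ⟨∅, fun c => ⟨0, zero_mem _, by simp⟩⟩
  | succ k ih =>
    obtain ⟨s, hs⟩ := ih
    obtain ⟨t, ht⟩ := IsNoetherian.noetherian (maximalIdeal C ^ k)
    refine ⟨s ∪ t, fun c => ?_⟩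
    obtain ⟨x, hx, hcx⟩ := hs c
    have key : ∀ y ∈ maximalIdeal C ^ k, ∃ w ∈ Submodule.span K (t : Set C),
        y - w ∈ maximalIdeal C ^ (k + 1) := by
      intro y hy
      rw [← ht] at hy
      induction hy using Submodule.span_induction with
      | mem y hy => exact ⟨y, Submodule.subset_span hy, by simp⟩
      | zero => exact ⟨0, zero_mem _, by simp⟩
      | add a b ha hb iha ihb =>
        obtain ⟨w, hw, h⟩ := iha
        obtain ⟨w', hw', h'⟩ := ihb
        exact ⟨w + w', add_mem hw hw', by rw [add_sub_add_comm]; exact add_mem h h'⟩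
      | smul a b hb ihb =>
        obtain ⟨w, hw, h⟩ := ihb
        obtain ⟨r, hr⟩ := hres a
        refine ⟨r • w, Submodule.smul_mem _ _ hw, ?_⟩
        have hb' : b ∈ maximalIdeal C ^ k := by rw [← ht]; exact hb
        have h1 : (a - algebraMap K C r) * b ∈ maximalIdeal C ^ (k + 1) := by
          rw [pow_succ']
          exact Ideal.mul_mem_mul hr hb'
        have h2 := add_mem h1 (Ideal.mul_mem_left _ (algebraMap K C r) h)
        convert! h2 using 1
        rw [smul_eq_mul, Algebra.smul_def r w]
        ring
    obtain ⟨w, hw, h⟩ := key _ hcx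
    refine ⟨x + w, add_mem (Submodule.span_mono (by simp) hx)
      (Submodule.span_mono (by simp) hw), ?_⟩
    rw [← sub_sub]
    exact h

theorem Derivation.map_pow_succ_le {K C : Type*} [CommRing K] [CommRing C] [Algebra K C]
    (δ : Derivation K C C) (J : Ideal C) (k : ℕ) {x : C} (hx : x ∈ J ^ (k + 1)) :
    δ x ∈ J ^ k := by
  induction k generalizing x with
  | zero => simp
  | succ k ih =>
    rw [pow_succ] at hx
    induction hx using Submodule.mul_induction_on' with
    | mem_mul_mem a ha b hb =>
      rw [Derivation.leibniz, smul_eq_mul, smul_eq_mul]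
      refine add_mem (Ideal.mul_mem_right _ _ ha) ?_
      rw [mul_comm, pow_succ]
      exact Ideal.mul_mem_mul (ih ha) hb
    | add a _ b _ iha ihb =>
      rw [_root_.map_add]
      exact add_mem iha ihb

theorem Derivation.eq_zero_of_isAdicComplete {K C : Type*} [Field K] [CharZero K] [CommRing C]
    [IsDomain C] [IsNoetherianRing C] [IsLocalRing C] [Algebra K C]
    [IsAdicComplete (maximalIdeal C) C]
    (hres : ∀ c : C, ∃ k : K, c - algebraMap K C k ∈ maximalIdeal C) {d : ℕ} (z : Fin d → C)
    (hz : ∀ j, z j ∈ maximalIdeal C) {N : ℕ} (hN : maximalIdeal C ^ N ≤ Ideal.span (Set.range z))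
    (δ : Derivation K C C) (hδ : ∀ j, δ (z j) = 0) : δ = 0 := by
  have : CharZero C := charZero_of_injective_algebraMap (algebraMap K C).injective
  have hcomp := MvPowerSeries.isAdicCompletion (Fin d) K
  let g : MvPolynomial (Fin d) K →+* C := (MvPolynomial.aeval z).toRingHom
  have hg : (MvPolynomial.idealOfVars (Fin d) K).map g = Ideal.span (Set.range z) := by
    rw [MvPolynomial.idealOfVars, Ideal.map_span, ← Set.range_comp]
    congr 2
    ext j
    simp [g]
  have hgm : Ideal.span (Set.range z) ≤ maximalIdeal C := by
    rw [Ideal.span_le]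
    rintro _ ⟨j, rfl⟩
    exact hz j
  obtain ⟨G, hG⟩ := hcomp.exists_lift g (maximalIdeal C) (hg.le.trans hgm)
  have hδG : ∀ Φ, δ (G Φ) = 0 := by
    intro Φ
    have : ∀ k, δ (G Φ) ∈ maximalIdeal C ^ k := by
      intro k
      obtain ⟨p, hp⟩ := hcomp.exists_sub_mem (k + 1) Φ
      have h1 : δ (g p) = 0 := by
        have hmem : g p ∈ Algebra.adjoin K (Set.range z) := by
          rw [Algebra.adjoin_range_eq_range_aeval]
          exact ⟨p, rfl⟩
        exact Derivation.eqOn_adjoin (D1 := δ) (D2 := 0) (by rintro _ ⟨j, rfl⟩; exact hδ j) hmem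
      have h2 := Ideal.mem_map_of_mem G hp
      rw [Ideal.map_map, hG, Ideal.map_pow, hg] at h2
      have h3 := δ.map_pow_succ_le (maximalIdeal C) k (Ideal.pow_right_mono hgm _ h2)
      have h4 : G Φ = g p + G (Φ - MvPolynomial.coeToMvPowerSeries.ringHom p) := by
        rw [← hG, RingHom.comp_apply, ← _root_.map_add, add_sub_cancel]
      rw [h4, _root_.map_add, h1, zero_add]
      exact h3
    have h := Ideal.iInf_pow_eq_bot_of_isLocalRing (maximalIdeal C)
      (IsLocalRing.maximalIdeal.isMaximal C).ne_top
    rw [← Ideal.mem_bot, ← h]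
    exact (Submodule.mem_iInf _).mpr this
  algebraize [G]
  have hinteg : Algebra.IsIntegral (MvPowerSeries (Fin d) K) C := by
    let J := Ideal.span (Set.range (MvPowerSeries.X : Fin d → MvPowerSeries (Fin d) K))
    have hJ : J.map (algebraMap (MvPowerSeries (Fin d) K) C) = Ideal.span (Set.range z) := by
      rw [← hg, ← hG, ← Ideal.map_map, MvPowerSeries.map_idealOfVars]
      rfl
    have : IsHausdorff J C := by
      rw [← IsHausdorff.map_algebraMap_iff (S := C), hJ]
      refine IsHausdorff.of_le_jacobson _ _ ?_
      rw [IsLocalRing.jacobson_eq_maximalIdeal ⊥ bot_ne_top]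
      exact hgm
    obtain ⟨s, hs⟩ := IsLocalRing.exists_finset_span_sup_pow_eq_top hres N
    have : Module.Finite (MvPowerSeries (Fin d) K) C := by
      refine Module.Finite.of_isPrecomplete (J := J) s (eq_top_iff.mpr fun c _ => ?_)
      obtain ⟨x, hx, hcx⟩ := hs c
      rw [← add_sub_cancel x c]
      refine Submodule.add_mem_sup ?_ ?_
      · clear hcx
        induction hx using Submodule.span_induction with
        | mem y hy => exact Submodule.subset_span hy
        | zero => exact zero_mem _
        | add a b _ _ iha ihb => exact add_mem iha ihb
        | smul a b _ ihb =>
          have h1 : a • b = (MvPowerSeries.C a : MvPowerSeries (Fin d) K) • b := by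
            rw [Algebra.smul_def, Algebra.smul_def]
            congr 1
            have := RingHom.congr_fun hG (MvPolynomial.C a)
            simp only [RingHom.comp_apply, MvPolynomial.coeToMvPowerSeries.ringHom_apply,
              MvPolynomial.coe_C] at this
            exact ((MvPolynomial.aeval_C z a).symm.trans this.symm)
          rw [h1]
          exact Submodule.smul_mem _ _ ihb
      · rw [Ideal.smul_top_eq_map, hJ]
        exact hN hcx
    infer_instance
  let L : C →ₗ[MvPowerSeries (Fin d) K] C :=
    { toFun := δ
      map_add' := δ.map_add
      map_smul' := by
        intro Φ c
        rw [Algebra.smul_def, Derivation.leibniz]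
        change _ • _ + _ • δ (G Φ) = _
        rw [hδG, smul_zero, add_zero, algebraMap_smul]
        rfl }
  have h0 := Derivation.eq_zero_of_isIntegral (Derivation.mk' L fun a b => δ.leibniz a b)
  ext c
  exact congrArg (fun D => D c) h0

theorem IsAdicComplete.of_surjective {A C : Type*} [CommRing A] [CommRing C] [IsNoetherianRing A]
    {J : Ideal A} [IsAdicComplete J A] (π : A →+* C) (hπ : Function.Surjective π) :
    IsAdicComplete (J.map π) C := by
  algebraize [π]
  have : Module.Finite A C := Module.Finite.of_surjective (Algebra.linearMap A C) hπ
  have h1 : IsPrecomplete J C := by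
    rw [← AdicCompletion.of_surjective_iff]
    intro y
    obtain ⟨x, rfl⟩ := AdicCompletion.map_surjective J (f := Algebra.linearMap A C) hπ y
    obtain ⟨a, rfl⟩ := AdicCompletion.of_surjective J A x
    exact ⟨algebraMap A C a, (AdicCompletion.map_of J (Algebra.linearMap A C) a).symm⟩
  have h2 : IsHausdorff J C := IsHausdorff.of_le_jacobson _ _ (IsAdicComplete.le_jacobson_bot J)
  have h3 : IsAdicComplete J C := { h1, h2 with }
  exact (IsAdicComplete.map_algebraMap_iff J C (S := C)).mpr h3

theorem Ideal.height_add_ringKrullDim_quotient_le {A : Type*} [CommRing A] (N : Ideal A)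
    [hN : N.IsPrime] : (N.height : WithBot ℕ∞) + ringKrullDim (A ⧸ N) ≤ ringKrullDim A := by
  have : Nonempty (PrimeSpectrum A) := ⟨⟨N, hN⟩⟩
  have h1 : ringKrullDim (A ⧸ N) = Order.coheight (⟨N, hN⟩ : PrimeSpectrum A) := by
    rw [ringKrullDim_quotient, Order.coheight_eq_krullDim_Ici]
    congr 2
  have h2 : N.height = Order.height (⟨N, hN⟩ : PrimeSpectrum A) :=
    PrimeSpectrum.height_eq_orderHeight ⟨N, hN⟩
  rw [h1, h2, ringKrullDim,
    Order.krullDim_eq_iSup_height_add_coheight_of_nonempty]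
  exact_mod_cast le_iSup (fun a : PrimeSpectrum A => Order.height a + Order.coheight a) ⟨N, hN⟩

theorem MvPowerSeries.maximalIdeal_eq_varIdeal (σ K : Type*) [Finite σ] [Field K] :
    maximalIdeal (MvPowerSeries σ K) = varIdeal σ K := by
  ext f
  rw [mem_varIdeal_iff, IsLocalRing.mem_maximalIdeal, mem_nonunits_iff,
    MvPowerSeries.isUnit_iff_constantCoeff, isUnit_iff_ne_zero, not_not]

theorem MvPowerSeries.ringKrullDim_le (K : Type*) [Field K] (n : ℕ) :
    ringKrullDim (MvPowerSeries (Fin n) K) ≤ n := by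
  rw [← IsLocalRing.maximalIdeal_height_eq_ringKrullDim, maximalIdeal_eq_varIdeal]
  have h1 := Ideal.height_le_spanFinrank (varIdeal (Fin n) K) (by
    rw [← maximalIdeal_eq_varIdeal]
    exact (IsLocalRing.maximalIdeal.isMaximal _).ne_top)
  have h2 := Submodule.spanFinrank_span_le_ncard_of_finite
    (R := MvPowerSeries (Fin n) K) (Set.finite_range (X (R := K) (σ := Fin n)))
  have h3 : (Set.range (X (R := K) (σ := Fin n))).ncard ≤ n := by
    rw [← Set.image_univ]
    refine (Set.ncard_image_le).trans ?_
    simp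
  have h4 : (varIdeal (Fin n) K).height ≤ n := h1.trans (by exact_mod_cast h2.trans h3)
  exact_mod_cast h4

theorem MvPowerSeries.height_le_finrank_span_pderiv {K : Type*} [Field K] [CharZero K] {n : ℕ}
    (N : Ideal (MvPowerSeries (Fin n) K)) [N.IsPrime] (κ : Type*) [Field κ]
    [Algebra (MvPowerSeries (Fin n) K ⧸ N) κ] [IsFractionRing (MvPowerSeries (Fin n) K ⧸ N) κ] :
    N.height ≤ Module.finrank κ (Submodule.span κ {v : Fin n → κ | ∃ g ∈ N, v = fun i =>
      algebraMap (MvPowerSeries (Fin n) K ⧸ N) κ (Ideal.Quotient.mk N (pderiv K i g))}) := by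
  classical
  set W := Submodule.span κ {v : Fin n → κ | ∃ g ∈ N, v = fun i =>
      algebraMap (MvPowerSeries (Fin n) K ⧸ N) κ (Ideal.Quotient.mk N (pderiv K i g))} with hW
  let A := MvPowerSeries (Fin n) K
  let C := A ⧸ N
  have : IsLocalRing C :=
    IsLocalRing.quotient_of_le (IsLocalRing.le_maximalIdeal (Ideal.IsPrime.ne_top ‹_›))
  have hmap : (varIdeal (Fin n) K).map (Ideal.Quotient.mk N) = maximalIdeal C := by
    rw [← maximalIdeal_eq_varIdeal]
    exact IsLocalRing.map_maximalIdeal_of_surjective' _ Ideal.Quotient.mk_surjective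
  have : IsAdicComplete (maximalIdeal C) C := by
    rw [← hmap]
    exact IsAdicComplete.of_surjective _ Ideal.Quotient.mk_surjective
  obtain ⟨s, hs, hcard⟩ := Ideal.exists_finset_card_eq_height_of_isNoetherianRing (maximalIdeal C)
  have hrad : (Ideal.span (s : Set C)).radical = maximalIdeal C := by
    refine le_antisymm ?_ ?_
    · exact (Ideal.radical_mono hs.1.2).trans
        (IsLocalRing.maximalIdeal.isMaximal C).isPrime.radical.le
    · rw [Ideal.radical_eq_sInf]
      refine le_sInf fun P hP => ?_
      have := hP.2
      exact hs.2 ⟨hP.2, hP.1⟩ (IsLocalRing.le_maximalIdeal hP.2.ne_top)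
  obtain ⟨k, hk⟩ := Ideal.exists_radical_pow_le_of_fg (Ideal.span (s : Set C))
    (IsNoetherian.noetherian _)
  rw [hrad] at hk
  let e := s.equivFin
  let z : Fin s.card → C := fun j => (e.symm j : C)
  have hz : Set.range z = s := by
    change Set.range ((fun x : s => (x : C)) ∘ e.symm) = _
    rw [e.symm.surjective.range_comp]
    simp
  have hzm : ∀ j, z j ∈ maximalIdeal C := fun j => hs.1.2 (Ideal.subset_span (e.symm j).2)
  have hres : ∀ c : C, ∃ r : K, c - algebraMap K C r ∈ maximalIdeal C := by
    intro c
    obtain ⟨f, rfl⟩ := Ideal.Quotient.mk_surjective c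
    refine ⟨constantCoeff f, ?_⟩
    rw [← hmap]
    have : algebraMap K C (constantCoeff f) =
        Ideal.Quotient.mk N (MvPowerSeries.C (constantCoeff f)) := rfl
    rw [this, ← _root_.map_sub]
    refine Ideal.mem_map_of_mem _ ?_
    rw [mem_varIdeal_iff]
    simp
  choose zl hzl using fun j => Ideal.Quotient.mk_surjective (I := N) (z j)
  let w : Fin s.card → Fin n → κ := fun j i =>
    algebraMap C κ (Ideal.Quotient.mk N (pderiv K i (zl j)))
  have htop : W ⊔ Submodule.span κ (Set.range w) = ⊤ := by
    by_contra hlt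
    obtain ⟨φ, hφne, hφker⟩ := Submodule.exists_le_ker_of_lt_top _ (lt_top_iff_ne_top.mpr hlt)
    have hφ : ∀ v ∈ W, φ v = 0 := fun v hv => hφker (Submodule.mem_sup_left hv)
    have hφ0 : ∀ j, φ (w j) = 0 := fun j =>
      hφker (Submodule.mem_sup_right (Submodule.subset_span ⟨j, rfl⟩))
    refine hφne ?_
    have hexp : ∀ v : Fin n → κ, φ v = ∑ i, v i * φ (Pi.single i 1) := by
      intro v
      conv_lhs => rw [← Finset.univ_sum_single v, _root_.map_sum]
      refine Finset.sum_congr rfl fun i _ => ?_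
      rw [← smul_eq_mul, ← map_smul, ← Pi.single_smul', smul_eq_mul, mul_one]
    obtain ⟨b, hb⟩ := IsLocalization.exist_integer_multiples_of_finite (nonZeroDivisors C)
      fun i => φ (Pi.single i 1)
    choose c hc using hb
    choose cl hcl using fun i => Ideal.Quotient.mk_surjective (I := N) (c i)
    let D : Derivation K A A := ∑ i, cl i • pderiv K i
    have hD : ∀ x, algebraMap C κ (Ideal.Quotient.mk N (D x)) = algebraMap C κ b *
        φ (fun i => algebraMap C κ (Ideal.Quotient.mk N (pderiv K i x))) := by
      intro x
      rw [hexp, Finset.mul_sum]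
      have : D x = ∑ i, cl i * pderiv K i x := by
        have h := congrFun (_root_.map_sum Derivation.coeFnAddMonoidHom
          (fun i => cl i • pderiv K i) Finset.univ) x
        rw [Finset.sum_apply] at h
        exact h
      rw [this, _root_.map_sum, _root_.map_sum]
      refine Finset.sum_congr rfl fun i _ => ?_
      rw [_root_.map_mul, _root_.map_mul, hcl, hc, Algebra.smul_def]
      ring
    have hinj := IsFractionRing.injective C κ
    have hDN : ∀ x, Ideal.Quotient.mkₐ K N x = 0 → Ideal.Quotient.mkₐ K N (D x) = 0 := by
      intro x hx
      have hx : x ∈ N := Ideal.Quotient.eq_zero_iff_mem.mp hx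
      apply hinj
      rw [_root_.map_zero]
      refine (hD x).trans ?_
      rw [hφ _ (Submodule.subset_span ⟨x, hx, rfl⟩), mul_zero]
    have hsurj : Function.Surjective (Ideal.Quotient.mkₐ K N) := Ideal.Quotient.mkₐ_surjective K N
    have hδ0 := Derivation.eq_zero_of_isAdicComplete hres z hzm
      (hk.trans (by rw [hz])) (Derivation.liftOfSurjective hsurj hDN) (by
        intro j
        rw [← hzl j]
        refine (Derivation.liftOfSurjective_apply hsurj hDN (zl j)).trans ?_
        apply hinj
        rw [_root_.map_zero]
        refine (hD (zl j)).trans ?_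
        exact (congrArg (_ * ·) (hφ0 j)).trans (mul_zero _))
    have hφi : ∀ i, φ (Pi.single i 1) = 0 := by
      intro i
      have h1 := (Derivation.liftOfSurjective_apply hsurj hDN (X i)).symm
      rw [hδ0] at h1
      have h2 := (hD (X i)).symm.trans (congrArg (algebraMap C κ) h1)
      have h3 : (fun l => algebraMap C κ (Ideal.Quotient.mk N (pderiv K l (X i)))) =
          Pi.single i 1 := by
        ext l
        rw [pderiv_X]
        by_cases hil : i = l
        · rw [hil, Pi.single_eq_same, Pi.single_eq_same, _root_.map_one, _root_.map_one]
        · rw [Pi.single_eq_of_ne hil, Pi.single_eq_of_ne (Ne.symm hil), _root_.map_zero,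
            _root_.map_zero]
      rw [h3] at h2
      have h4 : algebraMap C κ b ≠ 0 := by
        rw [Ne, ← _root_.map_zero (algebraMap C κ), hinj.eq_iff]
        exact nonZeroDivisors.coe_ne_zero b
      simpa [h4] using h2
    ext v
    simp [hφi]
  have hsum := Submodule.finrank_add_le_finrank_add_finrank W (Submodule.span κ (Set.range w))
  rw [htop, finrank_top, Module.finrank_fin_fun] at hsum
  have hfin := finrank_range_le_card (R := κ) w
  rw [Set.finrank, Fintype.card_fin] at hfin
  have hdim := (Ideal.height_add_ringKrullDim_quotient_le N).trans (ringKrullDim_le K n)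
  rw [← IsLocalRing.maximalIdeal_height_eq_ringKrullDim, ← hcard] at hdim
  have h5 : N.height + s.card ≤ n := by exact_mod_cast hdim
  have hne : N.height ≠ ⊤ := by
    intro h
    rw [h, top_add] at h5
    exact ENat.natCast_ne_top n (top_le_iff.mp h5)
  obtain ⟨t, ht⟩ := ENat.ne_top_iff_exists.mp hne
  rw [← ht] at h5 ⊢
  norm_cast at h5 ⊢
  lia

theorem MvPowerSeries.pderiv_map {σ R X : Type*} [CommRing R] [CommRing X] (φ : R →+* X) (i : σ)
    (f : MvPowerSeries σ R) : pderiv X i (map φ f) = map φ (pderiv R i f) := by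
  ext d
  simp [coeff_pderiv]

instance MvPowerSeries.isRegularLocalRing (K : Type u) [Field K] (n : ℕ) :
    IsRegularLocalRing (MvPowerSeries (Fin n) K) := by
  let A := MvPowerSeries (Fin n) K
  let g : MvPolynomial (Fin n) K →+* A := MvPolynomial.coeToMvPowerSeries.ringHom
  have hg : g.Flat := (MvPowerSeries.isAdicCompletion (Fin n) K).flat
  let N := maximalIdeal A
  have hN : (N.comap g).map g = N := by
    refine le_antisymm Ideal.map_comap_le ?_
    change maximalIdeal A ≤ _
    rw [maximalIdeal_eq_varIdeal, ← map_idealOfVars]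
    refine Ideal.map_mono (Ideal.map_le_iff_le_comap.mp ?_)
    rw [map_idealOfVars, ← maximalIdeal_eq_varIdeal]
  have h1 : (⊥ : Ideal (MvPolynomial (Fin n) K)).RegAt (N.comap g) := by
    rw [Ideal.regAt_bot_iff]
    infer_instance
  have h2 := Ideal.RegAt.map hg rfl h1 (by
    refine (Ideal.RegAt.self N).congr hN.symm rfl)
  rw [Ideal.map_bot, Ideal.regAt_bot_iff] at h2
  let e : A ≃ₐ[A] Localization.AtPrime N := IsLocalization.atUnits A N.primeCompl (by
    intro x hx
    by_contra h
    exact hx ((IsLocalRing.mem_maximalIdeal x).mpr h))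
  exact IsRegularLocalRing.of_ringEquiv (R := Localization.AtPrime N) e.symm.toRingEquiv

/-- Elements of a prime ideal with independent gradients are part of a regular system of
parameters. -/
theorem MvPowerSeries.mem_maximalIdeal_of_sum_mem_sq {L : Type u} [CommRing L] {n r : ℕ}
    (N : Ideal (MvPowerSeries (Fin n) L)) [N.IsPrime] (f : Fin r → MvPowerSeries (Fin n) L)
    (hf : ∀ j, f j ∈ N) (a : Fin r → Fin n → MvPowerSeries (Fin n) L)
    (c : MvPowerSeries (Fin n) L) (hc : c ∉ N)
    (ha : ∀ k j, ∑ i, a k i * pderiv L i (f j) - (if k = j then c else 0) ∈ N)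
    (x : Fin r → Localization.AtPrime N)
    (hx : ∑ j, x j * algebraMap _ (Localization.AtPrime N) (f j) ∈
      maximalIdeal (Localization.AtPrime N) ^ 2) (k : Fin r) :
    x k ∈ maximalIdeal (Localization.AtPrime N) := by
  classical
  let A := MvPowerSeries (Fin n) L
  let A' := Localization.AtPrime N
  obtain ⟨b, hb⟩ := IsLocalization.exist_integer_multiples_of_finite N.primeCompl x
  choose y hy using hb
  have h1 : algebraMap A A' (∑ j, y j * f j) ∈ (N ^ 2).map (algebraMap A A') := by
    rw [Ideal.map_pow, Localization.AtPrime.map_eq_maximalIdeal]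
    have := Ideal.mul_mem_left _ (algebraMap A A' b) hx
    rw [Finset.mul_sum] at this
    convert! this using 1
    rw [_root_.map_sum]
    refine Finset.sum_congr rfl fun j _ => ?_
    rw [_root_.map_mul, hy, Algebra.smul_def, mul_assoc]
  rw [IsLocalization.algebraMap_mem_map_algebraMap_iff N.primeCompl] at h1
  obtain ⟨u, hu, h2⟩ := h1
  have h3 : ∀ i, ∑ j, (u * y j) * pderiv L i (f j) ∈ N := by
    intro i
    have h4 := (pderiv L i).map_pow_succ_le N 1 h2
    rw [pow_one, Finset.mul_sum, _root_.map_sum] at h4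
    have h5 : ∑ j, f j * pderiv L i (u * y j) ∈ N :=
      sum_mem fun j _ => Ideal.mul_mem_right _ _ (hf j)
    have h6 := sub_mem h4 h5
    rw [← Finset.sum_sub_distrib] at h6
    convert! h6 using 1
    refine Finset.sum_congr rfl fun j _ => ?_
    rw [← mul_assoc, Derivation.leibniz, smul_eq_mul, smul_eq_mul]
    ring
  have h7 : (u * y k) * c ∈ N := by
    have h8 : ∑ i, a k i * ∑ j, (u * y j) * pderiv L i (f j) ∈ N :=
      sum_mem fun i _ => Ideal.mul_mem_left _ _ (h3 i)
    have h9 : ∑ j, (u * y j) * (∑ i, a k i * pderiv L i (f j) - (if k = j then c else 0)) ∈ N :=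
      sum_mem fun j _ => Ideal.mul_mem_left _ _ (ha k j)
    have h10 := sub_mem h8 h9
    convert! h10 using 1
    simp only [mul_sub, Finset.sum_sub_distrib, Finset.mul_sum, mul_ite, mul_zero,
      Finset.sum_ite_eq, Finset.mem_univ, if_true]
    rw [Finset.sum_comm]
    simp only [mul_left_comm, sub_sub_cancel]
  have h11 : y k ∈ N :=
    ((‹N.IsPrime›.mem_or_mem h7).resolve_right hc |> ‹N.IsPrime›.mem_or_mem).resolve_left hu
  have h12 : algebraMap A A' (b : A) * x k ∈ maximalIdeal A' := by
    rw [← Algebra.smul_def, ← hy, ← Localization.AtPrime.map_eq_maximalIdeal]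
    exact Ideal.mem_map_of_mem _ h11
  exact (Ideal.unit_mul_mem_iff_mem _ (IsLocalization.map_units A' b)).mp h12

theorem exists_dual_of_linearIndependent {D κ : Type*} [CommRing D] [IsDomain D] [Field κ]
    (ψ : D →+* κ) (hψ : Function.Injective ψ) {n r : ℕ} (v : Fin r → Fin n → D)
    (hv : LinearIndependent κ fun j i => ψ (v j i)) :
    ∃ (a : Fin r → Fin n → D) (c : D), c ≠ 0 ∧
      ∀ k j, ∑ i, a k i * v j i = if k = j then c else 0 := by
  classical
  let F := FractionRing D
  let ψ' : F →+* κ := IsFractionRing.lift hψ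
  have hψ' : ∀ d, ψ' (algebraMap D F d) = ψ d := fun d => IsFractionRing.lift_algebraMap hψ d
  let w : Fin r → Fin n → F := fun j i => algebraMap D F (v j i)
  have hw : LinearIndependent F w := by
    rw [Fintype.linearIndependent_iff] at hv ⊢
    intro g hg j
    apply ψ'.injective
    rw [_root_.map_zero]
    refine hv (fun j => ψ' (g j)) ?_ j
    ext i
    have := congrArg ψ' (congrFun hg i)
    simpa [w, hψ'] using this
  let ℓ : (Fin r → F) →ₗ[F] (Fin n → F) := Fintype.linearCombination F w
  have hℓ : LinearMap.ker ℓ = ⊥ := by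
    rw [LinearMap.ker_eq_bot']
    intro g hg
    ext j
    exact Fintype.linearIndependent_iff.mp hw g hg j
  obtain ⟨g, hg⟩ := ℓ.exists_leftInverse_of_injective hℓ
  obtain ⟨b, hb⟩ := IsLocalization.exist_integer_multiples_of_finite (nonZeroDivisors D)
    fun p : Fin r × Fin n => g (Pi.single p.2 1) p.1
  choose a ha using hb
  refine ⟨fun k i => a (k, i), b, nonZeroDivisors.coe_ne_zero b, fun k j => ?_⟩
  apply IsFractionRing.injective D F
  have h1 : g (w j) k = if k = j then 1 else 0 := by
    have h2 := LinearMap.congr_fun hg (Pi.single j 1)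
    have h3 : ℓ (Pi.single j 1) = w j := by simp [ℓ]
    rw [LinearMap.comp_apply, h3] at h2
    rw [h2, LinearMap.id_apply, Pi.single_apply]
  have h4 : g (w j) k = ∑ i, w j i * g (Pi.single i 1) k := by
    conv_lhs => rw [← Finset.univ_sum_single (w j), _root_.map_sum, Finset.sum_apply]
    refine Finset.sum_congr rfl fun i _ => ?_
    have : (Pi.single i (w j i) : Fin n → F) = w j i • Pi.single i 1 := by
      rw [← Pi.single_smul', smul_eq_mul, mul_one]
    rw [this, map_smul, Pi.smul_apply, smul_eq_mul]
  have h5 : algebraMap D F (∑ i, a (k, i) * v j i) = algebraMap D F b * g (w j) k := by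
    rw [h4, Finset.mul_sum, _root_.map_sum]
    refine Finset.sum_congr rfl fun i _ => ?_
    rw [_root_.map_mul, ha, Algebra.smul_def]
    ring
  rw [h5, h1]
  split_ifs <;> simp

theorem Ideal.IsRadical.map_algebraMap_eq_maximalIdeal {A : Type*} [CommRing A] {J N : Ideal A}
    [N.IsPrime] (hJ : J.IsRadical) (hN : N ∈ J.minimalPrimes) :
    J.map (algebraMap A (Localization.AtPrime N)) = maximalIdeal (Localization.AtPrime N) := by
  rw [← Localization.AtPrime.map_eq_maximalIdeal,
    ← IsLocalization.AtPrime.radical_map_of_mem_minimalPrimes (Localization.AtPrime N) N J hN,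
    ← IsLocalization.map_radical N.primeCompl, hJ.radical]

theorem Ideal.exists_notMem_mul_mem_of_map_le {A : Type*} [CommRing A] [IsNoetherianRing A]
    {J P : Ideal A} [P.IsPrime]
    (h : P.map (algebraMap A (Localization.AtPrime P)) ≤
      J.map (algebraMap A (Localization.AtPrime P))) :
    ∃ u ∉ P, ∀ x ∈ P, u * x ∈ J := by
  classical
  obtain ⟨s, hs⟩ := IsNoetherian.noetherian P
  have key : ∀ x ∈ P, ∃ u ∉ P, u * x ∈ J := by
    intro x hx
    have := h (Ideal.mem_map_of_mem _ hx)
    rw [IsLocalization.algebraMap_mem_map_algebraMap_iff P.primeCompl] at this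
    exact this
  choose! u hu hux using key
  refine ⟨∏ y ∈ s, u y, ?_, fun x hx => ?_⟩
  · rw [Ideal.IsPrime.prod_mem_iff]
    rintro ⟨y, hy, hy'⟩
    exact hu y (hs ▸ Submodule.subset_span hy) hy'
  · rw [← hs] at hx
    induction hx using Submodule.span_induction with
    | mem y hy =>
      rw [← Finset.mul_prod_erase s u hy, mul_right_comm]
      exact Ideal.mul_mem_right _ _ (hux y (hs ▸ Submodule.subset_span hy))
    | zero => simp
    | add a b _ _ iha ihb => rw [mul_add]; exact add_mem iha ihb
    | smul a b _ ihb => rw [smul_eq_mul, mul_left_comm]; exact Ideal.mul_mem_left _ _ ihb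

theorem MvPowerSeries.regularSequence_span_eq_maximalIdeal {L : Type u} [Field L] {n r : ℕ}
    (N : Ideal (MvPowerSeries (Fin n) L)) [N.IsPrime] (f : Fin r → MvPowerSeries (Fin n) L)
    (hf : ∀ j, f j ∈ N) (a : Fin r → Fin n → MvPowerSeries (Fin n) L)
    (c : MvPowerSeries (Fin n) L) (hc : c ∉ N)
    (ha : ∀ k j, ∑ i, a k i * pderiv L i (f j) - (if k = j then c else 0) ∈ N) :
    (Ideal.span (Set.range f)).RegAt N ∧
    (N.height ≤ r → (Ideal.span (Set.range f)).map (algebraMap _ (Localization.AtPrime N)) =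
      maximalIdeal (Localization.AtPrime N)) := by
  let A := MvPowerSeries (Fin n) L
  let A' := Localization.AtPrime N
  have : IsRegularLocalRing A' := .of_isLocalization_atPrime N A'
  have hfm : ∀ j, algebraMap A A' (f j) ∈ maximalIdeal A' := fun j => by
    rw [← Localization.AtPrime.map_eq_maximalIdeal]
    exact Ideal.mem_map_of_mem _ (hf j)
  have hmap : (Ideal.span (Set.range f)).map (algebraMap A A') =
      Ideal.span (Set.range fun j => algebraMap A A' (f j)) := by
    rw [Ideal.map_span, ← Set.range_comp]
    rfl
  obtain ⟨h1, h2⟩ := IsRegularLocalRing.quotient_span (fun j => algebraMap A A' (f j)) hfm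
    fun x hx k => mem_maximalIdeal_of_sum_mem_sq N f hf a c hc ha x hx k
  constructor
  · unfold Ideal.RegAt
    rw [hmap]
    exact h1
  · intro hr
    have h3 : ringKrullDim (A' ⧸ Ideal.span (Set.range fun j => algebraMap A A' (f j))) = 0 := by
      obtain ⟨d, hd⟩ := IsRegularLocalRing.exists_natCast_eq
        (A' ⧸ Ideal.span (Set.range fun j => algebraMap A A' (f j)))
      rw [hd, IsLocalization.AtPrime.ringKrullDim_eq_height N A'] at h2
      have h4 : N.height = d + r := by exact_mod_cast h2
      rw [h4] at hr
      norm_cast at hr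
      rw [hd]
      have : d = 0 := by lia
      simp [this]
    have h5 := IsLocalRing.maximalIdeal_eq_bot_of_ringKrullDim_eq_zero
      (A := A' ⧸ Ideal.span (Set.range fun j => algebraMap A A' (f j))) h3
    rw [hmap]
    refine le_antisymm (Ideal.span_le.mpr (by rintro _ ⟨j, rfl⟩; exact hfm j)) ?_
    rw [← IsLocalRing.map_maximalIdeal_of_surjective' _ Ideal.Quotient.mk_surjective,
      Ideal.map_eq_bot_iff_le_ker, Ideal.mk_ker] at h5
    exact h5

theorem MvPowerSeries.exists_jacobian {R K : Type u} [CommRing R] [IsNoetherianRing R]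
    [Field K] [CharZero K] {φ : R →+* K} (hφ : φ.Flat) {n : ℕ}
    (P : Ideal (MvPowerSeries (Fin n) R)) [P.IsPrime] (hP : P ≤ varIdeal (Fin n) R)
    (hrad : (P.map (map (σ := Fin n) φ)).IsRadical) :
    ∃ (r : ℕ) (f : Fin r → MvPowerSeries (Fin n) R) (h c : MvPowerSeries (Fin n) R)
      (a : Fin r → Fin n → MvPowerSeries (Fin n) R), (∀ j, f j ∈ P) ∧ h ∉ P ∧
      (∀ x ∈ P, h * x ∈ Ideal.span (Set.range f)) ∧ c ∉ P ∧
      ∀ k j, ∑ i, a k i * pderiv R i (f j) - (if k = j then c else 0) ∈ P := by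
  classical
  let S := MvPowerSeries (Fin n) R
  let A := MvPowerSeries (Fin n) K
  let ι : S →+* A := map φ
  have hι : ι.Flat := flat_map hφ
  have hne : P.map ι ≠ ⊤ := by
    intro h
    have h1 : P.map ι ≤ varIdeal (Fin n) K := (Ideal.map_mono hP).trans (map_varIdeal φ).le
    rw [h, ← maximalIdeal_eq_varIdeal] at h1
    exact (IsLocalRing.maximalIdeal.isMaximal A).ne_top (top_le_iff.mp h1)
  obtain ⟨N, hN⟩ := Ideal.nonempty_minimalPrimes hne
  have hNp : N.IsPrime := hN.1.1
  have hNP : N.comap ι = P := Ideal.comap_eq_of_mem_minimalPrimes_map hι hN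
  have hloc := hrad.map_algebraMap_eq_maximalIdeal hN
  let κ := FractionRing (A ⧸ N)
  let ψ : A →+* κ := (algebraMap (A ⧸ N) κ).comp (Ideal.Quotient.mk N)
  have hψ : ∀ x, ψ x = 0 ↔ x ∈ N := by
    intro x
    rw [← Ideal.Quotient.eq_zero_iff_mem, ← (IsFractionRing.injective (A ⧸ N) κ).eq_iff,
      _root_.map_zero]
    rfl
  let s : Set (Fin n → κ) := {v | ∃ p ∈ P, v = fun i => ψ (ι (pderiv R i p))}
  have hspan : ∀ x ∈ P.map ι, (fun i => ψ (pderiv K i x)) ∈ Submodule.span κ s := by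
    intro x hx
    induction hx using Submodule.span_induction with
    | mem y hy =>
      obtain ⟨p, hp, rfl⟩ := hy
      refine Submodule.subset_span ⟨p, hp, ?_⟩
      ext i
      rw [pderiv_map]
    | zero =>
      convert! zero_mem (Submodule.span κ s) using 1
      ext i
      simp
    | add x y _ _ hx hy =>
      convert! add_mem hx hy using 1
      ext i
      simp
    | smul b x hx ih =>
      convert! Submodule.smul_mem _ (ψ b) ih using 1
      ext i
      have hx0 : ψ x = 0 := (hψ x).mpr (hN.1.2 hx)
      rw [smul_eq_mul, Derivation.leibniz, _root_.map_add, smul_eq_mul, smul_eq_mul,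
        _root_.map_mul, _root_.map_mul, hx0, zero_mul, add_zero]
      rfl
  have hle := height_le_finrank_span_pderiv N κ
  have hs : Submodule.span κ {v : Fin n → κ | ∃ g ∈ N, v = fun i =>
      algebraMap (A ⧸ N) κ (Ideal.Quotient.mk N (pderiv K i g))} ≤ Submodule.span κ s := by
    rw [Submodule.span_le]
    rintro _ ⟨g, hg, rfl⟩
    have h1 : algebraMap A (Localization.AtPrime N) g ∈
        (P.map ι).map (algebraMap A (Localization.AtPrime N)) := by
      rw [hloc, ← Localization.AtPrime.map_eq_maximalIdeal]
      exact Ideal.mem_map_of_mem _ hg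
    rw [IsLocalization.algebraMap_mem_map_algebraMap_iff N.primeCompl] at h1
    obtain ⟨u, hu, hug⟩ := h1
    have hu0 : ψ u ≠ 0 := fun h => hu ((hψ u).mp h)
    have h2 := Submodule.smul_mem _ (ψ u)⁻¹ (hspan _ hug)
    convert! h2 using 1
    ext i
    have hg0 : ψ g = 0 := (hψ g).mpr hg
    rw [Pi.smul_apply, smul_eq_mul, Derivation.leibniz, _root_.map_add, smul_eq_mul, smul_eq_mul,
        _root_.map_mul, _root_.map_mul, hg0, zero_mul, add_zero, inv_mul_cancel_left₀ hu0]
    rfl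
  obtain ⟨v, hv, -, hvi⟩ := Submodule.exists_fun_fin_finrank_span_eq κ s
  choose f hf hfv using hv
  let θ : S ⧸ P →+* κ := (algebraMap (A ⧸ N) κ).comp (Ideal.quotientMap N ι hNP.ge)
  have hθ : Function.Injective θ := (IsFractionRing.injective (A ⧸ N) κ).comp
    (Ideal.quotientMap_injective' (H := hNP.ge) hNP.le)
  have hD : IsDomain (S ⧸ P) := Ideal.Quotient.isDomain P
  obtain ⟨a', c', hc', ha'⟩ := exists_dual_of_linearIndependent θ hθ
    (fun j i => Ideal.Quotient.mk P (pderiv R i (f j))) (by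
      convert! hvi using 1
      ext j i
      rw [hfv]
      rfl)
  choose a ha using fun k i => Ideal.Quotient.mk_surjective (I := P) (a' k i)
  obtain ⟨c, rfl⟩ := Ideal.Quotient.mk_surjective c'
  have hac : ∀ k j, ∑ i, a k i * pderiv R i (f j) - (if k = j then c else 0) ∈ P := by
    intro k j
    rw [← Ideal.Quotient.eq_zero_iff_mem, _root_.map_sub, sub_eq_zero, _root_.map_sum]
    simp only [_root_.map_mul, ha]
    rw [ha']
    split_ifs <;> simp
  have hcP : c ∉ P := fun h => hc' (Ideal.Quotient.eq_zero_iff_mem.mpr h)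
  have hloc2 := (regularSequence_span_eq_maximalIdeal N (fun j => ι (f j))
    (fun j => by
      rw [← Ideal.mem_comap, hNP]
      exact hf j)
    (fun k i => ι (a k i)) (ι c) (by rw [← Ideal.mem_comap, hNP]; exact hcP) (by
      intro k j
      have h1 : ι (∑ i, a k i * pderiv R i (f j) - (if k = j then c else 0)) ∈ N := by
        rw [← Ideal.mem_comap, hNP]
        exact hac k j
      convert! h1 using 1
      rw [_root_.map_sub, _root_.map_sum]
      congr 1
      · refine Finset.sum_congr rfl fun i _ => ?_
        rw [_root_.map_mul, pderiv_map]
      · split_ifs <;> simp)).2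
    (hle.trans (by exact_mod_cast Submodule.finrank_mono hs))
  have hfP : Ideal.span (Set.range f) ≤ P := by
    rw [Ideal.span_le]
    rintro _ ⟨j, rfl⟩
    exact hf j
  let g : Localization.AtPrime P →+* Localization.AtPrime N :=
    Localization.localRingHom P N ι hNP.symm
  have hg : g.Flat := hι.localRingHom N P hNP.symm
  have hgl : IsLocalHom g := Localization.isLocalHom_localRingHom _ _ _ _
  algebraize [g]
  have : IsLocalHom (algebraMap (Localization.AtPrime P) (Localization.AtPrime N)) := hgl
  have : Module.FaithfullyFlat (Localization.AtPrime P) (Localization.AtPrime N) :=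
    Module.FaithfullyFlat.of_flat_of_isLocalHom
  have hmm : P.map (algebraMap S (Localization.AtPrime P)) ≤
      (Ideal.span (Set.range f)).map (algebraMap S (Localization.AtPrime P)) := by
    rw [← Ideal.comap_map_eq_self_of_faithfullyFlat (B := Localization.AtPrime N)
      ((Ideal.span (Set.range f)).map (algebraMap S (Localization.AtPrime P)))]
    rw [← Ideal.map_le_iff_le_comap]
    have h1 := Ideal.map_localRingHom ι (Ideal.span (Set.range f)) P N hNP.symm
    have h2 := Ideal.map_localRingHom ι P P N hNP.symm
    refine h2.le.trans (le_trans ?_ h1.ge)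
    rw [hloc, ← hloc2, Ideal.map_span ι, ← Set.range_comp]
    rfl
  obtain ⟨h, hh, hhP⟩ := Ideal.exists_notMem_mul_mem_of_map_le hmm
  exact ⟨_, f, h, c, a, hf, hh, hhP, hcP, hac⟩

theorem Ideal.map_algebraMap_eq_of_mul_mem {A : Type*} [CommRing A] {J J' N : Ideal A} [N.IsPrime]
    (h : J ≤ J') {u : A} (hu : u ∉ N) (huJ : ∀ x ∈ J', u * x ∈ J) :
    J'.map (algebraMap A (Localization.AtPrime N)) =
      J.map (algebraMap A (Localization.AtPrime N)) := by
  refine le_antisymm (Ideal.map_le_iff_le_comap.mpr fun x hx => ?_) (Ideal.map_mono h)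
  rw [Ideal.mem_comap, IsLocalization.algebraMap_mem_map_algebraMap_iff N.primeCompl]
  exact ⟨u, hu, huJ x hx⟩

theorem MvPowerSeries.regAt_map_of_jacobian {R L : Type u} [CommRing R] [Field L] (φ : R →+* L)
    {n r : ℕ} {P : Ideal (MvPowerSeries (Fin n) R)} {f : Fin r → MvPowerSeries (Fin n) R}
    {h c : MvPowerSeries (Fin n) R} {a : Fin r → Fin n → MvPowerSeries (Fin n) R}
    (hf : ∀ j, f j ∈ P) (hh : h ∉ P) (hhP : ∀ x ∈ P, h * x ∈ Ideal.span (Set.range f))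
    (hc : c ∉ P)
    (ha : ∀ k j, ∑ i, a k i * pderiv R i (f j) - (if k = j then c else 0) ∈ P)
    (N : Ideal (MvPowerSeries (Fin n) L)) [N.IsPrime] (hN : N.comap (map φ) = P) :
    (P.map (map φ)).RegAt N := by
  let ι : MvPowerSeries (Fin n) R →+* MvPowerSeries (Fin n) L := map φ
  have hmem : ∀ x, ι x ∈ N ↔ x ∈ P := fun x => by rw [← hN]; rfl
  have h1 := (regularSequence_span_eq_maximalIdeal N (fun j => ι (f j))
    (fun j => (hmem _).mpr (hf j)) (fun k i => ι (a k i)) (ι c) (by rwa [hmem]) (by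
      intro k j
      convert! (hmem _).mpr (ha k j) using 1
      rw [_root_.map_sub, _root_.map_sum]
      congr 1
      · refine Finset.sum_congr rfl fun i _ => ?_
        rw [_root_.map_mul, pderiv_map]
      · split_ifs <;> simp)).1
  have hspan : Ideal.span (Set.range fun j => ι (f j)) = (Ideal.span (Set.range f)).map ι := by
    rw [Ideal.map_span, ← Set.range_comp]
    rfl
  have h2 : (P.map ι).map (algebraMap _ (Localization.AtPrime N)) =
      (Ideal.span (Set.range fun j => ι (f j))).map (algebraMap _ (Localization.AtPrime N)) := by
    refine Ideal.map_algebraMap_eq_of_mul_mem (u := ι h) ?_ (by rwa [hmem]) fun x hx => ?_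
    · rw [hspan]
      refine Ideal.map_mono (Ideal.span_le.mpr ?_)
      rintro _ ⟨j, rfl⟩
      exact hf j
    · rw [hspan]
      induction hx using Submodule.span_induction with
      | mem y hy =>
        obtain ⟨p, hp, rfl⟩ := hy
        rw [← _root_.map_mul]
        exact Ideal.mem_map_of_mem _ (hhP p hp)
      | zero => simp
      | add x y _ _ hx hy => rw [mul_add]; exact add_mem hx hy
      | smul b x _ hx => rw [smul_eq_mul, mul_left_comm]; exact Ideal.mul_mem_left _ _ hx
  unfold Ideal.RegAt at h1 ⊢
  rw [h2]
  exact h1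

theorem MvPowerSeries.hasRegularFibers_map {K L : Type u} [Field K] [CharZero K] [Field L]
    (φ : K →+* L) (n : ℕ) : HasRegularFibers (map (σ := Fin n) φ) := by
  intro N hN
  have hle : N.comap (map φ) ≤ varIdeal (Fin n) K := by
    rw [← maximalIdeal_eq_varIdeal]
    exact IsLocalRing.le_maximalIdeal (Ideal.IsPrime.ne_top inferInstance)
  obtain ⟨r, f, h, c, a, hf, hh, hhP, hc, ha⟩ := exists_jacobian
    (RingHom.Flat.of_bijective (f := RingHom.id K) Function.bijective_id) (N.comap (map φ)) hle
    (by
      rw [map_id, Ideal.map_id]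
      exact Ideal.IsPrime.isRadical inferInstance)
  exact regAt_map_of_jacobian φ hf hh hhP hc ha N rfl

theorem IsLocalization.AtPrime.algebraMap_eq_zero_iff_mem {X L : Type*} [CommRing X] [Field L]
    [Algebra X L] (P : Ideal X) [P.IsPrime] [IsLocalization.AtPrime L P] {x : X} :
    algebraMap X L x = 0 ↔ x ∈ P := by
  rw [← IsLocalization.AtPrime.to_map_mem_maximal_iff L P x,
    IsLocalRing.maximalIdeal_eq_bot, Ideal.mem_bot]

theorem MvPowerSeries.finite_degree_lt (σ : Type*) [Finite σ] (k : ℕ) :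
    Finite {d : σ →₀ ℕ // d.degree < k} :=
  (Finsupp.finite_of_degree_lt k).to_subtype

theorem MvPowerSeries.exists_coeff_eq {σ X : Type*} [CommRing X] {p : (σ →₀ ℕ) → Prop}
    (x : {d : σ →₀ ℕ // p d} → X) : ∃ G : MvPowerSeries σ X, ∀ d, coeff d.1 G = x d := by
  classical
  let G : MvPowerSeries σ X := fun d => if h : p d then x ⟨d, h⟩ else 0
  exact ⟨G, fun d => dif_pos d.2⟩

theorem MvPowerSeries.exists_mul_sub_map_mem {X L : Type u} [CommRing X] [Field L] [Algebra X L]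
    (P : Ideal X) [P.IsPrime] [IsLocalization.AtPrime L P] (n k : ℕ)
    (F : MvPowerSeries (Fin n) L) : ∃ s ∉ P, ∃ G : MvPowerSeries (Fin n) X,
      C (algebraMap X L s) * F - map (algebraMap X L) G ∈ varIdeal (Fin n) L ^ k := by
  classical
  have := finite_degree_lt (Fin n) k
  obtain ⟨s, hs⟩ := IsLocalization.exist_integer_multiples_of_finite P.primeCompl
    (fun d : {d : Fin n →₀ ℕ // d.degree < k} => coeff d.1 F)
  choose x hx using hs
  obtain ⟨G, hG⟩ := exists_coeff_eq x
  refine ⟨s, s.2, G, ?_⟩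
  rw [mem_varIdeal_pow_iff]
  intro d hd
  rw [_root_.map_sub, coeff_C_mul, coeff_map, hG ⟨d, hd⟩, hx,
    Algebra.smul_def, sub_self]

theorem RingHom.Flat.of_comp_isLocalization {A A' C : Type u} [CommRing A] [CommRing A']
    [CommRing C] [Algebra A A'] (W : Submonoid A) [IsLocalization W A'] {g : A' →+* C}
    (hg : (g.comp (algebraMap A A')).Flat) : g.Flat := by
  let _ := g.toAlgebra
  let _ := (g.comp (algebraMap A A')).toAlgebra
  have : IsScalarTower A A' C := IsScalarTower.of_algebraMap_eq fun _ => rfl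
  have : Module.Flat A C := hg
  exact (Module.flat_iff_of_isLocalization A' W C).mpr this

theorem MvPowerSeries.exists_isAdicCompletion {X L T : Type u} [CommRing X] [IsNoetherianRing X]
    [Field L] [Algebra X L] [CommRing T] [IsNoetherianRing T] (P : Ideal X) [P.IsPrime]
    [IsLocalization.AtPrime L P] {n : ℕ} {p : MvPowerSeries (Fin n) X →+* T}
    (hp : Function.Surjective p) (Q : Ideal T) [Q.IsPrime]
    (hQ : Q.comap p = P.comap constantCoeff) :
    ∃ g : Localization.AtPrime Q →+*
        MvPowerSeries (Fin n) L ⧸ (RingHom.ker p).map (map (algebraMap X L)),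
      (∀ x, g (algebraMap T _ (p x)) = Ideal.Quotient.mk _ (map (algebraMap X L) x)) ∧
      g.Flat ∧ g.IsAdicCompletion (maximalIdeal (Localization.AtPrime Q)) := by
  let h : MvPowerSeries (Fin n) X →+* MvPowerSeries (Fin n) L := map (algebraMap X L)
  have hLX : (algebraMap X L).Flat := by
    rw [RingHom.flat_algebraMap_iff]
    exact IsLocalization.flat L P.primeCompl
  have hh : h.Flat := flat_map hLX
  let J := (RingHom.ker p).map h
  have hmem : ∀ x, p x ∈ Q ↔ h x ∈ varIdeal (Fin n) L := by
    intro x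
    rw [← Ideal.mem_comap, hQ, mem_varIdeal_iff, constantCoeff_map,
      IsLocalization.AtPrime.algebraMap_eq_zero_iff_mem P]
    rfl
  have hJle : J ≤ maximalIdeal (MvPowerSeries (Fin n) L) := by
    rw [maximalIdeal_eq_varIdeal, Ideal.map_le_iff_le_comap]
    intro x hx
    rw [Ideal.mem_comap, ← hmem, (RingHom.mem_ker).mp hx]
    exact zero_mem _
  have hC : IsLocalRing (MvPowerSeries (Fin n) L ⧸ J) := IsLocalRing.quotient_of_le hJle
  let e := RingHom.quotientKerEquivOfSurjective hp
  let t : T →+* MvPowerSeries (Fin n) L ⧸ J :=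
    (Ideal.quotientMap J h Ideal.le_comap_map).comp e.symm.toRingHom
  have ht : ∀ x, t (p x) = Ideal.Quotient.mk J (h x) := by
    intro x
    have : e.symm (p x) = Ideal.Quotient.mk _ x := by
      rw [RingEquiv.symm_apply_eq]
      rfl
    change Ideal.quotientMap J h Ideal.le_comap_map (e.symm (p x)) = _
    rw [this, Ideal.quotientMap_mk]
  have htf : t.Flat := RingHom.Flat.comp (.of_bijective e.symm.bijective) (hh.quotientMap _)
  have hunit : ∀ y : Q.primeCompl, IsUnit (t y) := by
    rintro ⟨y, hy⟩
    obtain ⟨x, rfl⟩ := hp y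
    rw [ht]
    refine IsUnit.map _ ?_
    by_contra hx
    apply hy
    rw [SetLike.mem_coe, hmem, ← maximalIdeal_eq_varIdeal]
    exact hx
  let g : Localization.AtPrime Q →+* MvPowerSeries (Fin n) L ⧸ J := IsLocalization.lift hunit
  have hgt : ∀ y, g (algebraMap T _ y) = t y := IsLocalization.lift_eq hunit
  have hgf : g.Flat := .of_comp_isLocalization Q.primeCompl (by
    rw [show g.comp (algebraMap T _) = t from RingHom.ext hgt]
    exact htf)
  have hmap : (maximalIdeal (Localization.AtPrime Q)).map g =
      (varIdeal (Fin n) L).map (Ideal.Quotient.mk J) := by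
    rw [← Localization.AtPrime.map_eq_maximalIdeal, Ideal.map_map,
      show g.comp (algebraMap T _) = t from RingHom.ext hgt]
    apply le_antisymm
    · rw [Ideal.map_le_iff_le_comap]
      intro y hy
      obtain ⟨x, rfl⟩ := hp y
      rw [Ideal.mem_comap, ht]
      exact Ideal.mem_map_of_mem _ ((hmem x).mp hy)
    · rw [Ideal.map_le_iff_le_comap, Ideal.span_le]
      rintro _ ⟨i, rfl⟩
      have h1 : h (MvPowerSeries.X i) = MvPowerSeries.X i := map_X _ i
      rw [SetLike.mem_coe, Ideal.mem_comap, ← h1, ← ht]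
      refine Ideal.mem_map_of_mem _ ((hmem _).mpr ?_)
      rw [h1]
      exact Ideal.subset_span ⟨i, rfl⟩
  have hne : (maximalIdeal (Localization.AtPrime Q)).map g ≠ ⊤ := by
    rw [hmap]
    intro htop
    have h1 := congrArg (Ideal.comap (Ideal.Quotient.mk J)) htop
    rw [Ideal.comap_map_mk (by rwa [← maximalIdeal_eq_varIdeal]), Ideal.comap_top,
      ← maximalIdeal_eq_varIdeal] at h1
    exact (IsLocalRing.maximalIdeal.isMaximal _).ne_top h1
  have hgl : IsLocalHom g := ((local_hom_TFAE g).out 2 0).mp (IsLocalRing.le_maximalIdeal hne)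
  refine ⟨g, fun x => (hgt _).trans (ht x), hgf, ?_, fun k z => ?_, fun k a ha => ?_⟩
  · rw [hmap]
    exact IsAdicComplete.of_surjective _ Ideal.Quotient.mk_surjective
  · obtain ⟨F, rfl⟩ := Ideal.Quotient.mk_surjective z
    obtain ⟨s, hs, G, hG⟩ := exists_mul_sub_map_mem P n k F
    have hsQ : p (C s) ∈ Q.primeCompl := by
      intro h1
      have h2 : C s ∈ Q.comap p := h1
      rw [hQ, Ideal.mem_comap, constantCoeff_C] at h2
      exact hs h2
    have hu : IsUnit (Ideal.Quotient.mk J (h (C s))) := by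
      rw [← ht]
      exact hunit ⟨_, hsQ⟩
    refine ⟨IsLocalization.mk' _ (p G) ⟨_, hsQ⟩, ?_⟩
    rw [Ideal.map_pow, hmap, ← Ideal.unit_mul_mem_iff_mem _ hu, mul_sub]
    have h1 : Ideal.Quotient.mk J (h (C s)) * g (IsLocalization.mk' _ (p G) ⟨_, hsQ⟩) =
        Ideal.Quotient.mk J (h G) := by
      rw [← ht, ← hgt, ← _root_.map_mul, mul_comm, IsLocalization.mk'_spec, hgt, ht]
    rw [h1, ← _root_.map_mul, ← _root_.map_sub, ← Ideal.map_pow]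
    refine Ideal.mem_map_of_mem _ ?_
    convert! hG using 3
    exact map_C _ _
  · algebraize [g]
    have : IsLocalHom (algebraMap (Localization.AtPrime Q) (MvPowerSeries (Fin n) L ⧸ J)) := hgl
    have : Module.FaithfullyFlat (Localization.AtPrime Q) (MvPowerSeries (Fin n) L ⧸ J) :=
      Module.FaithfullyFlat.of_flat_of_isLocalHom
    rw [← Ideal.comap_map_eq_self_of_faithfullyFlat (B := MvPowerSeries (Fin n) L ⧸ J)
      (maximalIdeal (Localization.AtPrime Q) ^ k)]
    exact ha

theorem MvPowerSeries.isRadical_map_of_isGRing {X L T : Type u} [CommRing X] [IsNoetherianRing X]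
    [Field L] [Algebra X L] [CommRing T] [IsNoetherianRing T] [Algebra ℚ T] (hT : IsGRing T)
    (P : Ideal X) [P.IsPrime] [IsLocalization.AtPrime L P] {n : ℕ}
    {p : MvPowerSeries (Fin n) X →+* T} (hp : Function.Surjective p) (Q : Ideal T) [Q.IsPrime]
    (hQ : Q.comap p = P.comap constantCoeff) {E : Ideal (MvPowerSeries (Fin n) X)}
    (hE : E.IsRadical) (hpE : RingHom.ker p ≤ E) :
    (E.map (map (σ := Fin n) (algebraMap X L))).IsRadical := by
  obtain ⟨g, hg, hgf, hgc⟩ := exists_isAdicCompletion (L := L) P hp Q hQ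
  let h : MvPowerSeries (Fin n) X →+* MvPowerSeries (Fin n) L := map (algebraMap X L)
  let J := (RingHom.ker p).map h
  obtain ⟨e, he⟩ := (AdicCompletion.isAdicCompletion (m := maximalIdeal (Localization.AtPrime Q))
    (IsNoetherian.noetherian _)).exists_ringEquiv hgc
  have hreg : HasRegularFibers g := by
    rw [← he]
    refine HasRegularFibers.comp (RingHom.Flat.of_bijective e.bijective) (isGRing_iff.mp hT Q)
      (HasRegularFibers.of_map_comap fun N _ => ?_)
    exact Ideal.map_comap_of_surjective _ e.surjective N
  have h1 : (E.map p).IsRadical := by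
    rw [← Ideal.radical_eq_iff, ← Ideal.map_radical_of_surjective hp hpE, hE.radical]
  have h2 : ((E.map p).map (algebraMap T (Localization.AtPrime Q))).IsRadical := by
    rw [← Ideal.radical_eq_iff, ← IsLocalization.map_radical Q.primeCompl, h1.radical]
  have h3 := (hreg.isRadical_map hgf h2).comap (f := Ideal.Quotient.mk J)
  have h4 : (g.comp (algebraMap T _)).comp p = (Ideal.Quotient.mk J).comp h := RingHom.ext hg
  rw [Ideal.map_map, Ideal.map_map, h4, ← Ideal.map_map,
    Ideal.comap_map_mk (Ideal.map_mono hpE)] at h3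
  exact h3

theorem Submodule.exists_matrix_mulVec_eq {K ι : Type*} [Field K] [Fintype ι] [DecidableEq ι]
    (V : Submodule K (ι → K)) : ∃ π : Matrix ι ι K, (∀ v ∈ V, π.mulVec v = v) ∧
      ∀ v, π.mulVec v ∈ V := by
  obtain ⟨π₀, hπ₀⟩ := LinearMap.exists_leftInverse_of_injective V.subtype V.ker_subtype
  refine ⟨LinearMap.toMatrix' (V.subtype.comp π₀), fun v hv => ?_, fun v => ?_⟩
  · rw [LinearMap.toMatrix'_mulVec]
    exact congrArg Subtype.val (LinearMap.congr_fun hπ₀ ⟨v, hv⟩)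
  · rw [LinearMap.toMatrix'_mulVec]
    exact (π₀ v).2

theorem Submodule.mulVec_eq_of_mem_span {K L ι : Type*} [Field K] [Field L] [Fintype ι]
    (θ : K →+* L) {V : Submodule K (ι → K)} {π : Matrix ι ι K} (hπ : ∀ v ∈ V, π.mulVec v = v)
    {w : ι → L} (hw : w ∈ Submodule.span L {z | ∃ v ∈ V, z = fun d => θ (v d)}) :
    (π.map θ).mulVec w = w := by
  induction hw using Submodule.span_induction with
  | mem z hz =>
    obtain ⟨v, hv, rfl⟩ := hz
    ext d
    conv_rhs => rw [← hπ v hv]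
    exact (RingHom.map_mulVec θ π v d).symm
  | zero => exact Matrix.mulVec_zero _
  | add x y _ _ hx hy => rw [Matrix.mulVec_add, hx, hy]
  | smul a x _ hx => rw [Matrix.mulVec_smul, hx]

theorem Submodule.exists_smul_mem_of_mem_span {X L ι : Type*} [CommRing X] [Field L] [Algebra X L]
    (P : Ideal X) [P.IsPrime] [IsLocalization.AtPrime L P] {c : X} (hc : c ∉ P)
    (hcP : ∀ x ∈ P, c * x = 0) {U : Submodule X (ι → X)} {v : ι → X}
    (hv : (fun d => algebraMap X L (v d)) ∈
      Submodule.span L {z | ∃ u ∈ U, z = fun d => algebraMap X L (u d)}) :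
    ∃ a ∉ P, a • v ∈ U := by
  have key : ∀ z ∈ Submodule.span L {z | ∃ u ∈ U, z = fun d => algebraMap X L (u d)},
      ∃ a ∉ P, ∃ u ∈ U, ∀ d, algebraMap X L a * z d = algebraMap X L (u d) := by
    intro z hz
    induction hz using Submodule.span_induction with
    | mem z hz =>
      obtain ⟨u, hu, rfl⟩ := hz
      exact ⟨1, P.one_notMem, u, hu, fun d => by simp⟩
    | zero => exact ⟨1, P.one_notMem, 0, zero_mem _, fun d => by simp⟩
    | add x y _ _ hx hy =>
      obtain ⟨a, ha, u, hu, h⟩ := hx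
      obtain ⟨b, hb, w, hw, h'⟩ := hy
      refine ⟨a * b, P.primeCompl.mul_mem ha hb, b • u + a • w,
        add_mem (U.smul_mem _ hu) (U.smul_mem _ hw), fun d => ?_⟩
      simp only [Pi.add_apply, Pi.smul_apply, smul_eq_mul, _root_.map_add, _root_.map_mul, ← h,
        ← h']
      ring
    | smul l x _ hx =>
      obtain ⟨a, ha, u, hu, h⟩ := hx
      obtain ⟨x', s, rfl⟩ := IsLocalization.exists_mk'_eq P.primeCompl l
      refine ⟨s * a, P.primeCompl.mul_mem s.2 ha, x' • u, U.smul_mem _ hu, fun d => ?_⟩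
      simp only [Pi.smul_apply, smul_eq_mul, _root_.map_mul, ← h]
      rw [← IsLocalization.mk'_spec' L x' s]
      ring
  obtain ⟨a, ha, u, hu, h⟩ := key _ hv
  refine ⟨c * a, P.primeCompl.mul_mem hc ha, ?_⟩
  convert! U.smul_mem c hu using 1
  ext d
  simp only [Pi.smul_apply, smul_eq_mul]
  rw [← sub_eq_zero, mul_assoc, ← mul_sub]
  apply hcP
  rw [← IsLocalization.AtPrime.algebraMap_eq_zero_iff_mem (L := L), _root_.map_sub, _root_.map_mul,
    h, sub_self]

theorem Subring.IsGluing.exists_smul_mem {X : Type u} [CommRing X] [IsLocalRing X] {R : Subring X}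
    {P₁ P₂ : Ideal X} [P₁.IsPrime] [P₂.IsPrime] (h : R.IsGluing P₁ P₂) (h12 : P₁ ⊓ P₂ = ⊥)
    (hP12 : ¬ P₁ ≤ P₂) (hP21 : ¬ P₂ ≤ P₁) {L₁ L₂ ι J : Type*} [Field L₁] [Field L₂]
    [Algebra X L₁] [Algebra X L₂] [IsLocalization.AtPrime L₁ P₁] [IsLocalization.AtPrime L₂ P₂]
    [Finite J] {U : Submodule X (ι → X)} (z : J → ι → X)
    (hz1 : ∀ j, (fun d => algebraMap X L₁ (z j d)) ∈
      Submodule.span L₁ {z | ∃ u ∈ U, z = fun d => algebraMap X L₁ (u d)})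
    (hz2 : ∀ j, (fun d => algebraMap X L₂ (z j d)) ∈
      Submodule.span L₂ {z | ∃ u ∈ U, z = fun d => algebraMap X L₂ (u d)}) :
    ∃ r ∈ R, r ∉ P₁ ∧ r ∉ P₂ ∧ ∀ j, r • z j ∈ U := by
  have := Fintype.ofFinite J
  have hzero : ∀ x ∈ P₁, ∀ y ∈ P₂, x * y = 0 := fun x hx y hy => by
    have : x * y ∈ P₁ ⊓ P₂ := ⟨P₁.mul_mem_right _ hx, P₂.mul_mem_left _ hy⟩
    rwa [h12] at this
  let N : J → Ideal X := fun j => U.comap (LinearMap.toSpanSingleton X _ (z j))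
  obtain ⟨c₂, hc₂, hc₂'⟩ := SetLike.not_le_iff_exists.mp hP12
  obtain ⟨c₁, hc₁, hc₁'⟩ := SetLike.not_le_iff_exists.mp hP21
  have h1 : ¬ Finset.univ.inf N ≤ P₁ := by
    rw [Ideal.IsPrime.inf_le' inferInstance]
    rintro ⟨j, -, hj⟩
    obtain ⟨a, ha, haU⟩ := Submodule.exists_smul_mem_of_mem_span P₁ hc₁'
      (fun x hx => by rw [mul_comm]; exact hzero x hx c₁ hc₁) (hz1 j)
    exact ha (hj haU)
  have h2 : ¬ Finset.univ.inf N ≤ P₂ := by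
    rw [Ideal.IsPrime.inf_le' inferInstance]
    rintro ⟨j, -, hj⟩
    obtain ⟨a, ha, haU⟩ := Submodule.exists_smul_mem_of_mem_span P₂ hc₂'
      (fun x hx => hzero c₂ hc₂ x hx) (hz2 j)
    exact ha (hj haU)
  obtain ⟨r, hr, hr1, hr2⟩ := h.surjectiveOff.exists_mem_notMem h1 h2
  exact ⟨r, r.2, hr1, hr2, fun j => (Submodule.mem_finsetInf.mp hr) j (Finset.mem_univ j)⟩

theorem Subring.IsGluing.mem_span {X : Type u} [CommRing X] [IsLocalRing X] {R : Subring X}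
    {P₁ P₂ : Ideal X} [P₁.IsPrime] [P₂.IsPrime] (h : R.IsGluing P₁ P₂) (h12 : P₁ ⊓ P₂ = ⊥)
    (hP12 : ¬ P₁ ≤ P₂) (hP21 : ¬ P₂ ≤ P₁) {K L₁ L₂ ι : Type*} [Field K] [Field L₁] [Field L₂]
    [Algebra R K] [IsFractionRing R K]
    [Algebra X L₁] [Algebra X L₂] [IsLocalization.AtPrime L₁ P₁] [IsLocalization.AtPrime L₂ P₂]
    (θ₁ : K →+* L₁) (θ₂ : K →+* L₂) (hθ₁ : ∀ r, θ₁ (algebraMap R K r) = algebraMap X L₁ r)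
    (hθ₂ : ∀ r, θ₂ (algebraMap R K r) = algebraMap X L₂ r) [Finite ι]
    {U : Submodule X (ι → X)} {V : Submodule K (ι → K)}
    (hU1 : ∀ u ∈ U, (fun d => algebraMap X L₁ (u d)) ∈
      Submodule.span L₁ {z | ∃ v ∈ V, z = fun d => θ₁ (v d)})
    (hU2 : ∀ u ∈ U, (fun d => algebraMap X L₂ (u d)) ∈
      Submodule.span L₂ {z | ∃ v ∈ V, z = fun d => θ₂ (v d)})
    (hV1 : ∀ v ∈ V, (fun d => θ₁ (v d)) ∈
      Submodule.span L₁ {z | ∃ u ∈ U, z = fun d => algebraMap X L₁ (u d)})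
    (hV2 : ∀ v ∈ V, (fun d => θ₂ (v d)) ∈
      Submodule.span L₂ {z | ∃ u ∈ U, z = fun d => algebraMap X L₂ (u d)})
    {u : ι → X} (hu : u ∈ U) : u ∈ Submodule.span X {z | z ∈ U ∧ ∀ d, z d ∈ R} := by
  classical
  have := Fintype.ofFinite ι
  have hdom := h.isDomain
  obtain ⟨π, hπV, hπ⟩ := V.exists_matrix_mulVec_eq
  obtain ⟨b, hb⟩ := IsLocalization.exist_integer_multiples_of_finite (nonZeroDivisors R)
    (fun jk : ι × ι => π jk.1 jk.2)
  choose ρ hρ using hb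
  simp only [Algebra.smul_def] at hρ
  have hb0 : (b : R) ≠ 0 := nonZeroDivisors.coe_ne_zero b
  have hbX : ((b : R) : X) ≠ 0 := fun h0 => hb0 (Subtype.ext h0)
  have hbK : algebraMap R K b ≠ 0 := by
    rwa [Ne, FaithfulSMul.algebraMap_eq_zero_iff]
  have hb1 : ((b : R) : X) ∉ P₁ := fun h1 => hbX (h.eq_zero_left _ (b : R).2 h1)
  have hb2 : ((b : R) : X) ∉ P₂ := fun h1 => hbX (h.eq_zero_right _ (b : R).2 h1)
  have hmul : ∀ d, ((b : R) : X) * u d = ∑ k, (ρ (d, k) : X) * u k := by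
    intro d
    have h1 : ((b : R) : X) * u d - ∑ k, (ρ (d, k) : X) * u k ∈ P₁ ⊓ P₂ := by
      constructor
      · have := congrFun (Submodule.mulVec_eq_of_mem_span θ₁ hπV (hU1 u hu)) d
        rw [SetLike.mem_coe, ← IsLocalization.AtPrime.algebraMap_eq_zero_iff_mem (L := L₁) P₁,
          _root_.map_sub, _root_.map_mul, ← this, _root_.map_sum, sub_eq_zero, Matrix.mulVec,
          dotProduct, Finset.mul_sum]
        refine Finset.sum_congr rfl fun k _ => ?_
        rw [_root_.map_mul, ← hθ₁, ← hθ₁, hρ, _root_.map_mul, Matrix.map_apply, mul_assoc]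
      · have := congrFun (Submodule.mulVec_eq_of_mem_span θ₂ hπV (hU2 u hu)) d
        rw [SetLike.mem_coe, ← IsLocalization.AtPrime.algebraMap_eq_zero_iff_mem (L := L₂) P₂,
          _root_.map_sub, _root_.map_mul, ← this, _root_.map_sum, sub_eq_zero, Matrix.mulVec,
          dotProduct, Finset.mul_sum]
        refine Finset.sum_congr rfl fun k _ => ?_
        rw [_root_.map_mul, ← hθ₂, ← hθ₂, hρ, _root_.map_mul, Matrix.map_apply, mul_assoc]
    rw [h12, Ideal.mem_bot, sub_eq_zero] at h1
    exact h1
  choose v₀ w hw using fun d => h.surjectiveOff _ hb1 hb2 (u d)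
  have hv : ∀ d, ((b : R) : X) * (u d - ∑ k, (ρ (d, k) : X) * w k) =
      ((∑ k, ρ (d, k) * v₀ k : R) : X) := by
    intro d
    rw [mul_sub, hmul, Finset.mul_sum, ← Finset.sum_sub_distrib, AddSubmonoidClass.coe_finsetSum]
    refine Finset.sum_congr rfl fun k _ => ?_
    rw [hw k]
    push_cast
    simp only [Subring.subtype_apply]
    ring
  have hvR : ∀ d, u d - ∑ k, (ρ (d, k) : X) * w k ∈ R := fun d =>
    h.mem_of_mul_mem _ (b : R).2 hbX _ (by rw [hv]; exact Subtype.prop _)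
  let z : Option ι → ι → R := fun o => o.elim (fun d => ⟨_, hvR d⟩) (fun k d => ρ (d, k))
  let x : Option ι → X := fun o => o.elim 1 w
  have hux : ∀ d, u d = ∑ o, x o * z o d := by
    intro d
    rw [Fintype.sum_option]
    change u d = 1 * (u d - ∑ k, (ρ (d, k) : X) * w k) + ∑ k, w k * (ρ (d, k) : X)
    rw [one_mul, sub_add_eq_add_sub, eq_sub_iff_add_eq]
    congr 1
    exact Finset.sum_congr rfl fun k _ => mul_comm _ _
  have hzV : ∀ o, (fun d => algebraMap R K (z o d)) ∈ V := by
    rintro (_ | k)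
    · convert! hπ (fun d => algebraMap R K (v₀ d)) using 1
      ext d
      apply mul_left_cancel₀ hbK
      rw [← _root_.map_mul, show (b : R) * z none d = ∑ k, ρ (d, k) * v₀ k from
        Subtype.ext (hv d), _root_.map_sum, Matrix.mulVec, dotProduct, Finset.mul_sum]
      refine Finset.sum_congr rfl fun k _ => ?_
      rw [_root_.map_mul, hρ, mul_assoc]
    · convert! hπ (Pi.single k (algebraMap R K b)) using 1
      ext d
      rw [Matrix.mulVec_single, Pi.smul_apply, MulOpposite.smul_eq_mul_unop]
      exact (hρ (d, k)).trans (mul_comm _ _)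
  obtain ⟨r, hrR, hr1, hr2, hrz⟩ := h.exists_smul_mem h12 hP12 hP21 (L₁ := L₁) (L₂ := L₂)
    (U := U) (fun o d => (z o d : X))
    (fun o => by simpa only [hθ₁] using hV1 _ (hzV o))
    (fun o => by simpa only [hθ₂] using hV2 _ (hzV o))
  choose x₀ t ht using fun o => h.surjectiveOff r hr1 hr2 (x o)
  let y : ι → X := fun d => ∑ o, (x₀ o : X) * z o d
  have huy : u = y + ∑ o, t o • (r • fun d => (z o d : X)) := by
    ext d
    rw [hux, Pi.add_apply, Finset.sum_apply, ← Finset.sum_add_distrib]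
    refine Finset.sum_congr rfl fun o _ => ?_
    rw [ht o]
    simp only [Pi.smul_apply, smul_eq_mul, Subring.subtype_apply]
    ring
  have hsum : ∑ o, t o • (r • fun d => (z o d : X)) ∈ U :=
    Submodule.sum_mem _ fun o _ => U.smul_mem _ (hrz o)
  have hyU : y ∈ U := by
    have := sub_mem hu hsum
    rwa [huy, add_sub_cancel_right] at this
  rw [huy]
  refine add_mem (Submodule.subset_span ⟨hyU, fun d => ?_⟩)
    (Submodule.sum_mem _ fun o _ => Submodule.smul_mem _ _ (Submodule.subset_span ⟨hrz o, fun d =>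
      R.mul_mem hrR (z o d).2⟩))
  exact Subring.sum_mem _ fun o _ => R.mul_mem (x₀ o).2 (z o d).2

theorem Ideal.mem_of_forall_mem_sup_pow {A : Type*} [CommRing A] [IsNoetherianRing A]
    {E Y : Ideal A} (hY : Y ≤ (⊥ : Ideal A).jacobson) {x : A} (hx : ∀ k, x ∈ E ⊔ Y ^ k) :
    x ∈ E := by
  have : IsHausdorff Y (A ⧸ E) := IsHausdorff.of_le_jacobson _ _ hY
  rw [← Ideal.Quotient.eq_zero_iff_mem]
  refine IsHausdorff.haus this _ fun k => ?_
  rw [SModEq.zero]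
  obtain ⟨e, he, y, hy, rfl⟩ := Submodule.mem_sup.mp (hx k)
  rw [_root_.map_add, Ideal.Quotient.eq_zero_iff_mem.mpr he, zero_add,
    show Ideal.Quotient.mk E y = y • (1 : A ⧸ E) by rw [Algebra.smul_def, mul_one]; rfl]
  exact Submodule.smul_mem_smul hy trivial

theorem Ideal.map_comap_of_isPrecomplete {S S₁ : Type*} [CommRing S] [CommRing S₁]
    [IsNoetherianRing S₁] (ι : S →+* S₁) (Y : Ideal S) [IsPrecomplete Y S]
    (hY : Y.map ι ≤ (⊥ : Ideal S₁).jacobson) (hι : ∀ J : Ideal S, (J.map ι).comap ι = J)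
    {E : Ideal S₁} (hE : ∀ k, E ≤ ((E ⊔ (Y ^ k).map ι).comap ι).map ι) :
    (E.comap ι).map ι = E := by
  let a : ℕ → Ideal S := fun k => (E ⊔ (Y ^ k).map ι).comap ι
  have ha : ∀ k, (a k).map ι = E ⊔ (Y ^ k).map ι := fun k =>
    le_antisymm Ideal.map_comap_le (sup_le (hE k)
      (Ideal.map_mono (Ideal.map_le_iff_le_comap.mp le_sup_right)))
  have hstep : ∀ k, ∀ x ∈ a k, ∃ x' ∈ a (k + 1), x - x' ∈ Y ^ k := by
    intro k x hx
    have h1 : (a (k + 1) ⊔ Y ^ k).map ι = (a k).map ι := by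
      rw [Ideal.map_sup, ha, ha, sup_assoc, ← Ideal.map_sup,
        sup_eq_right.mpr (Ideal.pow_le_pow_right k.le_succ : Y ^ (k + 1) ≤ Y ^ k)]
    have h2 : a (k + 1) ⊔ Y ^ k = a k := by rw [← hι (a (k + 1) ⊔ Y ^ k), h1, hι]
    rw [← h2] at hx
    obtain ⟨x', hx', y, hy, rfl⟩ := Submodule.mem_sup.mp hx
    exact ⟨x', hx', by rwa [add_sub_cancel_left]⟩
  choose! nxt hnxt hnxt' using hstep
  have hle : ∀ k, a k ≤ E.comap ι ⊔ Y ^ k := by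
    intro k x hx
    let s : ℕ → S := fun j => Nat.rec x (fun j z => nxt (k + j) z) j
    have hs : ∀ j, s j ∈ a (k + j) := by
      intro j
      induction j with
      | zero => exact hx
      | succ j ih => exact hnxt (k + j) _ ih
    have hss : ∀ j, s j - s (j + 1) ∈ Y ^ (k + j) := fun j => hnxt' (k + j) _ (hs j)
    have hsl : ∀ i j, s i - s (i + j) ∈ Y ^ (k + i) := by
      intro i j
      induction j with
      | zero => simp
      | succ j ih =>
        rw [← sub_add_sub_cancel _ (s (i + j))]
        exact add_mem ih (Ideal.pow_le_pow_right (by lia) (hss (i + j)))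
    obtain ⟨l, hl⟩ := IsPrecomplete.prec (I := Y) inferInstance (f := s) (by
      intro i j hij
      obtain ⟨j, rfl⟩ := Nat.exists_eq_add_of_le hij
      rw [SModEq.sub_mem, smul_eq_mul, Ideal.mul_top]
      exact Ideal.pow_le_pow_right (by lia) (hsl i j))
    have hl' : ∀ j, s j - l ∈ Y ^ j := by
      intro j
      have := hl j
      rwa [SModEq.sub_mem, smul_eq_mul, Ideal.mul_top] at this
    have hlE : l ∈ E.comap ι := by
      refine Ideal.mem_of_forall_mem_sup_pow hY fun j => ?_
      have h1 : ι (s j) ∈ E ⊔ (Y ^ j).map ι :=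
        (sup_le_sup_left (Ideal.map_mono (Ideal.pow_le_pow_right (Nat.le_add_left j k))) E :
          E ⊔ (Y ^ (k + j)).map ι ≤ E ⊔ (Y ^ j).map ι) (hs j)
      have h2 : ι (s j - l) ∈ E ⊔ (Y ^ j).map ι :=
        Submodule.mem_sup_right (Ideal.mem_map_of_mem _ (hl' j))
      rw [← Ideal.map_pow]
      have := sub_mem h1 h2
      rwa [_root_.map_sub, sub_sub_cancel] at this
    have hxl : x - l ∈ Y ^ k := by
      have h1 := hsl 0 k
      rw [zero_add] at h1
      have := add_mem h1 (hl' k)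
      rwa [sub_add_sub_cancel] at this
    have := add_mem (Submodule.mem_sup_left hlE : l ∈ E.comap ι ⊔ Y ^ k)
      (Submodule.mem_sup_right hxl)
    rwa [add_sub_cancel] at this
  refine le_antisymm Ideal.map_comap_le fun e he => Ideal.mem_of_forall_mem_sup_pow hY fun k => ?_
  rw [← Ideal.map_pow, ← Ideal.map_sup]
  exact Ideal.map_mono (hle k) (hE k he)

/-- The family of coefficients of total degree less than `k` of a power series. -/
noncomputable def MvPowerSeries.coeffsLT (σ A : Type*) [CommRing A] (k : ℕ) :
    MvPowerSeries σ A →ₗ[A] ({d : σ →₀ ℕ // d.degree < k} → A) :=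
  LinearMap.pi fun d => coeff d.1

theorem MvPowerSeries.coeffsLT_eq_zero_iff {σ A : Type*} [Finite σ] [CommRing A] {k : ℕ}
    {f : MvPowerSeries σ A} : coeffsLT σ A k f = 0 ↔ f ∈ varIdeal σ A ^ k := by
  rw [mem_varIdeal_pow_iff, funext_iff, Subtype.forall]
  rfl

theorem MvPowerSeries.exists_sub_mem_varIdeal_pow {σ A : Type*} [Finite σ] [CommRing A] (k : ℕ)
    (f : MvPowerSeries σ A) : ∃ p : MvPolynomial σ A, f - p ∈ varIdeal σ A ^ k := by
  refine ⟨truncTotal k f, ?_⟩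
  rw [mem_varIdeal_pow_iff]
  intro d hd
  rw [_root_.map_sub, MvPolynomial.coeff_coe, coeff_truncTotal f hd, sub_self]

theorem MvPowerSeries.coeffsLT_mem_span {σ A L : Type*} [Finite σ] [CommRing A] [CommRing L]
    (ψ : A →+* L) {E : Ideal (MvPowerSeries σ A)} {k : ℕ} {z : MvPowerSeries σ L}
    (hz : z ∈ E.map (map ψ)) : coeffsLT σ L k z ∈ Submodule.span L
      {w | ∃ u ∈ (E.restrictScalars A).map (coeffsLT σ A k), w = fun d => ψ (u d)} := by
  let G : Submodule L (MvPowerSeries σ L) := Submodule.span L {g | ∃ e ∈ E, g = map ψ e}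
  have hX : ∀ i, ∀ z ∈ G, X i * z ∈ G := by
    intro i z hz
    induction hz using Submodule.span_induction with
    | mem z hz =>
      obtain ⟨e, he, rfl⟩ := hz
      refine Submodule.subset_span ⟨X i * e, E.mul_mem_left _ he, ?_⟩
      rw [_root_.map_mul, map_X]
    | zero => simp
    | add x y _ _ hx hy => rw [mul_add]; exact add_mem hx hy
    | smul a x _ hx => rw [mul_smul_comm]; exact G.smul_mem _ hx
  have hpoly : ∀ b : MvPolynomial σ L, ∀ z ∈ G, (b : MvPowerSeries σ L) * z ∈ G := by
    intro b
    induction b using MvPolynomial.induction_on with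
    | C a =>
      intro z hz
      rw [MvPolynomial.coe_C, ← smul_eq_C_mul]
      exact G.smul_mem _ hz
    | add p q hp hq =>
      intro z hz
      rw [MvPolynomial.coe_add, add_mul]
      exact add_mem (hp z hz) (hq z hz)
    | mul_X p i hp =>
      intro z hz
      rw [MvPolynomial.coe_mul, MvPolynomial.coe_X, mul_assoc]
      exact hp _ (hX i z hz)
  have hW : z ∈ G ⊔ (varIdeal σ L ^ k).restrictScalars L := by
    induction hz using Submodule.span_induction with
    | mem z hz =>
      obtain ⟨e, he, rfl⟩ := hz
      exact Submodule.mem_sup_left (Submodule.subset_span ⟨e, he, rfl⟩)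
    | zero => exact zero_mem _
    | add x y _ _ hx hy => exact add_mem hx hy
    | smul b x _ hx =>
      obtain ⟨g, hg, y, hy, rfl⟩ := Submodule.mem_sup.mp hx
      obtain ⟨p, hp⟩ := exists_sub_mem_varIdeal_pow k b
      rw [smul_eq_mul, mul_add, ← sub_add_cancel b p, add_mul _ _ g, add_comm (_ * g), add_assoc]
      exact add_mem (Submodule.mem_sup_left (hpoly p g hg)) (Submodule.mem_sup_right
        (add_mem (Ideal.mul_mem_right _ _ hp) (Ideal.mul_mem_left _ _ hy)))
  obtain ⟨g, hg, y, hy, rfl⟩ := Submodule.mem_sup.mp hW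
  rw [_root_.map_add, coeffsLT_eq_zero_iff.mpr hy, add_zero]
  refine (Submodule.map_span_le (coeffsLT σ L k) _ _).mpr ?_ (Submodule.mem_map_of_mem hg)
  rintro _ ⟨e, he, rfl⟩
  exact Submodule.subset_span ⟨coeffsLT σ A k e, Submodule.mem_map_of_mem he, by
    ext d; exact coeff_map ψ d.1 e⟩

theorem MvPowerSeries.coeffsLT_mem_span_of_map_le {σ A K L : Type*} [Finite σ] [CommRing A]
    [CommRing K] [CommRing L] (ψ : A →+* L) (θ : K →+* L) {E : Ideal (MvPowerSeries σ A)}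
    {F : Ideal (MvPowerSeries σ K)} (h : E.map (map ψ) ≤ F.map (map θ)) {k : ℕ}
    {u : {d : σ →₀ ℕ // d.degree < k} → A}
    (hu : u ∈ (E.restrictScalars A).map (coeffsLT σ A k)) :
    (fun d => ψ (u d)) ∈ Submodule.span L
      {w | ∃ v ∈ (F.restrictScalars K).map (coeffsLT σ K k), w = fun d => θ (v d)} := by
  obtain ⟨e, he, rfl⟩ := hu
  convert! coeffsLT_mem_span θ (h (Ideal.mem_map_of_mem _ he)) using 1

theorem Subring.IsGluing.map_comap_eq {X : Type u} [CommRing X] [IsLocalRing X]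
    [IsNoetherianRing X] {R : Subring X}
    {P₁ P₂ : Ideal X} [P₁.IsPrime] [P₂.IsPrime] (h : R.IsGluing P₁ P₂) (h12 : P₁ ⊓ P₂ = ⊥)
    (hP12 : ¬ P₁ ≤ P₂) (hP21 : ¬ P₂ ≤ P₁) {K L₁ L₂ : Type*} [Field K] [Field L₁] [Field L₂]
    [Algebra R K] [IsFractionRing R K]
    [Algebra X L₁] [Algebra X L₂] [IsLocalization.AtPrime L₁ P₁] [IsLocalization.AtPrime L₂ P₂]
    (θ₁ : K →+* L₁) (θ₂ : K →+* L₂) (hθ₁ : ∀ r, θ₁ (algebraMap R K r) = algebraMap X L₁ r)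
    (hθ₂ : ∀ r, θ₂ (algebraMap R K r) = algebraMap X L₂ r) {n : ℕ}
    (hι : ∀ J : Ideal (MvPowerSeries (Fin n) R),
      (J.map (MvPowerSeries.map R.subtype)).comap (MvPowerSeries.map R.subtype) = J)
    {E : Ideal (MvPowerSeries (Fin n) X)} {F : Ideal (MvPowerSeries (Fin n) K)}
    (hEF1 : E.map (MvPowerSeries.map (algebraMap X L₁)) = F.map (MvPowerSeries.map θ₁))
    (hEF2 : E.map (MvPowerSeries.map (algebraMap X L₂)) = F.map (MvPowerSeries.map θ₂)) :
    (E.comap (MvPowerSeries.map R.subtype)).map (MvPowerSeries.map R.subtype) = E := by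
  refine Ideal.map_comap_of_isPrecomplete _ (MvPowerSeries.varIdeal (Fin n) R) ?_ hι
    fun k e he => ?_
  · rw [MvPowerSeries.map_varIdeal]
    exact MvPowerSeries.varIdeal_le_jacobson X
  have := MvPowerSeries.finite_degree_lt (Fin n) k
  let D := {d : Fin n →₀ ℕ // d.degree < k}
  let τ := MvPowerSeries.coeffsLT (Fin n) X k
  let U : Submodule X (D → X) := (E.restrictScalars X).map τ
  let V : Submodule K (D → K) := (F.restrictScalars K).map (MvPowerSeries.coeffsLT (Fin n) K k)
  have he' := h.mem_span h12 hP12 hP21 θ₁ θ₂ hθ₁ hθ₂ (U := U) (V := V)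
    (fun u hu => MvPowerSeries.coeffsLT_mem_span_of_map_le _ θ₁ hEF1.le hu)
    (fun u hu => MvPowerSeries.coeffsLT_mem_span_of_map_le _ θ₂ hEF2.le hu)
    (fun v hv => MvPowerSeries.coeffsLT_mem_span_of_map_le θ₁ _ hEF1.ge hv)
    (fun v hv => MvPowerSeries.coeffsLT_mem_span_of_map_le θ₂ _ hEF2.ge hv)
    (u := τ e) (Submodule.mem_map_of_mem he)
  let ι : MvPowerSeries (Fin n) R →+* MvPowerSeries (Fin n) X := MvPowerSeries.map R.subtype
  let J := ((E ⊔ (MvPowerSeries.varIdeal (Fin n) R ^ k).map ι).comap ι).map ι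
  have hY : MvPowerSeries.varIdeal (Fin n) X ^ k ≤ J := by
    rw [← MvPowerSeries.map_varIdeal R.subtype, ← Ideal.map_pow]
    exact Ideal.map_mono (Ideal.map_le_iff_le_comap.mp le_sup_right)
  have key : ∀ z ∈ Submodule.span X {z | z ∈ U ∧ ∀ d, z d ∈ R}, ∃ j ∈ J, τ j = z := by
    intro z hz
    suffices h1 : Submodule.span X {z | z ∈ U ∧ ∀ d, z d ∈ R} ≤ (J.restrictScalars X).map τ from
      h1 hz
    rw [Submodule.span_le]
    rintro z ⟨⟨e', he', rfl⟩, hzR⟩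
    obtain ⟨G, hG⟩ := MvPowerSeries.exists_coeff_eq (fun d : D => (⟨_, hzR d⟩ : R))
    have hG' : τ (ι G) = τ e' := by
      ext d
      exact (MvPowerSeries.coeff_map R.subtype d.1 G).trans (congrArg Subtype.val (hG d))
    refine ⟨ι G, Ideal.mem_map_of_mem _ ?_, hG'⟩
    rw [Ideal.mem_comap, Ideal.map_pow, MvPowerSeries.map_varIdeal, ← sub_add_cancel (ι G) e',
      add_comm]
    refine add_mem (Submodule.mem_sup_left he') (Submodule.mem_sup_right ?_)
    rw [← MvPowerSeries.coeffsLT_eq_zero_iff, _root_.map_sub, sub_eq_zero]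
    exact hG'
  obtain ⟨j, hj, hje⟩ := key _ he'
  rw [← sub_add_cancel e j]
  refine add_mem (hY ?_) hj
  rw [← MvPowerSeries.coeffsLT_eq_zero_iff, _root_.map_sub, sub_eq_zero]
  exact hje.symm

theorem Ideal.isField_localization_atPrime_of_inf_eq_bot {X : Type*} [CommRing X] (P P' : Ideal X)
    [P.IsPrime] (h : P ⊓ P' = ⊥) (hP : ¬ P' ≤ P) : IsField (Localization.AtPrime P) := by
  rw [IsLocalRing.isField_iff_maximalIdeal_eq, ← Localization.AtPrime.map_eq_maximalIdeal,
    Ideal.map_eq_bot_iff_le_ker]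
  obtain ⟨c, hc, hcP⟩ := SetLike.not_le_iff_exists.mp hP
  intro x hx
  rw [RingHom.mem_ker, IsLocalization.map_eq_zero_iff P.primeCompl]
  refine ⟨⟨c, hcP⟩, ?_⟩
  have : c * x ∈ P ⊓ P' := ⟨P.mul_mem_left _ hx, P'.mul_mem_right _ hc⟩
  rwa [h, Ideal.mem_bot] at this

theorem Ideal.exists_field_isLocalization_atPrime {X : Type u} [CommRing X] (P P' : Ideal X)
    [P.IsPrime] (h : P ⊓ P' = ⊥) (hP : ¬ P' ≤ P) :
    ∃ (L : Type u) (_ : Field L) (_ : Algebra X L), IsLocalization.AtPrime L P := by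
  let _ : Field (Localization.AtPrime P) :=
    (P.isField_localization_atPrime_of_inf_eq_bot P' h hP).toField
  exact ⟨Localization.AtPrime P, inferInstance, OreLocalization.instAlgebra,
    Localization.isLocalization⟩

theorem MvPowerSeries.comap_map_map_eq {A B : Type u} [CommRing A] [CommRing B]
    [IsNoetherianRing A] [IsNoetherianRing B] [IsLocalRing A] [IsLocalRing B] {f : A →+* B}
    [IsLocalHom f] (hf : f.Flat) {n : ℕ} (J : Ideal (MvPowerSeries (Fin n) A)) :
    (J.map (map f)).comap (map f) = J := by
  have hfl : (map (σ := Fin n) f).Flat := flat_map hf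
  let g : MvPowerSeries (Fin n) A →+* MvPowerSeries (Fin n) B := map f
  have : IsLocalHom g := MvPowerSeries.map.isLocalHom f
  algebraize [g]
  have : Module.Flat (MvPowerSeries (Fin n) A) (MvPowerSeries (Fin n) B) := hfl
  have : IsLocalHom (algebraMap (MvPowerSeries (Fin n) A) (MvPowerSeries (Fin n) B)) :=
    ‹IsLocalHom g›
  have : Module.FaithfullyFlat (MvPowerSeries (Fin n) A) (MvPowerSeries (Fin n) B) :=
    Module.FaithfullyFlat.of_flat_of_isLocalHom
  exact Ideal.comap_map_eq_self_of_faithfullyFlat (B := MvPowerSeries (Fin n) B) J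

theorem Subring.IsGluing.exists_field_hom {X K : Type u} [CommRing X] {R : Subring X} [IsDomain R]
    {P P' : Ideal X} [P.IsPrime] (hR : P.comap R.subtype = ⊥) (h : P ⊓ P' = ⊥) (hP : ¬ P' ≤ P)
    [Field K] [Algebra R K] [IsFractionRing R K] :
    ∃ (L : Type u) (_ : Field L) (_ : Algebra X L) (_ : IsLocalization.AtPrime L P)
      (θ : K →+* L), θ.comp (algebraMap R K) = (algebraMap X L).comp R.subtype := by
  obtain ⟨L, _, _, _⟩ := P.exists_field_isLocalization_atPrime P' h hP
  have hinj : Function.Injective ((algebraMap X L).comp R.subtype) := by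
    rw [injective_iff_map_eq_zero]
    intro r hr
    have : r ∈ P.comap R.subtype :=
      (IsLocalization.AtPrime.algebraMap_eq_zero_iff_mem (L := L) P).mp hr
    rwa [hR] at this
  exact ⟨L, _, _, ‹_›, IsFractionRing.lift hinj, IsLocalization.lift_comp _⟩

theorem MvPowerSeries.map_map_map {σ A B C : Type*} [CommRing A] [CommRing B] [CommRing C]
    (f : A →+* B) (g : B →+* C) (J : Ideal (MvPowerSeries σ A)) :
    (J.map (map f)).map (map g) = J.map (map (g.comp f)) := by
  rw [Ideal.map_map, MvPowerSeries.map_comp]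

theorem Ideal.IsRadical.radical_map_radical {A B : Type*} [CommRing A] [CommRing B] {f : A →+* B}
    {J : Ideal A} (h : (J.radical.map f).IsRadical) : J.radical.map f = (J.map f).radical :=
  le_antisymm (Ideal.map_radical_le f) (h.radical_le_iff.mpr (Ideal.map_mono Ideal.le_radical))

theorem MvPowerSeries.radical_map_map_eq {R X K L T : Type u} [CommRing R] [CommRing X]
    [IsNoetherianRing X] [Field K] [CharZero K] [Field L] [Algebra X L] [CommRing T]
    [IsNoetherianRing T] [Algebra ℚ T] (hT : IsGRing T) (P : Ideal X) [P.IsPrime]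
    [IsLocalization.AtPrime L P] {n : ℕ} {p : MvPowerSeries (Fin n) X →+* T}
    (hp : Function.Surjective p) (Q : Ideal T) [Q.IsPrime]
    (hQ : Q.comap p = P.comap constantCoeff) {ι : R →+* X} {κ : R →+* K} {θ : K →+* L}
    (hθ : θ.comp κ = (algebraMap X L).comp ι) {J : Ideal (MvPowerSeries (Fin n) R)}
    (hJ : RingHom.ker p ≤ J.map (map ι)) :
    (J.map (map ι)).radical.map (map (algebraMap X L)) =
      (J.map (map κ)).radical.map (map θ) := by
  have hfl : θ.Flat := by
    algebraize [θ]
    exact (inferInstance : Module.Flat K L)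
  have h1 : ((J.map (map ι)).radical.map (map (σ := Fin n) (algebraMap X L))).IsRadical :=
    isRadical_map_of_isGRing hT P hp Q hQ (Ideal.radical_isRadical _) (hJ.trans Ideal.le_radical)
  have h2 : ((J.map (map κ)).radical.map (map (σ := Fin n) θ)).IsRadical :=
    (hasRegularFibers_map θ n).isRadical_map (flat_map hfl) (Ideal.radical_isRadical _)
  have h3 : (J.map (map ι)).map (map (algebraMap X L)) = (J.map (map κ)).map (map θ) := by
    rw [map_map_map, map_map_map, hθ]
  exact h1.radical_map_radical.trans ((congrArg Ideal.radical h3).trans h2.radical_map_radical.symm)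

theorem Subring.IsGluing.isRadical_map {X T : Type u} [CommRing X] [IsLocalRing X]
    [IsNoetherianRing X] [Algebra ℚ X] {R : Subring X}
    {P₁ P₂ : Ideal X} [P₁.IsPrime] [P₂.IsPrime] (h : R.IsGluing P₁ P₂) (h12 : P₁ ⊓ P₂ = ⊥)
    (hP12 : ¬ P₁ ≤ P₂) (hP21 : ¬ P₂ ≤ P₁) [CommRing T]
    [IsNoetherianRing T] [Algebra ℚ T] (hT : IsGRing T) {n : ℕ}
    {p : MvPowerSeries (Fin n) X →+* T} (hp : Function.Surjective p)
    (Q₁ Q₂ : Ideal T) [Q₁.IsPrime] [Q₂.IsPrime]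
    (hQ₁ : Q₁.comap p = P₁.comap MvPowerSeries.constantCoeff)
    (hQ₂ : Q₂.comap p = P₂.comap MvPowerSeries.constantCoeff)
    {J : Ideal (MvPowerSeries (Fin n) R)} (hJ : J.IsRadical)
    (hpJ : RingHom.ker p ≤ J.map (MvPowerSeries.map R.subtype)) :
    (J.map (MvPowerSeries.map R.subtype)).IsRadical := by
  have := h.isDomain
  have := h.isLocalRing
  have := h.isLocalHom
  have := h.isNoetherianRing
  have hm1 : ¬ maximalIdeal X ≤ P₁ := fun hle =>
    hP21 ((IsLocalRing.le_maximalIdeal Ideal.IsPrime.ne_top').trans hle)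
  have hm2 : ¬ maximalIdeal X ≤ P₂ := fun hle =>
    hP12 ((IsLocalRing.le_maximalIdeal Ideal.IsPrime.ne_top').trans hle)
  have : CharZero X := algebraRat.charZero X
  have : CharZero R := ⟨fun a b hab => Nat.cast_injective (R := X) (by
    simpa using congrArg R.subtype hab)⟩
  have : CharZero (FractionRing R) :=
    charZero_of_injective_algebraMap (IsFractionRing.injective R (FractionRing R))
  obtain ⟨L₁, _, _, _, θ₁, hθ₁⟩ := exists_field_hom (K := FractionRing R) h.comap_left h12 hP21
  obtain ⟨L₂, _, _, _, θ₂, hθ₂⟩ := exists_field_hom (K := FractionRing R) h.comap_right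
    (inf_comm P₁ P₂ ▸ h12) hP12
  have hι (J' : Ideal (MvPowerSeries (Fin n) R)) :=
    MvPowerSeries.comap_map_map_eq (h.flat hm1 hm2) J'
  have key := h.map_comap_eq h12 hP12 hP21 θ₁ θ₂ (RingHom.congr_fun hθ₁) (RingHom.congr_fun hθ₂) hι
    (MvPowerSeries.radical_map_map_eq hT P₁ hp Q₁ hQ₁ hθ₁ hpJ)
    (MvPowerSeries.radical_map_map_eq hT P₂ hp Q₂ hQ₂ hθ₂ hpJ)
  rw [Ideal.comap_radical, hι, hJ.radical] at key
  rw [key]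
  exact Ideal.radical_isRadical _

theorem Subring.IsGluing.regAt_of_le {X T : Type u} [CommRing X] [IsLocalRing X]
    [IsNoetherianRing X] [Algebra ℚ X] {R : Subring X} [IsDomain R] [IsNoetherianRing R]
    {P P' : Ideal X} [P.IsPrime] (hR : P.comap R.subtype = ⊥) (h : P ⊓ P' = ⊥)
    (hP : ¬ P' ≤ P) [CommRing T] [IsNoetherianRing T] [Algebra ℚ T] (hT : IsGRing T) {n : ℕ}
    {p : MvPowerSeries (Fin n) X →+* T} (hp : Function.Surjective p) (Q : Ideal T) [Q.IsPrime]
    (hQ : Q.comap p = P.comap MvPowerSeries.constantCoeff)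
    (N : Ideal (MvPowerSeries (Fin n) X)) [N.IsPrime]
    (hN : N ≤ P.comap MvPowerSeries.constantCoeff)
    (hrad : ((N.comap (MvPowerSeries.map R.subtype)).map
      (MvPowerSeries.map R.subtype)).IsRadical)
    (hker : RingHom.ker p ≤ (N.comap (MvPowerSeries.map R.subtype)).map
      (MvPowerSeries.map R.subtype)) :
    ((N.comap (MvPowerSeries.map R.subtype)).map (MvPowerSeries.map R.subtype)).RegAt N := by
  have : CharZero X := algebraRat.charZero X
  have : CharZero R := ⟨fun a b hab => Nat.cast_injective (R := X) (by
    simpa using congrArg R.subtype hab)⟩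
  have : CharZero (FractionRing R) :=
    charZero_of_injective_algebraMap (IsFractionRing.injective R (FractionRing R))
  obtain ⟨L, _, _, _, θ, hθ⟩ := exists_field_hom (K := FractionRing R) hR h hP
  have hθf : θ.Flat := by
    algebraize [θ]
    exact (inferInstance : Module.Flat (FractionRing R) L)
  have hKf : (algebraMap R (FractionRing R)).Flat :=
    RingHom.flat_algebraMap_iff.mpr (IsLocalization.flat _ (nonZeroDivisors R))
  have hLf : (algebraMap X L).Flat :=
    RingHom.flat_algebraMap_iff.mpr (IsLocalization.flat _ P.primeCompl)
  set P0 := N.comap (MvPowerSeries.map R.subtype) with hP0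
  have : P0.IsPrime := Ideal.comap_isPrime _ _
  have hP0Y : P0 ≤ MvPowerSeries.varIdeal (Fin n) R := by
    intro f hf
    rw [MvPowerSeries.mem_varIdeal_iff]
    have h1 : MvPowerSeries.constantCoeff f ∈ P.comap R.subtype := by
      have := hN hf
      rwa [Ideal.mem_comap, MvPowerSeries.constantCoeff_map] at this
    rwa [hR] at h1
  have hPK : (P0.map
      (MvPowerSeries.map (σ := Fin n) (algebraMap R (FractionRing R)))).IsRadical := by
    have h1 := MvPowerSeries.isRadical_map_of_isGRing (L := L) hT P hp Q hQ hrad hker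
    rw [MvPowerSeries.map_map_map, ← hθ, ← MvPowerSeries.map_map_map] at h1
    rw [← MvPowerSeries.comap_map_map_eq hθf (P0.map _)]
    exact h1.comap _
  obtain ⟨r, f, d, c, a, hf, hh, hhP, hc, ha⟩ := MvPowerSeries.exists_jacobian hKf P0 hP0Y hPK
  obtain ⟨N'', hN''p, hN''⟩ : ∃ N'' : Ideal (MvPowerSeries (Fin n) L), N''.IsPrime ∧
      N''.comap (MvPowerSeries.map (algebraMap X L)) = N := by
    have hgd := (MvPowerSeries.flat_map (τ := Fin n) hLf).generalizingMap_comap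
    have hmax : (maximalIdeal (MvPowerSeries (Fin n) L)).comap
        (MvPowerSeries.map (algebraMap X L)) = P.comap MvPowerSeries.constantCoeff := by
      rw [MvPowerSeries.maximalIdeal_eq_varIdeal]
      ext x
      rw [Ideal.mem_comap, MvPowerSeries.mem_varIdeal_iff, MvPowerSeries.constantCoeff_map,
        IsLocalization.AtPrime.algebraMap_eq_zero_iff_mem P]
      rfl
    let y : PrimeSpectrum (MvPowerSeries (Fin n) L) := ⟨maximalIdeal _, inferInstance⟩
    obtain ⟨z, -, hz⟩ := hgd (a := y) (b := ⟨N, ‹_›⟩) ((PrimeSpectrum.le_iff_specializes _ _).mp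
      (hN.trans hmax.ge))
    exact ⟨z.asIdeal, z.2, congrArg PrimeSpectrum.asIdeal hz⟩
  have hreg := MvPowerSeries.regAt_map_of_jacobian ((algebraMap X L).comp R.subtype) hf hh hhP hc
    ha N'' (by rw [MvPowerSeries.map_comp, ← Ideal.comap_comap, hN''])
  rw [← MvPowerSeries.map_map_map] at hreg
  exact Ideal.RegAt.of_map (MvPowerSeries.flat_map hLf) hN''.symm hreg

theorem RingHom.Flat.of_surjective_of_ker_eq {A A' B T : Type u} [CommRing A] [CommRing A']
    [CommRing B] [CommRing T] {f : A →+* A'} (hf : f.Flat) {s : A →+* B} {p : A' →+* T}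
    {g : B →+* T} (hs : Function.Surjective s) (hp : Function.Surjective p)
    (hg : g.comp s = p.comp f) (hker : RingHom.ker p = (RingHom.ker s).map f) : g.Flat := by
  have h1 := RingHom.Flat.quotientMap hf (RingHom.ker s)
  let eB := RingHom.quotientKerEquivOfSurjective hs
  let eT := (Ideal.quotEquivOfEq hker.symm).trans (RingHom.quotientKerEquivOfSurjective hp)
  have h2 : g = (eT.toRingHom.comp
      (Ideal.quotientMap ((RingHom.ker s).map f) f Ideal.le_comap_map)).comp
        eB.symm.toRingHom := by
    refine RingHom.ext fun b => ?_
    obtain ⟨a, rfl⟩ := hs b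
    have h3 : eB.symm.toRingHom (s a) = Ideal.Quotient.mk (RingHom.ker s) a :=
      (RingEquiv.symm_apply_eq eB).mpr rfl
    have h4 : g (s a) = p (f a) := RingHom.congr_fun hg a
    rw [h4, RingHom.comp_apply, h3]
    rfl
  rw [h2]
  exact (RingHom.Flat.of_bijective eB.symm.bijective).comp
    (h1.comp (RingHom.Flat.of_bijective eT.bijective))

theorem Subring.IsGluing.hasRegularFibers {X B T : Type u} [CommRing X] [IsLocalRing X]
    [IsNoetherianRing X] [Algebra ℚ X] {R : Subring X}
    {P₁ P₂ : Ideal X} [P₁.IsPrime] [P₂.IsPrime] (h : R.IsGluing P₁ P₂) (h12 : P₁ ⊓ P₂ = ⊥)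
    (hP12 : ¬ P₁ ≤ P₂) (hP21 : ¬ P₂ ≤ P₁) [CommRing B] [CommRing T] [IsLocalRing T]
    [IsNoetherianRing T] [Algebra ℚ T] (hT : IsGRing T) {n : ℕ}
    {p : MvPowerSeries (Fin n) X →+* T} (hp : Function.Surjective p)
    {Q₁ Q₂ : Ideal T} [Q₁.IsPrime] [Q₂.IsPrime]
    (hQ₁ : Q₁.comap p = P₁.comap MvPowerSeries.constantCoeff)
    (hQ₂ : Q₂.comap p = P₂.comap MvPowerSeries.constantCoeff)
    {s : MvPowerSeries (Fin n) R →+* B} (hs : Function.Surjective s) {g : B →+* T}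
    (hg : g.comp s = p.comp (MvPowerSeries.map R.subtype))
    (hker : RingHom.ker p = (RingHom.ker s).map (MvPowerSeries.map R.subtype)) :
    HasRegularFibers g := by
  intro N _
  have hoff : g.SurjectiveOff Q₁ Q₂ :=
    h.surjectiveOff.mvPowerSeries.of_surjective s p hp hg hQ₁.ge hQ₂.ge
  by_cases hN : ¬ N ≤ Q₁ ∧ ¬ N ≤ Q₂
  · rw [hoff.map_comap hN.1 hN.2]
    exact Ideal.RegAt.self N
  have := h.isDomain
  have := h.isNoetherianRing
  have hc : (N.comap p).comap (MvPowerSeries.map R.subtype) = (N.comap g).comap s := by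
    rw [Ideal.comap_comap, ← hg, ← Ideal.comap_comap]
  have hle : RingHom.ker p ≤ ((N.comap p).comap (MvPowerSeries.map R.subtype)).map
      (MvPowerSeries.map R.subtype) := by
    rw [hker, hc]
    exact Ideal.map_mono (Ideal.comap_mono bot_le)
  have hm : (N.comap g).map g = (((N.comap p).comap (MvPowerSeries.map R.subtype)).map
      (MvPowerSeries.map R.subtype)).map p := by
    rw [Ideal.map_map, ← hg, hc, ← Ideal.map_map, Ideal.map_comap_of_surjective s hs]
  have hrad := h.isRadical_map h12 hP12 hP21 hT hp Q₁ Q₂ hQ₁ hQ₂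
    (Ideal.IsPrime.isRadical (I := (N.comap p).comap (MvPowerSeries.map R.subtype)) inferInstance)
    hle
  rw [hm, Ideal.regAt_map_iff p hp hle]
  rw [not_and_or, not_not, not_not] at hN
  rcases hN with hN | hN
  · exact regAt_of_le h.comap_left h12 hP21 hT hp Q₁ hQ₁ _ ((Ideal.comap_mono hN).trans hQ₁.le)
      hrad hle
  · exact regAt_of_le h.comap_right (inf_comm P₁ P₂ ▸ h12) hP12 hT hp Q₂ hQ₂ _
      ((Ideal.comap_mono hN).trans hQ₂.le) hrad hle

theorem MvPowerSeries.constExt_sup_varIdeal {X : Type u} [CommRing X] (P : Ideal X) (n : ℕ) :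
    P.constExt n ⊔ varIdeal (Fin n) X = P.comap constantCoeff := by
  refine le_antisymm (sup_le ?_ (varIdeal_le_comap_constantCoeff P)) fun f hf => ?_
  · rw [Ideal.constExt, Ideal.map_le_iff_le_comap]
    intro x hx
    simpa using hx
  · have h1 : f - C (constantCoeff f) ∈ varIdeal (Fin n) X := by
      rw [mem_varIdeal_iff]
      simp
    rw [← add_sub_cancel (C (constantCoeff f)) f]
    exact Submodule.add_mem_sup (Ideal.mem_map_of_mem _ hf) h1

theorem Ideal.comap_symm_comp_mk_eq {A T : Type*} [CommRing A] [CommRing T] {J K : Ideal A}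
    (e : T ≃+* A ⧸ J) {Q : Ideal T} (hJ : J ≤ K)
    (hQ : Q.map e.toRingHom = K.map (Ideal.Quotient.mk J)) :
    Q.comap (e.symm.toRingHom.comp (Ideal.Quotient.mk J)) = K := by
  have h1 : Q.comap e.symm.toRingHom = Q.map e.toRingHom := Ideal.comap_symm e
  rw [← Ideal.comap_comap, h1, hQ, Ideal.comap_map_mk hJ]

theorem Localization.AtPrime.map_inf_eq_maximalIdeal {T : Type*} [CommRing T] (Q Q' : Ideal T)
    [Q.IsPrime] (h : ¬ Q' ≤ Q) :
    (Q ⊓ Q').map (algebraMap T (Localization.AtPrime Q)) =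
      maximalIdeal (Localization.AtPrime Q) := by
  rw [← Localization.AtPrime.map_eq_maximalIdeal]
  refine le_antisymm (Ideal.map_mono inf_le_left) (Ideal.map_le_iff_le_comap.mpr fun x hx => ?_)
  obtain ⟨c, hc, hcQ⟩ := SetLike.not_le_iff_exists.mp h
  have hu : IsUnit (algebraMap T (Localization.AtPrime Q) c) :=
    IsLocalization.map_units _ (⟨c, hcQ⟩ : Q.primeCompl)
  rw [Ideal.mem_comap, ← Ideal.unit_mul_mem_iff_mem _ hu, ← map_mul]
  exact Ideal.mem_map_of_mem _ ⟨Q.mul_mem_left _ hx, Q'.mul_mem_right _ hc⟩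

theorem Localization.map_localRingHom_maximalIdeal {B T : Type*} [CommRing B] [CommRing T]
    {g : B →+* T} {q : Ideal B} [q.IsPrime] {Q : Ideal T} [Q.IsPrime] (Q' : Ideal T)
    (hq : q = Q.comap g) (hm : q.map g = Q ⊓ Q') (h : ¬ Q' ≤ Q) :
    (maximalIdeal (Localization.AtPrime q)).map (localRingHom q Q g hq) =
      maximalIdeal (Localization.AtPrime Q) := by
  rw [← Localization.AtPrime.map_inf_eq_maximalIdeal Q Q' h, ← hm,
    ← Localization.AtPrime.map_eq_maximalIdeal, Ideal.map_map, Ideal.map_map]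
  congr 1
  exact RingHom.ext (Localization.localRingHom_to_map q Q g hq)

open Cardinal in
theorem IsLocalRing.mk_quotient_eq_mk_residueField {T : Type u} [CommRing T] [IsLocalRing T]
    (hT : #T = #(ResidueField T)) (J : Ideal T) [IsLocalRing (T ⧸ J)] :
    #(T ⧸ J) = #T ∧ #(T ⧸ J) = #(ResidueField (T ⧸ J)) := by
  have : IsLocalHom (Ideal.Quotient.mk J) :=
    IsLocalHom.of_surjective _ Ideal.Quotient.mk_surjective
  have h1 : #(T ⧸ J) ≤ #T := mk_le_of_surjective Ideal.Quotient.mk_surjective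
  have h2 : #(ResidueField T) ≤ #(ResidueField (T ⧸ J)) :=
    mk_le_of_injective (ResidueField.map (Ideal.Quotient.mk J)).injective
  have h3 : #(ResidueField (T ⧸ J)) ≤ #(T ⧸ J) := mk_le_of_surjective residue_surjective
  exact ⟨h1.antisymm (hT.le.trans (h2.trans h3)), (h1.trans (hT.le.trans h2)).antisymm h3⟩

theorem RingHom.SurjectiveOff.surjective_residueField_map {B T : Type*} [CommRing B] [CommRing T]
    [IsLocalRing B] [IsLocalRing T] {g : B →+* T} [IsLocalHom g] {Q₁ Q₂ : Ideal T} [Q₁.IsPrime]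
    [Q₂.IsPrime] (hg : g.SurjectiveOff Q₁ Q₂) (h1 : ¬ maximalIdeal T ≤ Q₁)
    (h2 : ¬ maximalIdeal T ≤ Q₂) : Function.Surjective (ResidueField.map g) := by
  obtain ⟨a, ha, ha1, ha2⟩ := Ideal.exists_mem_notMem_notMem h1 h2
  intro x
  obtain ⟨t, rfl⟩ := residue_surjective x
  obtain ⟨r, s, rfl⟩ := hg a ha1 ha2 t
  refine ⟨residue B r, ?_⟩
  rw [ResidueField.map_residue, _root_.map_add, _root_.map_mul, (residue_eq_zero_iff a).mpr ha,
    zero_mul, add_zero]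

theorem RingHom.SurjectiveOff.bijOn_comap_quotient {B T : Type*} [CommRing B] [CommRing T]
    [IsLocalRing T] {g : B →+* T} {Q₁ Q₂ : Ideal T} [Q₁.IsPrime] [Q₂.IsPrime]
    (hg : g.SurjectiveOff Q₁ Q₂) (h12 : ¬ Q₁ ≤ Q₂) (h21 : ¬ Q₂ ≤ Q₁) {q : Ideal B} [q.IsPrime]
    (hq1 : q = Q₁.comap g) (hq2 : q = Q₂.comap g) (hm : q.map g = Q₁ ⊓ Q₂)
    (hc : ∀ p : Ideal B, (p.map g).comap g ≤ p) (g' : B ⧸ q →+* T ⧸ (Q₁ ⊓ Q₂))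
    (hg' : ∀ b, g' (Ideal.Quotient.mk q b) = Ideal.Quotient.mk (Q₁ ⊓ Q₂) (g b)) :
    Set.BijOn (fun P : Ideal (T ⧸ (Q₁ ⊓ Q₂)) => P.comap g')
      {P : Ideal (T ⧸ (Q₁ ⊓ Q₂)) | ∃ hP : P.IsPrime,
        0 < Order.height (⟨P, hP⟩ : PrimeSpectrum (T ⧸ (Q₁ ⊓ Q₂)))}
      {p : Ideal (B ⧸ q) | ∃ hp : p.IsPrime,
        0 < Order.height (⟨p, hp⟩ : PrimeSpectrum (B ⧸ q))} := by
  have hX : IsLocalRing (T ⧸ (Q₁ ⊓ Q₂)) := IsLocalRing.quotient_of_le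
    (inf_le_left.trans (IsLocalRing.le_maximalIdeal Ideal.IsPrime.ne_top'))
  have hcomp : g'.comp (Ideal.Quotient.mk q) = (Ideal.Quotient.mk (Q₁ ⊓ Q₂)).comp g :=
    RingHom.ext hg'
  have hker1 : RingHom.ker (Ideal.Quotient.mk (Q₁ ⊓ Q₂)) ≤ Q₁ := by
    rw [Ideal.mk_ker]; exact inf_le_left
  have hker2 : RingHom.ker (Ideal.Quotient.mk (Q₁ ⊓ Q₂)) ≤ Q₂ := by
    rw [Ideal.mk_ker]; exact inf_le_right
  have : (Q₁.map (Ideal.Quotient.mk (Q₁ ⊓ Q₂))).IsPrime :=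
    Ideal.map_isPrime_of_surjective Ideal.Quotient.mk_surjective hker1
  have : (Q₂.map (Ideal.Quotient.mk (Q₁ ⊓ Q₂))).IsPrime :=
    Ideal.map_isPrime_of_surjective Ideal.Quotient.mk_surjective hker2
  have hc1 := Ideal.comap_map_mk (inf_le_left : Q₁ ⊓ Q₂ ≤ Q₁)
  have hc2 := Ideal.comap_map_mk (inf_le_right : Q₁ ⊓ Q₂ ≤ Q₂)
  have hbot : ∀ Q : Ideal T, (Q.map (Ideal.Quotient.mk (Q₁ ⊓ Q₂))).comap
      (Ideal.Quotient.mk (Q₁ ⊓ Q₂)) = Q → q = Q.comap g →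
      (Q.map (Ideal.Quotient.mk (Q₁ ⊓ Q₂))).comap g' = ⊥ := by
    intro Q hQ hqQ
    refine Ideal.comap_injective_of_surjective _ (Ideal.Quotient.mk_surjective (I := q)) ?_
    rw [Ideal.comap_comap, hcomp, ← Ideal.comap_comap, hQ, ← hqQ, ← RingHom.ker_eq_comap_bot,
      Ideal.mk_ker]
  refine RingHom.SurjectiveOff.bijOn_comap (hg.of_surjective (g := g') (Ideal.Quotient.mk q)
    (Ideal.Quotient.mk (Q₁ ⊓ Q₂)) Ideal.Quotient.mk_surjective hcomp hc1.ge hc2.ge) ?_ ?_ ?_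
    (hbot Q₁ hc1 hq1) (hbot Q₂ hc2 hq2) ?_
  · refine Ideal.comap_injective_of_surjective _
      (Ideal.Quotient.mk_surjective (I := Q₁ ⊓ Q₂)) ?_
    rw [Ideal.comap_inf, hc1, hc2, ← RingHom.ker_eq_comap_bot, Ideal.mk_ker]
  · intro hle
    exact h12 (hc1.symm.le.trans ((Ideal.comap_mono hle).trans hc2.le))
  · intro hle
    exact h21 (hc2.symm.le.trans ((Ideal.comap_mono hle).trans hc1.le))
  · intro P
    rw [← Ideal.comap_le_comap_iff_of_surjective _ (Ideal.Quotient.mk_surjective (I := q)),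
      Ideal.comap_comap, hcomp, ← Ideal.comap_comap]
    have hP : P.map g' = ((P.comap (Ideal.Quotient.mk q)).map g).map
        (Ideal.Quotient.mk (Q₁ ⊓ Q₂)) := by
      rw [Ideal.map_map, ← hcomp, ← Ideal.map_map,
        Ideal.map_comap_of_surjective _ Ideal.Quotient.mk_surjective]
    rw [hP, Ideal.comap_map_mk]
    · exact hc _
    · rw [← hm]
      refine Ideal.map_mono ?_
      exact (Ideal.mk_ker (I := q)).symm.le.trans (Ideal.comap_mono bot_le)

theorem MvPowerSeries.comap_comap_eq_varIdeal {R X B T : Type u} [CommRing R] [CommRing X]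
    [CommRing B] [CommRing T] {ι : R →+* X} {P : Ideal X} (hR : P.comap ι = ⊥) {n : ℕ}
    {p : MvPowerSeries (Fin n) X →+* T} {Q : Ideal T} (hQ : Q.comap p = P.comap constantCoeff)
    {s : MvPowerSeries (Fin n) R →+* B} {g : B →+* T} (hg : g.comp s = p.comp (map ι)) :
    (Q.comap g).comap s = varIdeal (Fin n) R := by
  rw [Ideal.comap_comap, hg, ← Ideal.comap_comap, hQ]
  ext f
  rw [mem_varIdeal_iff, Ideal.mem_comap, Ideal.mem_comap, constantCoeff_map, ← Ideal.mem_comap, hR,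
    Ideal.mem_bot]

theorem MvPowerSeries.map_comap_eq_inf {R X B T : Type u} [CommRing R] [CommRing X]
    [CommRing B] [CommRing T] {ι : R →+* X} {P₁ P₂ : Ideal X} (hR : P₁.comap ι = ⊥)
    (h12 : P₁ ⊓ P₂ = ⊥) {n : ℕ} {p : MvPowerSeries (Fin n) X →+* T} (hp : Function.Surjective p)
    {Q₁ Q₂ : Ideal T} (hQ₁ : Q₁.comap p = P₁.comap constantCoeff)
    (hQ₂ : Q₂.comap p = P₂.comap constantCoeff)
    {s : MvPowerSeries (Fin n) R →+* B} (hs : Function.Surjective s) {g : B →+* T}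
    (hg : g.comp s = p.comp (map ι)) : (Q₁.comap g).map g = Q₁ ⊓ Q₂ := by
  have h1 : (Q₁ ⊓ Q₂).comap p = varIdeal (Fin n) X := by
    rw [Ideal.comap_inf, hQ₁, hQ₂, ← Ideal.comap_inf, h12, ← RingHom.ker_eq_comap_bot,
      ker_constantCoeff]
  rw [← Ideal.map_comap_of_surjective s hs (Q₁.comap g), comap_comap_eq_varIdeal hR hQ₁ hg,
    Ideal.map_map, hg, ← Ideal.map_map, map_varIdeal, ← h1, Ideal.map_comap_of_surjective p hp]

end

theorem statement6
    -- Setting (†)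
    (n k : ℕ) (I : Ideal (MvPowerSeries (Fin n) ℚ)) (hI : I ≠ ⊤)
    (q : Fin k → Ideal (MvPowerSeries (Fin n) ℚ)) (hqinj : Function.Injective q)
    (hqmin : I.minimalPrimes = Set.range q)
    (hqprime : ∀ (D : Type u) [CommRing D] [IsDomain D] [Algebra ℚ D] (i : Fin k),
      ((q i).psExt n D).IsPrime)
    (hqincomp : ∀ (D : Type u) [CommRing D] [IsDomain D] [Algebra ℚ D] (i j : Fin k),
      (q i).psExt n D ≤ (q j).psExt n D ↔ i = j)
    -- `T`: an uncountable local ring containing the rationals with `|T| = |T/M|`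
    (T : Type u) [CommRing T] [IsNoetherianRing T] [IsLocalRing T] [Algebra ℚ T]
    [Uncountable T] (hTcard : Cardinal.mk T = Cardinal.mk (ResidueField T))
    -- `Q₁, Q₂ ∈ Spec T`, incomparable, with `T_{Q₁}` and `T_{Q₂}` catenary
    (Q₁ Q₂ : Ideal T) [Q₁.IsPrime] [Q₂.IsPrime]
    (h12 : ¬Q₁ ≤ Q₂) (h21 : ¬Q₂ ≤ Q₁)
    (hcat₁ : IsCatenaryRing (Localization.AtPrime Q₁))
    (hcat₂ : IsCatenaryRing (Localization.AtPrime Q₂))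
    -- the isomorphism `φ : T ≅ T̄[[y₁, …, yₙ]]/I·T̄[[y₁, …, yₙ]]` carrying `Qᵢ` to
    -- `(Q̄ᵢᵉ, y₁, …, yₙ)/I·T̄[[y₁, …, yₙ]]`
    (φ : T ≃+*
      (MvPowerSeries (Fin n) (T ⧸ (Q₁ ⊓ Q₂)) ⧸ I.psExt n (T ⧸ (Q₁ ⊓ Q₂))))
    (hφ₁ : Q₁.map φ.toRingHom =
      ((Q₁.map (Ideal.Quotient.mk (Q₁ ⊓ Q₂))).constExt n ⊔
        Ideal.span (Set.range
          (MvPowerSeries.X : Fin n → MvPowerSeries (Fin n) (T ⧸ (Q₁ ⊓ Q₂))))).map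
        (Ideal.Quotient.mk (I.psExt n (T ⧸ (Q₁ ⊓ Q₂)))))
    (hφ₂ : Q₂.map φ.toRingHom =
      ((Q₂.map (Ideal.Quotient.mk (Q₁ ⊓ Q₂))).constExt n ⊔
        Ideal.span (Set.range
          (MvPowerSeries.X : Fin n → MvPowerSeries (Fin n) (T ⧸ (Q₁ ⊓ Q₂))))).map
        (Ideal.Quotient.mk (I.psExt n (T ⧸ (Q₁ ⊓ Q₂))))) :
    -- there is an uncountable local subring `(B, B ∩ M)` of `T` containing `ℚ` with:
    ∃ B : Subring T, ∃ hBloc : IsLocalRing ↥B,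
      letI := hBloc
      IsNoetherianRing ↥B ∧ Uncountable ↥B ∧
      Set.range (algebraMap ℚ T) ⊆ (B : Set T) ∧
      maximalIdeal ↥B = (maximalIdeal T).comap B.subtype ∧
      -- (1) the completion of `B` is isomorphic to the completion of `T`
      Nonempty (AdicCompletion (maximalIdeal ↥B) ↥B ≃+*
        AdicCompletion (maximalIdeal T) T) ∧
      -- (2) `|B| = |B/(B ∩ M)|`
      Cardinal.mk ↥B = Cardinal.mk (ResidueField ↥B) ∧
      -- (3) `B ∩ Q₁ = B ∩ Q₂`
      Q₁.comap B.subtype = Q₂.comap B.subtype ∧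
      -- (4) `B_{B ∩ Q₁}` is catenary
      IsCatenaryRing (Localization.AtPrime (Q₁.comap B.subtype)) ∧
      -- (5) `B ≅ R[[y₁, …, yₙ]]/I·R[[y₁, …, yₙ]]` for a domain `R` containing `ℚ`
      (∃ R : Type u, ∃ hR : CommRing R,
        letI := hR
        IsDomain R ∧ ∃ hRQ : Algebra ℚ R,
          letI := hRQ
          Nonempty (↥B ≃+* (MvPowerSeries (Fin n) R ⧸ I.psExt n R))) ∧
      -- (6) `P/(Q₁ ∩ Q₂) ↦ (B ∩ P)/(B ∩ Q₁)` is a bijection between the primes of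
      -- `T/(Q₁ ∩ Q₂)` of positive height and the primes of `B/(B ∩ Q₁)` of positive
      -- height; here `g` is the natural inclusion `B/(B ∩ Q₁) → T/(Q₁ ∩ Q₂)`, so that
      -- this map is `Ideal.comap g`
      (∀ g : (↥B ⧸ Q₁.comap B.subtype) →+* (T ⧸ (Q₁ ⊓ Q₂)),
        (∀ b : ↥B, g (Ideal.Quotient.mk (Q₁.comap B.subtype) b) =
          Ideal.Quotient.mk (Q₁ ⊓ Q₂) (b : T)) →
        Set.BijOn (fun P : Ideal (T ⧸ (Q₁ ⊓ Q₂)) => P.comap g)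
          { P : Ideal (T ⧸ (Q₁ ⊓ Q₂)) | ∃ hP : P.IsPrime,
            0 < Order.height (⟨P, hP⟩ : PrimeSpectrum (T ⧸ (Q₁ ⊓ Q₂))) }
          { p : Ideal (↥B ⧸ Q₁.comap B.subtype) | ∃ hp : p.IsPrime,
            0 < Order.height (⟨p, hp⟩ : PrimeSpectrum (↥B ⧸ Q₁.comap B.subtype)) }) ∧
      -- (7) for `i = 1, 2` there is a coheight-preserving bijection between the
      -- minimal primes of `T_{Qᵢ}` and those of `B_{B ∩ Q₁}`
      (∃ e : { P : Ideal (Localization.AtPrime Q₁) //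
            P ∈ minimalPrimes (Localization.AtPrime Q₁) } ≃
          { p : Ideal (Localization.AtPrime (Q₁.comap B.subtype)) //
            p ∈ minimalPrimes (Localization.AtPrime (Q₁.comap B.subtype)) },
        ∀ P, ringKrullDim (Localization.AtPrime Q₁ ⧸ P.val) =
          ringKrullDim (Localization.AtPrime (Q₁.comap B.subtype) ⧸ (e P).val)) ∧
      (∃ e : { P : Ideal (Localization.AtPrime Q₂) //
            P ∈ minimalPrimes (Localization.AtPrime Q₂) } ≃
          { p : Ideal (Localization.AtPrime (Q₁.comap B.subtype)) //
            p ∈ minimalPrimes (Localization.AtPrime (Q₁.comap B.subtype)) },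
        ∀ P, ringKrullDim (Localization.AtPrime Q₂ ⧸ P.val) =
          ringKrullDim (Localization.AtPrime (Q₁.comap B.subtype) ⧸ (e P).val)) ∧
      -- (8) if `T` is quasi-excellent then so is `B`
      (IsQuasiExcellentRing T → IsQuasiExcellentRing ↥B) := by
  have hM1 : Q₁ ≤ maximalIdeal T := IsLocalRing.le_maximalIdeal Ideal.IsPrime.ne_top'
  have hM2 : Q₂ ≤ maximalIdeal T := IsLocalRing.le_maximalIdeal Ideal.IsPrime.ne_top'
  have h1M : ¬ maximalIdeal T ≤ Q₁ := fun h => h21 (hM2.trans h)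
  have h2M : ¬ maximalIdeal T ≤ Q₂ := fun h => h12 (hM1.trans h)
  have hXloc : IsLocalRing (T ⧸ (Q₁ ⊓ Q₂)) := IsLocalRing.quotient_of_le (inf_le_left.trans hM1)
  have hXnoeth : IsNoetherianRing (T ⧸ (Q₁ ⊓ Q₂)) := inferInstance
  have hqmin' : ∀ 𝔮 ∈ I.minimalPrimes, ∀ (D : Type u) [CommRing D] [IsDomain D] [Algebra ℚ D],
      (𝔮.psExt n D).IsPrime := by
    intro 𝔮 h𝔮 D _ _ _
    rw [hqmin] at h𝔮
    obtain ⟨i, rfl⟩ := h𝔮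
    exact hqprime D i
  have hker1 : RingHom.ker (Ideal.Quotient.mk (Q₁ ⊓ Q₂)) ≤ Q₁ := by
    rw [Ideal.mk_ker]; exact inf_le_left
  have hker2 : RingHom.ker (Ideal.Quotient.mk (Q₁ ⊓ Q₂)) ≤ Q₂ := by
    rw [Ideal.mk_ker]; exact inf_le_right
  have hc1 := Ideal.comap_map_mk (inf_le_left : Q₁ ⊓ Q₂ ≤ Q₁)
  have hc2 := Ideal.comap_map_mk (inf_le_right : Q₁ ⊓ Q₂ ≤ Q₂)
  have hP1 : (Q₁.map (Ideal.Quotient.mk (Q₁ ⊓ Q₂))).IsPrime :=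
    Ideal.map_isPrime_of_surjective Ideal.Quotient.mk_surjective hker1
  have hP2 : (Q₂.map (Ideal.Quotient.mk (Q₁ ⊓ Q₂))).IsPrime :=
    Ideal.map_isPrime_of_surjective Ideal.Quotient.mk_surjective hker2
  have hcard := IsLocalRing.mk_quotient_eq_mk_residueField hTcard (Q₁ ⊓ Q₂)
  have hTu : Cardinal.aleph0 < Cardinal.mk T := Cardinal.aleph0_lt_mk_iff.mpr ‹_›
  have hinf : Q₁.map (Ideal.Quotient.mk (Q₁ ⊓ Q₂)) ⊓ Q₂.map (Ideal.Quotient.mk (Q₁ ⊓ Q₂)) = ⊥ := by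
    refine Ideal.comap_injective_of_surjective _
      (Ideal.Quotient.mk_surjective (I := Q₁ ⊓ Q₂)) ?_
    rw [Ideal.comap_inf, hc1, hc2, ← RingHom.ker_eq_comap_bot, Ideal.mk_ker]
  have hP12 : ¬ Q₁.map (Ideal.Quotient.mk (Q₁ ⊓ Q₂)) ≤ Q₂.map (Ideal.Quotient.mk (Q₁ ⊓ Q₂)) :=
    fun hle => h12 (hc1.symm.le.trans ((Ideal.comap_mono hle).trans hc2.le))
  have hP21 : ¬ Q₂.map (Ideal.Quotient.mk (Q₁ ⊓ Q₂)) ≤ Q₁.map (Ideal.Quotient.mk (Q₁ ⊓ Q₂)) :=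
    fun hle => h21 (hc2.symm.le.trans ((Ideal.comap_mono hle).trans hc1.le))
  have hI1 (P : Ideal (T ⧸ (Q₁ ⊓ Q₂))) : I.psExt n (T ⧸ (Q₁ ⊓ Q₂)) ≤
      P.comap MvPowerSeries.constantCoeff :=
    (MvPowerSeries.psExt_le_varIdeal hI _).trans (MvPowerSeries.varIdeal_le_comap_constantCoeff P)
  rw [MvPowerSeries.constExt_sup_varIdeal] at hφ₁ hφ₂
  have hQ₁ := Ideal.comap_symm_comp_mk_eq φ (hI1 _) hφ₁
  have hQ₂ := Ideal.comap_symm_comp_mk_eq φ (hI1 _) hφ₂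
  have hp : Function.Surjective (φ.symm.toRingHom.comp
      (Ideal.Quotient.mk (I.psExt n (T ⧸ (Q₁ ⊓ Q₂))))) :=
    φ.symm.surjective.comp Ideal.Quotient.mk_surjective
  have hpk : RingHom.ker (φ.symm.toRingHom.comp
      (Ideal.Quotient.mk (I.psExt n (T ⧸ (Q₁ ⊓ Q₂))))) = I.psExt n (T ⧸ (Q₁ ⊓ Q₂)) := by
    ext x
    rw [RingHom.mem_ker, RingHom.comp_apply, ← Ideal.Quotient.eq_zero_iff_mem]
    exact map_eq_zero_iff φ.symm φ.symm.injective
  generalize φ.symm.toRingHom.comp (Ideal.Quotient.mk (I.psExt n (T ⧸ (Q₁ ⊓ Q₂)))) = p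
    at hQ₁ hQ₂ hp hpk
  generalize hgP1 : Q₁.map (Ideal.Quotient.mk (Q₁ ⊓ Q₂)) = P₁ at *
  generalize hgP2 : Q₂.map (Ideal.Quotient.mk (Q₁ ⊓ Q₂)) = P₂ at *
  obtain ⟨R, hR, hRQ⟩ := Subring.exists_isGluing (hcard.1 ▸ hTu) hcard.2 P₁ P₂ hinf
  have hm1 : ¬ maximalIdeal (T ⧸ (Q₁ ⊓ Q₂)) ≤ P₁ := fun hle =>
    hP21 ((IsLocalRing.le_maximalIdeal Ideal.IsPrime.ne_top').trans hle)
  have hm2 : ¬ maximalIdeal (T ⧸ (Q₁ ⊓ Q₂)) ≤ P₂ := fun hle =>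
    hP12 ((IsLocalRing.le_maximalIdeal Ideal.IsPrime.ne_top').trans hle)
  have := hR.isDomain
  have := hR.isLocalRing
  have := hR.isLocalHom
  have := hR.isNoetherianRing
  have hRfl := hR.flat hm1 hm2
  let _ : Algebra ℚ R := ((algebraMap ℚ (T ⧸ (Q₁ ⊓ Q₂))).codRestrict R hRQ).toAlgebra
  let ι : MvPowerSeries (Fin n) R →+* MvPowerSeries (Fin n) (T ⧸ (Q₁ ⊓ Q₂)) :=
    MvPowerSeries.map R.subtype
  have : IsLocalHom ι := MvPowerSeries.map.isLocalHom R.subtype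
  let B : Subring T := (p.comp ι).range
  let s : MvPowerSeries (Fin n) R →+* B := (p.comp ι).rangeRestrict
  have hs : Function.Surjective s := (p.comp ι).rangeRestrict_surjective
  have hgs : B.subtype.comp s = p.comp ι := rfl
  have hsk : RingHom.ker s = I.psExt n R := by
    have h1 : RingHom.ker s = (RingHom.ker p).comap ι := by
      ext x
      rw [RingHom.mem_ker, Ideal.mem_comap, RingHom.mem_ker, ← Subtype.coe_inj]
      rfl
    rw [h1, hpk, ← MvPowerSeries.map_psExt R.subtype]
    exact MvPowerSeries.comap_map_map_eq hRfl _
  have hker : RingHom.ker p = (RingHom.ker s).map ι := by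
    rw [hsk, hpk]
    exact (MvPowerSeries.map_psExt R.subtype I).symm
  have hpl : IsLocalHom p := IsLocalHom.of_surjective p hp
  have hBn : Nontrivial B := inferInstance
  have hsl : IsLocalHom s := IsLocalHom.of_surjective s hs
  have hBloc : IsLocalRing B := IsLocalRing.of_surjective' s hs
  have hBnoeth : IsNoetherianRing B := isNoetherianRing_of_surjective _ _ s hs
  have hgfl : B.subtype.Flat :=
    RingHom.Flat.of_surjective_of_ker_eq (MvPowerSeries.flat_map hRfl) hs hp hgs hker
  have hgl : IsLocalHom B.subtype := by
    refine ⟨fun b hb => ?_⟩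
    obtain ⟨f, rfl⟩ := hs b
    have h1 : IsUnit (p (ι f)) := hb
    exact ((isUnit_of_map_unit ι f (isUnit_of_map_unit p _ h1))).map s
  have hff : Module.FaithfullyFlat B T := by
    have : Module.Flat B T := hgfl
    have : IsLocalHom (algebraMap B T) := hgl
    exact Module.FaithfullyFlat.of_flat_of_isLocalHom
  have hcontr (J : Ideal B) : (J.map B.subtype).comap B.subtype ≤ J :=
    (Ideal.comap_map_eq_self_of_faithfullyFlat (B := T) J).le
  have hoff : B.subtype.SurjectiveOff Q₁ Q₂ :=
    hR.surjectiveOff.mvPowerSeries.of_surjective s p hp hgs hQ₁.ge hQ₂.ge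
  have hBQ : Q₁.comap B.subtype = Q₂.comap B.subtype := by
    refine Ideal.comap_injective_of_surjective s hs ?_
    rw [MvPowerSeries.comap_comap_eq_varIdeal hR.comap_left hQ₁ hgs,
      MvPowerSeries.comap_comap_eq_varIdeal hR.comap_right hQ₂ hgs]
  have hqm : (Q₁.comap B.subtype).map B.subtype = Q₁ ⊓ Q₂ :=
    MvPowerSeries.map_comap_eq_inf hR.comap_left hinf hp hQ₁ hQ₂ hs hgs
  have hmin1 := MvPowerSeries.isPrime_map_localRingHom_of_mem_minimalPrimes hqmin' hinf hP21 hs hsk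
    hp hpk hgs hQ₁ (rfl : Q₁.comap B.subtype = Q₁.comap B.subtype)
  have hmin2 := MvPowerSeries.isPrime_map_localRingHom_of_mem_minimalPrimes hqmin'
    ((inf_comm P₂ P₁).trans hinf) hP12 hs hsk hp hpk hgs hQ₂ hBQ
  have hl1 := Localization.isLocalHom_localRingHom (Q₁.comap B.subtype) Q₁ B.subtype rfl
  have hl2 := Localization.isLocalHom_localRingHom (Q₁.comap B.subtype) Q₂ B.subtype hBQ
  have hfl1 := RingHom.Flat.localRingHom hgfl Q₁ (Q₁.comap B.subtype) rfl
  have hfl2 := RingHom.Flat.localRingHom hgfl Q₂ (Q₁.comap B.subtype) hBQ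
  have hres := hoff.surjective_residueField_map h1M h2M
  have hB1 : Cardinal.mk B ≤ Cardinal.mk T := Cardinal.mk_le_of_injective Subtype.val_injective
  have hB2 : Cardinal.mk T ≤ Cardinal.mk (ResidueField B) :=
    hTcard.le.trans (Cardinal.mk_le_of_surjective hres)
  have hB3 : Cardinal.mk (ResidueField B) ≤ Cardinal.mk B :=
    Cardinal.mk_le_of_surjective residue_surjective
  have hQB : ∀ c : ℚ, algebraMap ℚ T c ∈ B := by
    intro c
    exact ⟨algebraMap ℚ _ c, RingHom.congr_fun
      (Subsingleton.elim ((p.comp ι).comp (algebraMap ℚ _)) (algebraMap ℚ T)) c⟩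
  refine ⟨B, hBloc, hBnoeth, Cardinal.aleph0_lt_mk_iff.mp (hTu.trans_le (hB2.trans hB3)), ?_,
    (IsLocalRing.maximalIdeal_comap B.subtype).symm,
    hoff.exists_adicCompletion_ringEquiv h1M h2M hcontr, (hB1.trans hB2).antisymm hB3, hBQ,
    IsCatenaryRing.of_flat hfl1 hcat₁ hmin1, ⟨R, inferInstance, ‹_›, ‹_›, ?_⟩, fun g hg => ?_,
    exists_minimalPrimes_equiv_of_flat hfl1
      (Localization.map_localRingHom_maximalIdeal Q₂ rfl hqm h21) hmin1,
    exists_minimalPrimes_equiv_of_flat hfl2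
      (Localization.map_localRingHom_maximalIdeal Q₁ hBQ (hqm.trans (inf_comm _ _)) h12) hmin2,
    fun hTqe => ?_⟩
  · rintro _ ⟨c, rfl⟩
    exact hQB c
  · exact ⟨(RingHom.quotientKerEquivOfSurjective hs).symm.trans (Ideal.quotEquivOfEq hsk)⟩
  · exact hoff.bijOn_comap_quotient h12 h21 rfl hBQ hqm hcontr g hg
  · let _ : Algebra ℚ B := ((algebraMap ℚ T).codRestrict B hQB).toAlgebra
    exact IsQuasiExcellentRing.of_flat (A := B) (B := T)
      (hR.hasRegularFibers hinf hP12 hP21 hTqe.2.1 hp hQ₁ hQ₂ hs hgs hker) hTqe
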